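/- There exists n0 ∈ ℕ such that the following holds for all n ≥ n0. Let r, s be nonnegative integers with n = 3r + s and 1 ≤ s ≤ 3. If F1, …, Fn are 3-partite 3-graphs on the same vertex classes V1, V2, V3, each class of size n, and δ1(Fi) > δ(n,r,s) for every i ∈ [n], then {F1, …, Fn} admits a rainbow matching of size n; since such a rainbow matching covers all 3n vertices, it is a rainbow perfect matching. -/

import Mathlib

open Finset

/-- The number of edges of `E` containing the vertex `v` (the vertex degree). -/
def hdeg {α : Type} [DecidableEq α] (E : Finset (Finset α)) (v : α) : ℕ :=
  (E.filter (fun e => v ∈ e)).card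

/-- `E` is the edge set of a 3-partite 3-graph with vertex classes `V1, V2, V3`:
every edge has exactly one vertex in each class. -/
def IsPartite3 {α : Type} [DecidableEq α] (V1 V2 V3 : Finset α)
    (E : Finset (Finset α)) : Prop :=
  ∀ e ∈ E, e ⊆ V1 ∪ V2 ∪ V3 ∧
    (e ∩ V1).card = 1 ∧ (e ∩ V2).card = 1 ∧ (e ∩ V3).card = 1

/-- The degree bound `δ(n,r,s)` from the paper. -/
def deltaLM (n r s : ℕ) : ℕ :=
  if s = 1 then n ^ 2 - (n - r) ^ 2
  else if s = 2 then n ^ 2 - (n - r + 1) * (n - r - 1)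
  else n ^ 2 - (n - r) * (n - r - 1)


open Finset
namespace RPM
open scoped Classical

/-- A matching: distinct members differ in every coordinate. -/
def IsM {n : ℕ} (M : Finset (Fin 4 → Fin n)) : Prop :=
  ∀ e ∈ M, ∀ f ∈ M, e ≠ f → ∀ c, e c ≠ f c

/-- Perfect matching. -/
def HasPM {n : ℕ} (E : Finset (Fin 4 → Fin n)) : Prop :=
  ∃ M ⊆ E, IsM M ∧ M.card = n

lemma IsM.union {n : ℕ} {A B : Finset (Fin 4 → Fin n)} (hA : IsM A) (hB : IsM B)
    (hAB : ∀ a ∈ A, ∀ b ∈ B, ∀ c, a c ≠ b c) : IsM (A ∪ B) := by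
  intro e he f hf hef c
  rcases mem_union.1 he with h | h <;> rcases mem_union.1 hf with h' | h'
  · exact hA e h f h' hef c
  · exact hAB e h f h' c
  · exact (hAB f h' e h c).symm
  · exact hB e h f h' hef c

lemma IsM.mono {n : ℕ} {A B : Finset (Fin 4 → Fin n)} (hB : IsM B) (h : A ⊆ B) : IsM A :=
  fun e he f hf => hB e (h he) f (h hf)

lemma IsM.injOn {n : ℕ} {A : Finset (Fin 4 → Fin n)} (hA : IsM A) (c : Fin 4) :
    Set.InjOn (fun e : Fin 4 → Fin n => e c) A := by
  intro e he f hf h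
  by_contra hne
  exact hA e he f hf hne c h

lemma isM_empty {n : ℕ} : IsM (∅ : Finset (Fin 4 → Fin n)) := by
  intro e he; simp at he

lemma isM_singleton {n : ℕ} (e : Fin 4 → Fin n) : IsM {e} := by
  intro a ha b hb hab
  simp at ha hb; subst ha; subst hb; exact absurd rfl hab

lemma IsM.insert {n : ℕ} {A : Finset (Fin 4 → Fin n)} (hA : IsM A) {e : Fin 4 → Fin n}
    (h : ∀ a ∈ A, ∀ c, a c ≠ e c) : IsM (insert e A) := by
  rw [insert_eq, union_comm]
  exact hA.union (isM_singleton e) (by intro a ha b hb; simp at hb; subst hb; exact h a ha)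

lemma not_mem_of_disj {n : ℕ} {A : Finset (Fin 4 → Fin n)} {e : Fin 4 → Fin n}
    (h : ∀ a ∈ A, ∀ c, a c ≠ e c) : e ∉ A := fun he => h e he 0 rfl

/-- The four swapped edges. -/
def swp {n : ℕ} (T p q r : Fin 4 → Fin n) : Fin 4 → Fin 4 → Fin n :=
  ![![T 0, p 1, q 2, r 3], ![p 0, T 1, r 2, q 3], ![q 0, r 1, T 2, p 3], ![r 0, q 1, p 2, T 3]]

lemma swap_isM {n : ℕ} {M : Finset (Fin 4 → Fin n)} (hM : IsM M) {T p q r : Fin 4 → Fin n}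
    (hp : p ∈ M) (hq : q ∈ M) (hr : r ∈ M) (hpq : p ≠ q) (hpr : p ≠ r) (hqr : q ≠ r)
    (hT : ∀ e ∈ M, ∀ c, e c ≠ T c) :
    IsM ((M \ {p, q, r}) ∪ univ.image (swp T p q r)) ∧
    ((M \ {p, q, r}) ∪ univ.image (swp T p q r)).card = M.card + 1 := by
  have h1 := hM p hp q hq hpq
  have h2 := hM p hp r hr hpr
  have h3 := hM q hq r hr hqr
  have h4 := hT p hp
  have h5 := hT q hq
  have h6 := hT r hr
  have hinj : ∀ a b : Fin 4, a ≠ b → ∀ c, swp T p q r a c ≠ swp T p q r b c := by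
    intro a b hab c
    have e1 := h1 c; have e2 := h2 c; have e3 := h3 c
    have e4 := h4 c; have e5 := h5 c; have e6 := h6 c
    have e1' := e1.symm; have e2' := e2.symm; have e3' := e3.symm
    have e4' := e4.symm; have e5' := e5.symm; have e6' := e6.symm
    fin_cases a <;> fin_cases b <;> first | (exact absurd rfl hab) | (fin_cases c <;> assumption)
  have hcross : ∀ a ∈ M \ {p, q, r}, ∀ b ∈ univ.image (swp T p q r), ∀ c, a c ≠ b c := by
    intro a ha b hb c
    simp only [mem_sdiff, mem_insert, mem_singleton, not_or] at ha
    obtain ⟨haM, n1, n2, n3⟩ := ha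
    have e1 := hM a haM p hp n1 c
    have e2 := hM a haM q hq n2 c
    have e3 := hM a haM r hr n3 c
    have e4 := hT a haM c
    simp only [mem_image, mem_univ, true_and] at hb
    obtain ⟨b', rfl⟩ := hb
    fin_cases b' <;> fin_cases c <;> assumption
  have hinj' : Function.Injective (swp T p q r) := by
    intro a b hab
    by_contra hne
    exact hinj a b hne 0 (congrFun hab 0)
  refine ⟨(hM.mono sdiff_subset).union ?_ hcross, ?_⟩
  · intro e he f hf hef c
    simp only [mem_image, mem_univ, true_and] at he hf
    obtain ⟨a, rfl⟩ := he
    obtain ⟨b, rfl⟩ := hf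
    exact hinj a b (fun h => hef (by rw [h])) c
  · rw [card_union_of_disjoint]
    · rw [card_image_of_injective _ hinj', card_sdiff_of_subset, card_fin]
      · have : ({p, q, r} : Finset (Fin 4 → Fin n)).card = 3 := by
          rw [card_eq_three]; exact ⟨p, q, r, hpq, hpr, hqr, rfl⟩
        have h3 : ({p, q, r} : Finset (Fin 4 → Fin n)).card ≤ M.card := by
          apply card_le_card
          intro x hx; simp at hx; rcases hx with rfl | rfl | rfl <;> assumption
        omega
      · intro x hx; simp at hx; rcases hx with rfl | rfl | rfl <;> assumption
    · rw [disjoint_left]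
      intro a ha hb
      exact hcross a ha a hb 0 rfl

/-- Near-complete 4-partite 4-graphs have perfect matchings. -/
lemma near_complete {n : ℕ} (B : Fin 4 → Finset (Fin n)) (m : ℕ) (hm : 100 ≤ m)
    (hB : ∀ c, (B c).card = m) (E : Finset (Fin 4 → Fin n))
    (hmiss : ∀ c, ∀ v ∈ B c,
      ((Fintype.piFinset B).filter (fun e => e c = v ∧ e ∉ E)).card * 100 ≤ m ^ 3) :
    ∃ M ⊆ E, IsM M ∧ M.card = m ∧ ∀ e ∈ M, ∀ c, e c ∈ B c := by
  let Q : Finset (Finset (Fin 4 → Fin n)) :=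
    ((E ∩ Fintype.piFinset B).powerset).filter IsM
  have hQ : Q.Nonempty := ⟨∅, mem_filter.2 ⟨empty_mem_powerset _, isM_empty⟩⟩
  obtain ⟨M, hMQ, hmax⟩ := exists_max_image Q card hQ
  simp only [Q, mem_filter, mem_powerset] at hMQ
  obtain ⟨hMsub, hM⟩ := hMQ
  have hME : M ⊆ E := hMsub.trans inter_subset_left
  have hMB : ∀ e ∈ M, ∀ c, e c ∈ B c := fun e he c =>
    Fintype.mem_piFinset.1 (mem_of_mem_inter_right (hMsub he)) c
  have himg : ∀ c, (M.image (fun e => e c)).card = M.card := fun c =>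
    card_image_of_injOn (hM.injOn c)
  have himgsub : ∀ c, M.image (fun e => e c) ⊆ B c := by
    intro c x hx
    obtain ⟨e, he, rfl⟩ := mem_image.1 hx
    exact hMB e he c
  have htm : M.card ≤ m := by
    rw [← himg 0, ← hB 0]; exact card_le_card (himgsub 0)
  refine ⟨M, hME, hM, ?_, hMB⟩
  by_contra hne
  have htlt : M.card < m := lt_of_le_of_ne htm hne
  set t := M.card with ht
  let B' : Fin 4 → Finset (Fin n) := fun c => B c \ M.image (fun e => e c)
  have hB' : ∀ c, (B' c).card = m - t := by
    intro c
    simp only [B']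
    rw [card_sdiff_of_subset (himgsub c), hB, himg]
  have hB'ne : ∀ c, (B' c).Nonempty := by
    intro c
    rw [← card_pos, hB']; omega
  choose T hT' using hB'ne
  have hTB : ∀ c, T c ∈ B c := fun c => (mem_sdiff.1 (hT' c)).1
  have hT : ∀ e ∈ M, ∀ c, e c ≠ T c := by
    intro e he c h
    exact (mem_sdiff.1 (hT' c)).2 (mem_image.2 ⟨e, he, h⟩)
  rcases Nat.lt_or_ge (2 * t) m with hcase | hcase
  · -- all tuples of `B'` are missing
    have hsub : (Fintype.piFinset (fun c => if c = 0 then {T 0} else B' c)) ⊆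
        (Fintype.piFinset B).filter (fun e => e 0 = T 0 ∧ e ∉ E) := by
      intro e he
      rw [Fintype.mem_piFinset] at he
      have h0 : e 0 = T 0 := by simpa using he 0
      have hall : ∀ c, e c ∈ B' c := by
        intro c
        by_cases hc : c = 0
        · subst hc; rw [h0]; exact hT' 0
        · simpa [hc] using he c
      rw [mem_filter, Fintype.mem_piFinset]
      refine ⟨fun c => (mem_sdiff.1 (hall c)).1, h0, fun heE => ?_⟩
      have hd : ∀ a ∈ M, ∀ c, a c ≠ e c := by
        intro a ha c h
        exact (mem_sdiff.1 (hall c)).2 (mem_image.2 ⟨a, ha, h⟩)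
      have := hmax (insert e M) (by
        simp only [Q, mem_filter, mem_powerset]
        refine ⟨?_, hM.insert hd⟩
        intro x hx
        rcases mem_insert.1 hx with rfl | hx
        · exact mem_inter.2 ⟨heE, Fintype.mem_piFinset.2 fun c => (mem_sdiff.1 (hall c)).1⟩
        · exact hMsub hx)
      rw [card_insert_of_notMem (not_mem_of_disj hd)] at this
      omega
    have h1 := card_le_card hsub
    rw [Fintype.card_piFinset] at h1
    simp only [Fin.prod_univ_four, Fin.isValue, if_true] at h1
    have h2 := hmiss 0 (T 0) (hTB 0)
    have e1 : (1 : Fin 4) ≠ 0 := by decide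
    have e2 : (2 : Fin 4) ≠ 0 := by decide
    have e3 : (3 : Fin 4) ≠ 0 := by decide
    simp only [e1, e2, e3, if_false, hB', card_singleton, one_mul] at h1
    have h3 : m ≤ 2 * (m - t) := by omega
    have h4 : m ^ 3 ≤ (2 * (m - t)) ^ 3 := Nat.pow_le_pow_left h3 3
    have h5 : 0 < m ^ 3 := by positivity
    nlinarith
  · -- swap
    let TR := M ×ˢ M ×ˢ M
    let bad : Fin 4 → Finset ((Fin 4 → Fin n) × (Fin 4 → Fin n) × (Fin 4 → Fin n)) := fun c =>
      TR.filter (fun x => swp T x.1 x.2.1 x.2.2 c ∉ E)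
    have hswB : ∀ x ∈ TR, ∀ c, swp T x.1 x.2.1 x.2.2 c ∈ Fintype.piFinset B := by
      rintro ⟨p, q, r⟩ hx c
      simp only [TR, mem_product] at hx
      rw [Fintype.mem_piFinset]
      intro c'
      have e1 := hMB p hx.1 c'
      have e2 := hMB q hx.2.1 c'
      have e3 := hMB r hx.2.2 c'
      have e4 := hTB c'
      fin_cases c <;> fin_cases c' <;> assumption
    have hbad : ∀ c, (bad c).card * 100 ≤ m ^ 3 := by
      intro c
      refine le_trans (Nat.mul_le_mul_right _ ?_) (hmiss c (T c) (hTB c))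
      refine card_le_card_of_injOn (fun x => swp T x.1 x.2.1 x.2.2 c) ?_ ?_
      · rintro ⟨p, q, r⟩ hx
        have hx' := (mem_filter.1 hx)
        simp only [coe_filter, Set.mem_ofPred_eq]
        refine ⟨hswB _ hx'.1 c, ?_, hx'.2⟩
        fin_cases c <;> rfl
      · rintro ⟨p, q, r⟩ hx ⟨p', q', r'⟩ hx' h
        have hy := (mem_filter.1 hx).1
        have hy' := (mem_filter.1 hx').1
        simp only [TR, mem_product] at hy hy'
        have key : ∀ a ∈ M, ∀ b ∈ M, ∀ c, a c = b c → a = b := fun a ha b hb c h =>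
          hM.injOn c ha hb h
        simp only at h
        have k0 := congrFun h 0
        have k1 := congrFun h 1
        have k2 := congrFun h 2
        have k3 := congrFun h 3
        simp only [Prod.mk.injEq]
        fin_cases c
        · exact ⟨key _ hy.1 _ hy'.1 1 k1, key _ hy.2.1 _ hy'.2.1 2 k2,
            key _ hy.2.2 _ hy'.2.2 3 k3⟩
        · exact ⟨key _ hy.1 _ hy'.1 0 k0, key _ hy.2.1 _ hy'.2.1 3 k3,
            key _ hy.2.2 _ hy'.2.2 2 k2⟩
        · exact ⟨key _ hy.1 _ hy'.1 3 k3, key _ hy.2.1 _ hy'.2.1 0 k0,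
            key _ hy.2.2 _ hy'.2.2 1 k1⟩
        · exact ⟨key _ hy.1 _ hy'.1 2 k2, key _ hy.2.1 _ hy'.2.1 1 k1,
            key _ hy.2.2 _ hy'.2.2 0 k0⟩
    let D1 := (M ×ˢ M).image (fun x => (x.1, x.1, x.2))
    let D2 := (M ×ˢ M).image (fun x => (x.1, x.2, x.1))
    let D3 := (M ×ˢ M).image (fun x => (x.1, x.2, x.2))
    have hD1 : D1.card ≤ t * t := by
      refine card_image_le.trans ?_; rw [card_product]
    have hD2 : D2.card ≤ t * t := by
      refine card_image_le.trans ?_; rw [card_product]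
    have hD3 : D3.card ≤ t * t := by
      refine card_image_le.trans ?_; rw [card_product]
    have hTR : TR.card = t * (t * t) := by
      simp only [TR, card_product]; rw [ht]
    have hex : ∃ x ∈ TR, x ∉ (bad 0 ∪ bad 1 ∪ bad 2 ∪ bad 3 ∪ D1 ∪ D2 ∪ D3) := by
      by_contra hcon
      push Not at hcon
      have h1 := card_le_card (show TR ⊆ _ from hcon)
      have h2 : (bad 0 ∪ bad 1 ∪ bad 2 ∪ bad 3 ∪ D1 ∪ D2 ∪ D3).card ≤
          (bad 0).card + (bad 1).card + (bad 2).card + (bad 3).card + D1.card + D2.card + D3.card := by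
        refine (card_union_le _ _).trans (Nat.add_le_add_right ?_ _)
        refine (card_union_le _ _).trans (Nat.add_le_add_right ?_ _)
        refine (card_union_le _ _).trans (Nat.add_le_add_right ?_ _)
        refine (card_union_le _ _).trans (Nat.add_le_add_right ?_ _)
        refine (card_union_le _ _).trans (Nat.add_le_add_right ?_ _)
        exact card_union_le _ _
      have b0 := hbad 0
      have b1 := hbad 1
      have b2 := hbad 2
      have b3 := hbad 3
      rw [hTR] at h1
      have h3 : t * (t * t) * 100 ≤ 4 * m ^ 3 + 300 * (t * t) := by
        nlinarith
      have h4 : m ^ 3 ≤ (2 * t) ^ 3 := Nat.pow_le_pow_left hcase 3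
      have h5 : 50 ≤ t := by omega
      nlinarith [Nat.mul_le_mul_right (t * t) h5]
    obtain ⟨⟨p, q, r⟩, hx, hnot⟩ := hex
    have hx' := hx
    simp only [TR, mem_product] at hx
    obtain ⟨hp, hq, hr⟩ := hx
    simp only [mem_union, not_or] at hnot
    obtain ⟨⟨⟨⟨⟨⟨n0, n1⟩, n2⟩, n3⟩, nd1⟩, nd2⟩, nd3⟩ := hnot
    have hpq : p ≠ q := by
      rintro rfl; exact nd1 (mem_image.2 ⟨(p, r), by simp [hp, hr], rfl⟩)
    have hpr : p ≠ r := by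
      rintro rfl; exact nd2 (mem_image.2 ⟨(p, q), by simp [hp, hq], rfl⟩)
    have hqr : q ≠ r := by
      rintro rfl; exact nd3 (mem_image.2 ⟨(p, q), by simp [hp, hq], rfl⟩)
    have hin : ∀ c, swp T p q r c ∈ E := by
      intro c
      have : ∀ c, (p, q, r) ∉ bad c := by
        intro c; fin_cases c <;> assumption
      have := this c
      simp only [bad, mem_filter, not_and, not_not] at this
      exact this hx'
    obtain ⟨h1, h2⟩ := swap_isM hM hp hq hr hpq hpr hqr hT
    have := hmax _ (by
      simp only [Q, mem_filter, mem_powerset]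
      refine ⟨?_, h1⟩
      intro x hx
      rcases mem_union.1 hx with hx | hx
      · exact hMsub (mem_sdiff.1 hx).1
      · obtain ⟨c, _, rfl⟩ := mem_image.1 hx
        exact mem_inter.2 ⟨hin c, hswB _ hx' c⟩)
    omega

end RPM

open Finset
namespace RPM
open scoped Classical

lemma card_fix {n : ℕ} (S : Finset (Fin 4)) (f : Fin 4 → Fin n) :
    ((univ : Finset (Fin 4 → Fin n)).filter (fun e => ∀ c ∈ S, e c = f c)).card
      = n ^ (4 - S.card) := by
  have : ((univ : Finset (Fin 4 → Fin n)).filter (fun e => ∀ c ∈ S, e c = f c)) =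
      Fintype.piFinset (fun c => if c ∈ S then {f c} else univ) := by
    ext e
    simp only [mem_filter, mem_univ, true_and, Fintype.mem_piFinset]
    refine forall_congr' fun c => ?_
    by_cases h : c ∈ S <;> simp [h]
  rw [this, Fintype.card_piFinset]
  have h2 : ∀ c, (if c ∈ S then ({f c} : Finset (Fin n)) else univ).card = if c ∈ S then 1 else n := by
    intro c; by_cases h : c ∈ S <;> simp [h]
  simp only [h2]
  rw [prod_ite]
  simp only [prod_const, one_pow, one_mul]
  congr 1
  rw [filter_not, card_sdiff_of_subset (filter_subset _ _)]
  simp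

lemma card_fix2 {n : ℕ} (c c' : Fin 4) (h : c ≠ c') (v w : Fin n) :
    ((univ : Finset (Fin 4 → Fin n)).filter (fun e => e c = v ∧ e c' = w)).card = n ^ 2 := by
  have := card_fix {c, c'} (fun x => if x = c then v else w)
  rw [card_pair h] at this
  rw [← this]
  congr 1
  ext e
  simp [h.symm]

lemma card_fix1 {n : ℕ} (c : Fin 4) (v : Fin n) :
    ((univ : Finset (Fin 4 → Fin n)).filter (fun e => e c = v)).card = n ^ 3 := by
  have := card_fix {c} (fun x => v)
  rw [card_singleton] at this
  rw [← this]
  congr 1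
  ext e
  simp

lemma card_hit {n : ℕ} (M : Finset (Fin 4 → Fin n)) (c : Fin 4) (v : Fin n) :
    ((univ : Finset (Fin 4 → Fin n)).filter
      (fun e => e c = v ∧ ∃ f ∈ M, ∃ c', c' ≠ c ∧ e c' = f c')).card ≤ 3 * M.card * n ^ 2 := by
  have hsub : ((univ : Finset (Fin 4 → Fin n)).filter
      (fun e => e c = v ∧ ∃ f ∈ M, ∃ c', c' ≠ c ∧ e c' = f c')) ⊆
      (M ×ˢ (univ.erase c)).biUnion (fun x => univ.filter (fun e => e c = v ∧ e x.2 = x.1 x.2)) := by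
    intro e he
    simp only [mem_filter, mem_univ, true_and] at he
    obtain ⟨h1, f, hf, c', hc', h2⟩ := he
    simp only [mem_biUnion, mem_filter, mem_univ, true_and, mem_product, mem_erase]
    exact ⟨(f, c'), ⟨hf, hc', trivial⟩, h1, h2⟩
  refine (card_le_card hsub).trans ?_
  refine (card_biUnion_le_card_mul _ _ (n ^ 2) ?_).trans ?_
  · rintro ⟨f, c'⟩ hx
    simp only [mem_product, mem_erase] at hx
    exact (card_fix2 c c' hx.2.1.symm v (f c')).le
  · rw [card_product, card_erase_of_mem (mem_univ _)]
    simp [mul_comm]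

lemma greedy {n : ℕ} (A : Finset (Fin 4 → Fin n)) (D : Finset (Fin 4 → Fin n)) (hD : IsM D)
    (K : ℕ) (Z : Finset (Fin 4 × Fin n)) (hK : 3 * (D.card + Z.card) * n ^ 2 < K)
    (hZ : ∀ z ∈ Z, K ≤ (A.filter (fun e => e z.1 = z.2)).card) :
    ∃ M, IsM M ∧ D ⊆ M ∧ (∀ e ∈ M, e ∈ D ∨ e ∈ A) ∧ M.card ≤ D.card + Z.card ∧
      ∀ z ∈ Z, ∃ e ∈ M, e z.1 = z.2 := by
  induction Z using Finset.induction_on with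
  | empty => exact ⟨D, hD, Subset.rfl, fun e he => Or.inl he, by simp, by simp⟩
  | insert z Z hz ih =>
    rw [card_insert_of_notMem hz] at hK
    obtain ⟨M, h1, h2, h3, h4, h5⟩ := ih
      (lt_of_le_of_lt (Nat.mul_le_mul_right _ (by omega)) hK)
      (fun z hz => hZ z (mem_insert_of_mem hz))
    rw [card_insert_of_notMem hz]
    by_cases hc : ∃ e ∈ M, e z.1 = z.2
    · refine ⟨M, h1, h2, h3, by omega, ?_⟩
      intro w hw
      rcases mem_insert.1 hw with rfl | hw
      · exact hc
      · exact h5 w hw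
    · have hK2 := hZ z (mem_insert_self _ _)
      have hhit := card_hit M z.1 z.2
      have hlt : ((univ : Finset (Fin 4 → Fin n)).filter
        (fun e => e z.1 = z.2 ∧ ∃ f ∈ M, ∃ c', c' ≠ z.1 ∧ e c' = f c')).card <
          (A.filter (fun e => e z.1 = z.2)).card := by
        refine lt_of_le_of_lt hhit (lt_of_lt_of_le (lt_of_le_of_lt ?_ hK) hK2)
        exact Nat.mul_le_mul_right _ (by omega)
      obtain ⟨e, heA, heN⟩ := exists_mem_notMem_of_card_lt_card hlt
      simp only [mem_filter] at heA
      simp only [mem_filter, mem_univ, true_and, not_and, not_exists] at heN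
      have hd : ∀ a ∈ M, ∀ c, a c ≠ e c := by
        intro a ha c hac
        by_cases hcz : c = z.1
        · subst hcz
          exact hc ⟨a, ha, hac.trans heA.2⟩
        · exact heN heA.2 a ha c hcz hac.symm
      refine ⟨insert e M, h1.insert hd, h2.trans (subset_insert _ _), ?_, ?_, ?_⟩
      · intro x hx
        rcases mem_insert.1 hx with rfl | hx
        · exact Or.inr heA.1
        · exact h3 x hx
      · rw [card_insert_of_notMem (not_mem_of_disj hd)]; omega
      · intro w hw
        rcases mem_insert.1 hw with rfl | hw
        · exact ⟨e, mem_insert_self _ _, heA.2⟩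
        · obtain ⟨x, hx, hx'⟩ := h5 w hw
          exact ⟨x, mem_insert_of_mem hx, hx'⟩

/-- A rainbow matching of size `d` when every colour has many edges and each vertex few. -/
lemma dense_matching {n : ℕ} (A : Finset (Fin 4 → Fin n)) (a b d : ℕ)
    (ha : ∀ i, a ≤ (A.filter (fun e => e 0 = i)).card)
    (hb : ∀ c, c ≠ 0 → ∀ v, (A.filter (fun e => e c = v)).card ≤ b)
    (hd : 3 * d * b < (n - d) * a) : ∃ M ⊆ A, IsM M ∧ M.card = d := by
  let Q : Finset (Finset (Fin 4 → Fin n)) := (A.powerset).filter IsM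
  have hQ : Q.Nonempty := ⟨∅, mem_filter.2 ⟨empty_mem_powerset _, isM_empty⟩⟩
  obtain ⟨M, hMQ, hmax⟩ := exists_max_image Q card hQ
  simp only [Q, mem_filter, mem_powerset] at hMQ
  obtain ⟨hMA, hM⟩ := hMQ
  by_cases hcard : d ≤ M.card
  · obtain ⟨M', h1, h2⟩ := exists_subset_card_eq hcard
    exact ⟨M', h1.trans hMA, hM.mono h1, h2⟩
  exfalso
  push Not at hcard
  let I := M.image (fun e => e 0)
  have hI : I.card = M.card := card_image_of_injOn (hM.injOn 0)
  have h1 : (univ \ I).card * a ≤ (A.filter (fun e => e 0 ∈ univ \ I)).card := by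
    have : A.filter (fun e => e 0 ∈ univ \ I) =
        (univ \ I).biUnion (fun i => A.filter (fun e => e 0 = i)) := by
      ext e; simp [and_comm]
    rw [this, card_biUnion]
    · rw [← smul_eq_mul]; exact card_nsmul_le_sum _ _ _ fun i _ => ha i
    · intro i _ j _ hij
      rw [Function.onFun, disjoint_left]
      intro e he he'
      exact hij ((mem_filter.1 he).2.symm.trans (mem_filter.1 he').2)
  have h2 : (A.filter (fun e => e 0 ∈ univ \ I)) ⊆
      (M ×ˢ (univ.erase (0 : Fin 4))).biUnion (fun x => A.filter (fun e => e x.2 = x.1 x.2)) := by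
    intro e he
    simp only [mem_filter, mem_sdiff, mem_univ, true_and] at he
    by_contra hcon
    simp only [mem_biUnion, mem_product, mem_erase, mem_univ, mem_filter, not_exists, not_and] at hcon
    have hdis : ∀ f ∈ M, ∀ c, f c ≠ e c := by
      intro f hf c hfc
      by_cases hc : c = 0
      · subst hc; exact he.2 (mem_image.2 ⟨f, hf, hfc⟩)
      · exact hcon (f, c) ⟨hf, hc, trivial⟩ he.1 hfc.symm
    have := hmax (insert e M) (by
      simp only [Q, mem_filter, mem_powerset]
      exact ⟨insert_subset he.1 hMA, hM.insert hdis⟩)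
    rw [card_insert_of_notMem (not_mem_of_disj hdis)] at this
    omega
  have h3 := (card_le_card h2).trans (card_biUnion_le_card_mul _ _ b (by
    rintro ⟨f, c⟩ hx
    simp only [mem_product, mem_erase] at hx
    exact hb c hx.2.1 _))
  rw [card_product, card_erase_of_mem (mem_univ _)] at h3
  simp only [card_univ, Fintype.card_fin] at h3
  rw [card_sdiff_of_subset (subset_univ _), hI] at h1
  simp only [card_univ, Fintype.card_fin] at h1
  have h4 : (n - d) * a ≤ (n - M.card) * a := Nat.mul_le_mul_right _ (by omega)
  have h5 : M.card * (4 - 1) * b ≤ 3 * d * b := Nat.mul_le_mul_right _ (by omega)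
  omega

end RPM

open Finset
namespace RPM
open scoped Classical

/-- tuples meeting `W` and the complement of `W` -/
def GG {n : ℕ} (W : Fin 4 → Finset (Fin n)) (e : Fin 4 → Fin n) : Prop :=
  (∃ c, c ≠ 0 ∧ e c ∈ W c) ∧ (∃ c, c ≠ 0 ∧ e c ∉ W c)

lemma split_set {n : ℕ} (S : Finset (Fin n)) (a b : ℕ) (h : S.card = a + b) :
    ∃ A ⊆ S, A.card = a ∧ (S \ A).card = b := by
  obtain ⟨A, h1, h2⟩ := exists_subset_card_eq (show a ≤ S.card by omega)
  exact ⟨A, h1, h2, by rw [card_sdiff_of_subset h1]; omega⟩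

lemma block_one {n : ℕ} (E : Finset (Fin 4 → Fin n)) (W X : Fin 4 → Finset (Fin n))
    (m0 : ℕ) (hm0 : 100 ≤ m0)
    (hmiss : ∀ c, ∀ v ∈ X c,
      ((univ : Finset (Fin 4 → Fin n)).filter (fun e => e c = v ∧ GG W e ∧ e ∉ E)).card * 100 ≤ m0 ^ 3)
    (B : Fin 4 → Finset (Fin n)) (m : ℕ) (hm : m0 ≤ m) (hB : ∀ c, (B c).card = m)
    (hBX : ∀ c, B c ⊆ X c) (hG : ∀ e, (∀ c, e c ∈ B c) → GG W e) :
    ∃ M ⊆ E, IsM M ∧ M.card = m ∧ ∀ e ∈ M, ∀ c, e c ∈ B c := by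
  refine near_complete B m (by omega) hB E ?_
  intro c v hv
  refine le_trans (Nat.mul_le_mul_right _ (card_le_card ?_))
    ((hmiss c v (hBX c hv)).trans (Nat.pow_le_pow_left hm 3))
  intro e he
  simp only [mem_filter, Fintype.mem_piFinset, mem_univ, true_and] at he ⊢
  exact ⟨he.2.1, hG e he.1, he.2.2⟩

lemma blocks {n : ℕ} (E : Finset (Fin 4 → Fin n)) (W X R : Fin 4 → Finset (Fin n)) (n' : ℕ)
    (hX : ∀ c, (X c).card = n') (hR : ∀ c, R c ⊆ X c)
    (hsum : (R 1).card + (R 2).card + (R 3).card = n') (m0 : ℕ) (hm0 : 100 ≤ m0)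
    (hm1 : m0 ≤ (R 1).card) (hm2 : m0 ≤ (R 2).card) (hm3 : m0 ≤ (R 3).card)
    (hRW : ∀ c, R c ⊆ W c) (hX2 : ∀ v ∈ X 2, v ∉ R 2 → v ∉ W 2)
    (hX3 : ∀ v ∈ X 3, v ∉ R 3 → v ∉ W 3)
    (hmiss : ∀ c, ∀ v ∈ X c,
      ((univ : Finset (Fin 4 → Fin n)).filter (fun e => e c = v ∧ GG W e ∧ e ∉ E)).card * 100 ≤ m0 ^ 3) :
    ∃ M ⊆ E, IsM M ∧ M.card = n' ∧ ∀ e ∈ M, ∀ c, e c ∈ X c := by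
  set m1 := (R 1).card with hm1'
  set m2 := (R 2).card with hm2'
  set m3 := (R 3).card with hm3'
  obtain ⟨P1, p1, p2, p3⟩ := split_set (X 0) m1 (m2 + m3) (by rw [hX]; omega)
  obtain ⟨P2, p4, p5, p6⟩ := split_set (X 0 \ P1) m2 m3 p3
  have hs : ∀ c, (X c \ R c).card = n' - (R c).card := by
    intro c; rw [card_sdiff_of_subset (hR c), hX]
  obtain ⟨A1, a1, a2, a3⟩ := split_set (X 1 \ R 1) m2 m3 (by rw [hs]; omega)
  obtain ⟨A2, b1, b2, b3⟩ := split_set (X 2 \ R 2) m1 m3 (by rw [hs]; omega)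
  obtain ⟨A3, d1, d2, d3⟩ := split_set (X 3 \ R 3) m1 m2 (by rw [hs]; omega)
  have nW2 : ∀ v ∈ X 2 \ R 2, v ∉ W 2 := fun v hv => hX2 v (mem_sdiff.1 hv).1 (mem_sdiff.1 hv).2
  have nW3 : ∀ v ∈ X 3 \ R 3, v ∉ W 3 := fun v hv => hX3 v (mem_sdiff.1 hv).1 (mem_sdiff.1 hv).2
  let B1 : Fin 4 → Finset (Fin n) := ![P1, R 1, A2, A3]
  let B2 : Fin 4 → Finset (Fin n) := ![P2, A1, R 2, (X 3 \ R 3) \ A3]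
  let B3 : Fin 4 → Finset (Fin n) := ![(X 0 \ P1) \ P2, (X 1 \ R 1) \ A1, (X 2 \ R 2) \ A2, R 3]
  have hB1X : ∀ c, B1 c ⊆ X c := by
    intro c
    fin_cases c
    · exact p1
    · exact hR 1
    · exact b1.trans sdiff_subset
    · exact d1.trans sdiff_subset
  have hB2X : ∀ c, B2 c ⊆ X c := by
    intro c
    fin_cases c
    · exact p4.trans sdiff_subset
    · exact a1.trans sdiff_subset
    · exact hR 2
    · exact sdiff_subset.trans sdiff_subset
  have hB3X : ∀ c, B3 c ⊆ X c := by
    intro c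
    fin_cases c
    · exact sdiff_subset.trans sdiff_subset
    · exact sdiff_subset.trans sdiff_subset
    · exact sdiff_subset.trans sdiff_subset
    · exact hR 3
  obtain ⟨M1, e1, f1, g1, k1⟩ := block_one E W X m0 hm0 hmiss B1 m1 hm1
    (by intro c; fin_cases c; exacts [p2, rfl, b2, d2]) hB1X
    (by
      intro e he
      exact ⟨⟨1, by decide, hRW 1 (he 1)⟩, ⟨2, by decide, nW2 _ (b1 (he 2))⟩⟩)
  obtain ⟨M2, e2, f2, g2, k2⟩ := block_one E W X m0 hm0 hmiss B2 m2 hm2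
    (by intro c; fin_cases c; exacts [p5, a2, rfl, d3]) hB2X
    (by
      intro e he
      exact ⟨⟨2, by decide, hRW 2 (he 2)⟩, ⟨3, by decide, nW3 _ (mem_sdiff.1 (he 3)).1⟩⟩)
  obtain ⟨M3, e3, f3, g3, k3⟩ := block_one E W X m0 hm0 hmiss B3 m3 hm3
    (by intro c; fin_cases c; exacts [p6, a3, b3, rfl]) hB3X
    (by
      intro e he
      exact ⟨⟨3, by decide, hRW 3 (he 3)⟩, ⟨2, by decide, nW2 _ (mem_sdiff.1 (he 2)).1⟩⟩)
  have q12 : ∀ c, Disjoint (B1 c) (B2 c) := by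
    intro c
    fin_cases c
    · exact disjoint_of_subset_right p4 disjoint_sdiff
    · exact disjoint_of_subset_right a1 disjoint_sdiff
    · exact disjoint_of_subset_left b1 sdiff_disjoint
    · exact disjoint_sdiff
  have q13 : ∀ c, Disjoint (B1 c) (B3 c) := by
    intro c
    fin_cases c
    · exact disjoint_of_subset_right sdiff_subset disjoint_sdiff
    · exact disjoint_of_subset_right sdiff_subset disjoint_sdiff
    · exact disjoint_sdiff
    · exact disjoint_of_subset_left d1 sdiff_disjoint
  have q23 : ∀ c, Disjoint (B2 c) (B3 c) := by
    intro c
    fin_cases c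
    · exact disjoint_sdiff
    · exact disjoint_sdiff
    · exact disjoint_of_subset_right sdiff_subset disjoint_sdiff
    · exact disjoint_of_subset_left sdiff_subset sdiff_disjoint
  have x12 : ∀ a ∈ M1, ∀ b ∈ M2, ∀ c, a c ≠ b c := fun a ha b hb c h =>
    disjoint_left.1 (q12 c) (k1 a ha c) (h ▸ k2 b hb c)
  have x13 : ∀ a ∈ M1, ∀ b ∈ M3, ∀ c, a c ≠ b c := fun a ha b hb c h =>
    disjoint_left.1 (q13 c) (k1 a ha c) (h ▸ k3 b hb c)
  have x23 : ∀ a ∈ M2, ∀ b ∈ M3, ∀ c, a c ≠ b c := fun a ha b hb c h =>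
    disjoint_left.1 (q23 c) (k2 a ha c) (h ▸ k3 b hb c)
  have x123 : ∀ a ∈ M1 ∪ M2, ∀ b ∈ M3, ∀ c, a c ≠ b c := by
    intro a ha b hb c
    rcases mem_union.1 ha with ha | ha
    · exact x13 a ha b hb c
    · exact x23 a ha b hb c
  refine ⟨(M1 ∪ M2) ∪ M3, union_subset (union_subset e1 e2) e3, (f1.union f2 x12).union f3 x123, ?_, ?_⟩
  · rw [card_union_of_disjoint, card_union_of_disjoint, g1, g2, g3, hsum]
    · rw [disjoint_left]; intro a ha hb; exact x12 a ha a hb 0 rfl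
    · rw [disjoint_left]; intro a ha hb; exact x123 a ha a hb 0 rfl
  · intro e he c
    rcases mem_union.1 he with he | he
    · rcases mem_union.1 he with he | he
      · exact hB1X c (k1 e he c)
      · exact hB2X c (k2 e he c)
    · exact hB3X c (k3 e he c)

/-- arithmetic for the number of avoiding edges -/
lemma arith_one (q s d α β : ℤ) (hs : s = 1 ∨ s = 2 ∨ s = 3) (hd : 1 ≤ d)
    (h1 : d - s ≤ 2 * α + β) (h2 : d - s ≤ α + 2 * β)
    (hα : |α| * 100 ≤ q) (hβ : |β| * 100 ≤ q) (hq : 1000 ≤ q) :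
    (if s = 1 then q ^ 2 else if s = 2 then q ^ 2 - 1 else q ^ 2 - q) ≤ (q + α) * (q + β) := by
  have a1 := abs_le.1 (show |α| ≤ q / 100 by omega)
  have a2 := abs_le.1 (show |β| ≤ q / 100 by omega)
  obtain ⟨a1, a1'⟩ := a1
  obtain ⟨a2, a2'⟩ := a2
  have b1 : -q ≤ 100 * α := by omega
  have b1' : 100 * α ≤ q := by omega
  have b2 : -q ≤ 100 * β := by omega
  have b2' : 100 * β ≤ q := by omega
  -- key
  have key : ∀ x y : ℤ, 0 ≤ x → y < 0 → d - s ≤ x + 2 * y → 100 * x ≤ q → -q ≤ 100 * y →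
      (if s = 1 then q ^ 2 else if s = 2 then q ^ 2 - 1 else q ^ 2 - q) ≤ (q + x) * (q + y) := by
    intro x y hx hy hxy k1 k2
    rcases hs with rfl | rfl | rfl
    · simp
      nlinarith
    · simp
      rcases eq_or_ne y (-1) with rfl | hy1
      · rcases eq_or_ne x 1 with rfl | hx1
        · nlinarith
        · have : 2 ≤ x := by omega
          nlinarith
      · have : y ≤ -2 := by omega
        have : 1 ≤ x + y := by omega
        nlinarith
    · simp
      rcases eq_or_ne y (-1) with rfl | hy1
      · nlinarith
      · have : y ≤ -2 := by omega
        have : 0 ≤ x + y := by omega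
        nlinarith
  rcases lt_or_ge β 0 with hb | hb
  · rcases lt_or_ge α 0 with ha | ha
    · rcases hs with rfl | rfl | rfl
      · omega
      · omega
      · omega
    · exact key α β ha hb h2 b1' b2
  · rcases lt_or_ge α 0 with ha | ha
    · rw [mul_comm]; exact key β α hb ha (by linarith) b2' b1
    · rcases hs with rfl | rfl | rfl <;> simp <;> nlinarith [mul_nonneg ha hb]

lemma arith_two (q s d α β : ℤ) (hs : s = 1 ∨ s = 2 ∨ s = 3) (hd : 2 ≤ d)
    (h1 : d - s ≤ 2 * α + β) (h2 : d - s ≤ α + 2 * β)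
    (hsp : ¬ (s = 2 ∧ d = 2 ∧ α = 0 ∧ β = 0))
    (hα : |α| * 100 ≤ q) (hβ : |β| * 100 ≤ q) (hq : 1000 ≤ q) :
    (if s = 1 then q ^ 2 else if s = 2 then q ^ 2 - 1 else q ^ 2 - q) * 10 + d * q ≤
      (q + α) * (q + β) * 10 := by
  have a1 := abs_le.1 (show |α| ≤ q / 100 by omega)
  have a2 := abs_le.1 (show |β| ≤ q / 100 by omega)
  obtain ⟨a1, a1'⟩ := a1
  obtain ⟨a2, a2'⟩ := a2
  have b1 : -q ≤ 100 * α := by omega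
  have b1' : 100 * α ≤ q := by omega
  have b2 : -q ≤ 100 * β := by omega
  have b2' : 100 * β ≤ q := by omega
  have key : ∀ x y : ℤ, 0 ≤ x → y < 0 → d - s ≤ x + 2 * y → 100 * x ≤ q → -q ≤ 100 * y →
      (if s = 1 then q ^ 2 else if s = 2 then q ^ 2 - 1 else q ^ 2 - q) * 10 + d * q ≤ (q + x) * (q + y) * 10 := by
    intro x y hx hy hxy k1 k2
    have hxy' : -(x * y) * 100 ≤ (-y) * q := by nlinarith
    rcases hs with rfl | rfl | rfl
    · simp
      have e1 : 0 ≤ (x + y - (d - 1) + y) * q := mul_nonneg (by linarith) (by linarith)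
      have e2 : 0 ≤ (-y - 1) * q := mul_nonneg (by linarith) (by linarith)
      have e3 : 0 ≤ (d - 2) * q := mul_nonneg (by linarith) (by linarith)
      nlinarith
    · simp
      have e1 : 0 ≤ (x + y - (d - 2) + y) * q := mul_nonneg (by linarith) (by linarith)
      have e2 : 0 ≤ (-y - 1) * q := mul_nonneg (by linarith) (by linarith)
      have e3 : 0 ≤ (d - 2) * q := mul_nonneg (by linarith) (by linarith)
      nlinarith
    · simp
      have e1 : 0 ≤ (x + y - (d - 3) + y) * q := mul_nonneg (by linarith) (by linarith)
      have e2 : 0 ≤ (-y - 1) * q := mul_nonneg (by linarith) (by linarith)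
      have e3 : 0 ≤ (d - 2) * q := mul_nonneg (by linarith) (by linarith)
      nlinarith
  rcases lt_or_ge β 0 with hb | hb
  · rcases lt_or_ge α 0 with ha | ha
    · rcases hs with rfl | rfl | rfl
      · omega
      · omega
      · omega
    · exact key α β ha hb h2 b1' b2
  · rcases lt_or_ge α 0 with ha | ha
    · rw [mul_comm (q + α)]; exact key β α hb ha (by linarith) b2' b1
    · have hab := mul_nonneg ha hb
      have e3 : 0 ≤ (d - 2) * q := mul_nonneg (by linarith) (by linarith)
      have e4 : 0 ≤ (3 * (α + β) - 2 * (d - s)) * q := mul_nonneg (by linarith) (by linarith)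
      rcases hs with rfl | rfl | rfl
      · simp; nlinarith
      · simp
        have : 1 ≤ α + β := by omega
        have e5 : 0 ≤ (α + β - 1) * q := mul_nonneg (by linarith) (by linarith)
        nlinarith
      · simp
        have e5 : 0 ≤ (α + β) * q := mul_nonneg (by linarith) (by linarith)
        nlinarith

end RPM

open Finset
namespace RPM
open scoped Classical

lemma exists_avoid {n : ℕ} (S : Finset (Fin n)) (h : 3 ≤ S.card) (a b : Fin n) :
    ∃ x ∈ S, x ≠ a ∧ x ≠ b := by
  have : ({a, b} : Finset (Fin n)).card < S.card := lt_of_le_of_lt card_le_two (by omega)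
  obtain ⟨x, hx, hx'⟩ := exists_mem_notMem_of_card_lt_card this
  simp at hx'
  exact ⟨x, hx, hx'.1, hx'.2⟩

lemma two_edges {n : ℕ} {A : Finset (Fin 4 → Fin n)} {c : Fin 4} {v i : Fin n}
    (h : 2 ≤ (A.filter (fun e => e 0 = i ∧ e c = v)).card) :
    ∃ e ∈ A, ∃ f ∈ A, e ≠ f ∧ e 0 = i ∧ e c = v ∧ f 0 = i ∧ f c = v := by
  obtain ⟨e, he, f, hf, hef⟩ := one_lt_card.1 (show 1 < _ from h)
  simp only [mem_filter] at he hf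
  exact ⟨e, he.1, f, hf.1, hef, he.2.1, he.2.2, hf.2.1, hf.2.2⟩

lemma ext4 {n : ℕ} {e f : Fin 4 → Fin n} (h0 : e 0 = f 0) (h1 : e 1 = f 1) (h2 : e 2 = f 2)
    (h3 : e 3 = f 3) : e = f := by
  funext c; fin_cases c <;> assumption

lemma special_star {n : ℕ} (A : Finset (Fin 4 → Fin n)) (Y : Fin 4 → Finset (Fin n)) (hn : 3 ≤ n)
    (hY : ∀ c, 3 ≤ (Y c).card)
    (h : ∀ c, c ≠ 0 → ∀ v ∈ Y c, ∀ i, 2 ≤ (A.filter (fun e => e 0 = i ∧ e c = v)).card)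
    (c c' : Fin 4) (hc : c ≠ 0)
    (nod : ∀ e ∈ A, ∀ f ∈ A, e 0 ≠ f 0 → e 1 ≠ f 1 → (e c = f c ∨ e c' = f c'))
    (hext : ∀ e f : Fin 4 → Fin n, e 0 = f 0 → e 1 = f 1 → e c = f c → e c' = f c' → e = f)
    (e f : Fin 4 → Fin n) (he : e ∈ A) (hf : f ∈ A) (h0 : e 0 = f 0) (h1 : e 1 = f 1)
    (h2 : e c = f c) (h3 : e c' ≠ f c') : False := by
  have claim : ∀ e ∈ A, ∀ f ∈ A, e 0 = f 0 → e 1 = f 1 → e c = f c → e c' ≠ f c' →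
      ∀ g ∈ A, g 0 ≠ e 0 → g 1 ≠ e 1 → g c = e c := by
    intro e he f hf h0 h1 h2 h3 g hg g0 g1
    rcases nod g hg e he g0 g1 with k | k
    · exact k
    · rcases nod g hg f hf (h0 ▸ g0) (h1 ▸ g1) with k' | k'
      · rw [h2]; exact k'
      · exact absurd (k.symm.trans k') h3
  obtain ⟨y, hy, hye, -⟩ := exists_avoid (Y c) (hY c) (e c) (e c)
  obtain ⟨k, -, hke, -⟩ := exists_avoid (univ : Finset (Fin n)) (by simpa using hn) (e 0) (e 0)
  obtain ⟨g, hg, _, -, -, g0, gc, -, -⟩ := two_edges (h c hc y hy k)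
  obtain ⟨j, -, hj1, hj2⟩ := exists_avoid (univ : Finset (Fin n)) (by simpa using hn) (e 0) k
  obtain ⟨x, hx, hx1, hx2⟩ := exists_avoid (Y 1) (hY 1) (e 1) (g 1)
  obtain ⟨a, ha, b, hb, hab, a0, a1, b0, b1⟩ := two_edges (h 1 (by decide) x hx j)
  have ca := claim e he f hf h0 h1 h2 h3 a ha (a0 ▸ hj1) (a1 ▸ hx1)
  have cb := claim e he f hf h0 h1 h2 h3 b hb (b0 ▸ hj1) (b1 ▸ hx1)
  have hab3 : a c' ≠ b c' := fun hh =>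
    hab (hext a b (a0.trans b0.symm) (a1.trans b1.symm) (ca.trans cb.symm) hh)
  have := claim a ha b hb (a0.trans b0.symm) (a1.trans b1.symm) (ca.trans cb.symm) hab3 g hg
    (by rw [g0, a0]; exact hj2.symm) (by rw [a1]; exact hx2.symm)
  exact hye (gc.symm.trans (this.trans ca))

lemma special {n : ℕ} (A : Finset (Fin 4 → Fin n)) (Y : Fin 4 → Finset (Fin n)) (hn : 3 ≤ n)
    (hY : ∀ c, 3 ≤ (Y c).card)
    (h : ∀ c, c ≠ 0 → ∀ v ∈ Y c, ∀ i, 2 ≤ (A.filter (fun e => e 0 = i ∧ e c = v)).card) :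
    ∃ M ⊆ A, IsM M ∧ M.card = 2 := by
  by_contra hcon
  have nod : ∀ e ∈ A, ∀ f ∈ A, e 0 ≠ f 0 → e 1 ≠ f 1 → (e 2 = f 2 ∨ e 3 = f 3) := by
    intro e he f hf h0 h1
    by_contra hh
    push Not at hh
    apply hcon
    have hef : ∀ c, e c ≠ f c := by
      intro c; fin_cases c
      exacts [h0, h1, hh.1, hh.2]
    refine ⟨{e, f}, by intro x hx; simp at hx; rcases hx with rfl | rfl <;> assumption, ?_, ?_⟩
    · refine (isM_singleton f).insert ?_
      intro a ha c; simp at ha; subst ha; exact (hef c).symm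
    · exact card_pair fun hh => h0 (congrFun hh 0)
  have i : Fin n := ⟨0, by omega⟩
  obtain ⟨x, hx, -, -⟩ := exists_avoid (Y 1) (hY 1) i i
  obtain ⟨e, he, f, hf, hef, e0, e1, f0, f1⟩ := two_edges (h 1 (by decide) x hx i)
  by_cases h2 : e 2 = f 2
  · refine special_star A Y hn hY h 2 3 (by decide) nod (fun e f a b c d => ext4 a b c d)
      e f he hf (e0.trans f0.symm) (e1.trans f1.symm) h2 ?_
    exact fun h3 => hef (ext4 (e0.trans f0.symm) (e1.trans f1.symm) h2 h3)
  by_cases h3 : e 3 = f 3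
  · exact special_star A Y hn hY h 3 2 (by decide)
      (fun e he f hf a b => (nod e he f hf a b).symm) (fun e f a b c d => ext4 a b d c)
      e f he hf (e0.trans f0.symm) (e1.trans f1.symm) h3 h2
  have key : ∀ g ∈ A, g 0 ≠ i → g 1 ≠ x → (g 2 = e 2 ∧ g 3 = f 3) ∨ (g 2 = f 2 ∧ g 3 = e 3) := by
    intro g hg g0 g1
    rcases nod g hg e he (e0 ▸ g0) (e1 ▸ g1) with k | k <;>
      rcases nod g hg f hf (f0 ▸ g0) (f1 ▸ g1) with k' | k'
    · exact absurd (k.symm.trans k') h2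
    · exact Or.inl ⟨k, k'⟩
    · exact Or.inr ⟨k', k⟩
    · exact absurd (k.symm.trans k') h3
  obtain ⟨j, -, hj, -⟩ := exists_avoid (univ : Finset (Fin n)) (by simpa using hn) i i
  obtain ⟨k, -, hk, hkj⟩ := exists_avoid (univ : Finset (Fin n)) (by simpa using hn) i j
  obtain ⟨x2, hx2, hxx, -⟩ := exists_avoid (Y 1) (hY 1) x x
  obtain ⟨x3, hx3, hx31, hx32⟩ := exists_avoid (Y 1) (hY 1) x x2
  have ex : ∀ j x', j ≠ i → x' ≠ x → x' ∈ Y 1 → (∃ g ∈ A, g 0 = j ∧ g 1 = x' ∧ g 2 = e 2 ∧ g 3 = f 3) ∧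
      (∃ g ∈ A, g 0 = j ∧ g 1 = x' ∧ g 2 = f 2 ∧ g 3 = e 3) := by
    intro j x' hj hx' hxY
    obtain ⟨a, ha, b, hb, hab, a0, a1, b0, b1⟩ := two_edges (h 1 (by decide) x' hxY j)
    rcases key a ha (a0 ▸ hj) (a1 ▸ hx') with ka | ka <;>
      rcases key b hb (b0 ▸ hj) (b1 ▸ hx') with kb | kb
    · exact absurd (ext4 (a0.trans b0.symm) (a1.trans b1.symm) (ka.1.trans kb.1.symm) (ka.2.trans kb.2.symm)) hab
    · exact ⟨⟨a, ha, a0, a1, ka⟩, ⟨b, hb, b0, b1, kb⟩⟩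
    · exact ⟨⟨b, hb, b0, b1, kb⟩, ⟨a, ha, a0, a1, ka⟩⟩
    · exact absurd (ext4 (a0.trans b0.symm) (a1.trans b1.symm) (ka.1.trans kb.1.symm) (ka.2.trans kb.2.symm)) hab
  obtain ⟨⟨g, hg, g0, g1, g2, g3⟩, -⟩ := ex j x2 hj hxx hx2
  obtain ⟨-, ⟨g', hg', g0', g1', g2', g3'⟩⟩ := ex k x3 hk hx31 hx3
  rcases nod g hg g' hg' (by rw [g0, g0']; exact hkj.symm) (by rw [g1, g1']; exact hx32.symm) with t | t
  · rw [g2, g2'] at t; exact h2 t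
  · rw [g3, g3'] at t; exact h3 t.symm

end RPM

open Finset
namespace RPM
open scoped Classical

lemma card_box {n : ℕ} (B0 B1 B2 B3 : Finset (Fin n)) :
    ((univ : Finset (Fin 4 → Fin n)).filter
      (fun e => e 0 ∈ B0 ∧ e 1 ∈ B1 ∧ e 2 ∈ B2 ∧ e 3 ∈ B3)).card
      = B0.card * B1.card * B2.card * B3.card := by
  have : ((univ : Finset (Fin 4 → Fin n)).filter
      (fun e => e 0 ∈ B0 ∧ e 1 ∈ B1 ∧ e 2 ∈ B2 ∧ e 3 ∈ B3)) =
      Fintype.piFinset ![B0, B1, B2, B3] := by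
    ext e
    simp only [mem_filter, mem_univ, true_and, Fintype.mem_piFinset, Fin.forall_fin_succ]
    simp
  rw [this, Fintype.card_piFinset, Fin.prod_univ_four]
  rfl

/-- `(c,c1,c2)` is one of the three listings of the vertex classes -/
def Trip (c c1 c2 : Fin 4) : Prop :=
  (c = 1 ∧ c1 = 2 ∧ c2 = 3) ∨ (c = 2 ∧ c1 = 1 ∧ c2 = 3) ∨ (c = 3 ∧ c1 = 1 ∧ c2 = 2)

lemma trip_exists (c : Fin 4) (hc : c ≠ 0) : ∃ c1 c2, Trip c c1 c2 := by
  unfold Trip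
  revert c; decide

lemma Trip.forall {c c1 c2 : Fin 4} (h : Trip c c1 c2) {P : Fin 4 → Prop} (h0 : P c) (h1 : P c1)
    (h2 : P c2) : ∀ x, x ≠ 0 → P x := by
  intro x hx
  rcases h with ⟨rfl, rfl, rfl⟩ | ⟨rfl, rfl, rfl⟩ | ⟨rfl, rfl, rfl⟩ <;> fin_cases x <;>
    first | exact absurd rfl hx | assumption

lemma Trip.ne {c c1 c2 : Fin 4} (h : Trip c c1 c2) : c ≠ 0 ∧ c1 ≠ 0 ∧ c2 ≠ 0 := by
  rcases h with ⟨rfl, rfl, rfl⟩ | ⟨rfl, rfl, rfl⟩ | ⟨rfl, rfl, rfl⟩ <;> decide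

lemma Trip.ne' {c c1 c2 : Fin 4} (h : Trip c c1 c2) : c1 ≠ c ∧ c2 ≠ c ∧ c1 ≠ c2 := by
  rcases h with ⟨rfl, rfl, rfl⟩ | ⟨rfl, rfl, rfl⟩ | ⟨rfl, rfl, rfl⟩ <;> decide

lemma Trip.sum {c c1 c2 : Fin 4} (h : Trip c c1 c2) (f : Fin 4 → ℕ) :
    f 1 + f 2 + f 3 = f c + f c1 + f c2 := by
  rcases h with ⟨rfl, rfl, rfl⟩ | ⟨rfl, rfl, rfl⟩ | ⟨rfl, rfl, rfl⟩ <;> omega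

lemma card_trip {n : ℕ} {c c1 c2 : Fin 4} (h : Trip c c1 c2) (I A B C : Finset (Fin n)) :
    ((univ : Finset (Fin 4 → Fin n)).filter
      (fun e => e 0 ∈ I ∧ e c ∈ A ∧ e c1 ∈ B ∧ e c2 ∈ C)).card
      = I.card * A.card * B.card * C.card := by
  rcases h with ⟨rfl, rfl, rfl⟩ | ⟨rfl, rfl, rfl⟩ | ⟨rfl, rfl, rfl⟩
  · exact card_box I A B C
  · rw [show I.card * A.card * B.card * C.card = I.card * B.card * A.card * C.card by ring,
      ← card_box]
    congr 1; ext e; simp; tauto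
  · rw [show I.card * A.card * B.card * C.card = I.card * B.card * C.card * A.card by ring,
      ← card_box]
    congr 1; ext e; simp; tauto

/-- complement of the degree bound -/
def kap (q s : ℕ) : ℕ := if s = 1 then q ^ 2 else if s = 2 then (q + 1) * (q - 1) else q * (q - 1)

/-- avoiding edges -/
def Av {n : ℕ} (E : Finset (Fin 4 → Fin n)) (U : Fin 4 → Finset (Fin n)) : Finset (Fin 4 → Fin n) :=
  E.filter (fun e => ∀ c, c ≠ 0 → e c ∉ U c)

lemma avoid_deg {n : ℕ} (E : Finset (Fin 4 → Fin n)) (κ : ℕ)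
    (hmis : ∀ c, c ≠ 0 → ∀ i v,
      ((univ : Finset (Fin 4 → Fin n)).filter (fun e => e 0 = i ∧ e c = v ∧ e ∉ E)).card + 1 ≤ κ)
    (U : Fin 4 → Finset (Fin n)) {c c1 c2 : Fin 4} (h : Trip c c1 c2) (i v : Fin n) (hv : v ∉ U c) :
    (n - (U c1).card) * (n - (U c2).card) + 1 ≤
      ((Av E U).filter (fun e => e 0 = i ∧ e c = v)).card + κ := by
  have h1 := card_trip h {i} {v} (U c1)ᶜ (U c2)ᶜ
  simp only [card_singleton, one_mul, card_compl, Fintype.card_fin] at h1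
  rw [← h1]
  have h2 : ((univ : Finset (Fin 4 → Fin n)).filter
      (fun e => e 0 ∈ ({i} : Finset (Fin n)) ∧ e c ∈ ({v} : Finset (Fin n)) ∧ e c1 ∈ (U c1)ᶜ ∧ e c2 ∈ (U c2)ᶜ)) ⊆
      ((Av E U).filter (fun e => e 0 = i ∧ e c = v)) ∪
      ((univ : Finset (Fin 4 → Fin n)).filter (fun e => e 0 = i ∧ e c = v ∧ e ∉ E)) := by
    intro e he
    simp only [mem_filter, mem_univ, true_and, mem_singleton, mem_compl] at he
    rw [mem_union, mem_filter, mem_filter]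
    by_cases heE : e ∈ E
    · left
      refine ⟨mem_filter.2 ⟨heE, ?_⟩, he.1, he.2.1⟩
      exact h.forall (P := fun c => e c ∉ U c) (by rw [he.2.1]; exact hv) he.2.2.1 he.2.2.2
    · right
      exact ⟨mem_univ _, he.1, he.2.1, heE⟩
  have h3 := (card_le_card h2).trans (card_union_le _ _)
  have h4 := hmis c h.ne.1 i v
  omega

lemma arith_fin (n d y q z a0 b : ℕ) (hn : 10000 ≤ n) (hd : 1 ≤ d) (q1 : n ≤ 2 * y)
    (q2 : d * q ≤ 10 * a0 + 9) (q3 : n ≤ 2 * z) (q4 : n ≤ 2 * q) (hb : b * 10000 ≤ n ^ 3) :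
    3 * d * b < z * (y * a0) := by
  have q5 : d * n ≤ 21 * a0 := by
    have h1 : d * n ≤ d * (2 * q) := Nat.mul_le_mul_left _ q4
    have h2 : 1 * 10000 ≤ d * n := Nat.mul_le_mul hd hn
    have h3 : d * (2 * q) = 2 * (d * q) := by ring
    omega
  have q6 : n * (n * (d * n)) ≤ (2 * z) * ((2 * y) * (21 * a0)) :=
    Nat.mul_le_mul q3 (Nat.mul_le_mul q1 q5)
  have q7 : d * (b * 10000) ≤ d * n ^ 3 := Nat.mul_le_mul_left _ hb
  have q8 : 0 < d * n ^ 3 := by positivity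
  have q9 : n * (n * (d * n)) = d * n ^ 3 := by ring
  have q10 : (2 * z) * ((2 * y) * (21 * a0)) = 84 * (z * (y * a0)) := by ring
  have q11 : 3 * d * b = 3 * (d * b) := by ring
  have q12 : d * (b * 10000) = 10000 * (d * b) := by ring
  omega

lemma D_matching {n : ℕ} (E : Finset (Fin 4 → Fin n)) (r s : ℕ) (hn : n = 3 * r + s) (hs1 : 1 ≤ s)
    (hs3 : s ≤ 3) (hbig : 10000 ≤ n)
    (hmis : ∀ c, c ≠ 0 → ∀ i v,
      ((univ : Finset (Fin 4 → Fin n)).filter (fun e => e 0 = i ∧ e c = v ∧ e ∉ E)).card + 1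
        ≤ kap (n - r) s)
    (U : Fin 4 → Finset (Fin n)) (d : ℕ) (hd1 : 1 ≤ d)
    (hd : (U 1).card + (U 2).card + (U 3).card + d = n) (hdn : d * 1000 ≤ n)
    (hU : ∀ c, c ≠ 0 → |((U c).card : ℤ) - r| * 1000 ≤ n) (b : ℕ) (hb : b * 10000 ≤ n ^ 3)
    (hbd : ∀ c, c ≠ 0 → ∀ v, ((Av E U).filter (fun e => e c = v)).card ≤ b) :
    ∃ M ⊆ Av E U, IsM M ∧ M.card = d := by
  obtain ⟨c, hc, hmax⟩ := exists_max_image (univ.erase (0 : Fin 4)) (fun c => (U c).card)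
    ⟨1, by decide⟩
  have hc0 : c ≠ 0 := (mem_erase.1 hc).1
  obtain ⟨c1, c2, hT⟩ := trip_exists c hc0
  have m1 := hmax c1 (mem_erase.2 ⟨hT.ne.2.1, mem_univ _⟩)
  have m2 := hmax c2 (mem_erase.2 ⟨hT.ne.2.2, mem_univ _⟩)
  have hsum := hT.sum (fun c => (U c).card)
  rw [hsum] at hd
  have u0 := hU c hT.ne.1
  have u1 := hU c1 hT.ne.2.1
  have u2 := hU c2 hT.ne.2.2
  set x0 := (U c).card with hx0
  set x1 := (U c1).card with hx1
  set x2 := (U c2).card with hx2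
  have hdeg : ∀ i v, v ∉ U c → (n - x1) * (n - x2) + 1 ≤
      ((Av E U).filter (fun e => e 0 = i ∧ e c = v)).card + kap (n - r) s :=
    fun i v hv => avoid_deg E _ hmis U hT i v hv
  have hx0' : x0 * 2 ≤ n := by
    have := (abs_le.1 (show |(x0 : ℤ) - r| ≤ n / 1000 by omega)).2
    omega
  have hkap : ((kap (n - r) s : ℕ) : ℤ) = (if (s : ℤ) = 1 then ((n - r : ℕ) : ℤ) ^ 2 else
      if (s : ℤ) = 2 then ((n - r : ℕ) : ℤ) ^ 2 - 1 else ((n - r : ℕ) : ℤ) ^ 2 - ((n - r : ℕ) : ℤ)) := by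
    obtain ⟨q, hq⟩ : ∃ q, n - r = q + 1 := ⟨n - r - 1, by omega⟩
    rw [hq]
    have : s = 1 ∨ s = 2 ∨ s = 3 := by omega
    rcases this with rfl | rfl | rfl <;> simp [kap] <;> ring
  have hs' : (s : ℤ) = 1 ∨ (s : ℤ) = 2 ∨ (s : ℤ) = 3 := by omega
  have e1 : ((n - x1 : ℕ) : ℤ) = ((n - r : ℕ) : ℤ) + ((r : ℤ) - x1) := by
    have := (abs_le.1 (show |(x1 : ℤ) - r| ≤ n / 1000 by omega)).2
    omega
  have e2 : ((n - x2 : ℕ) : ℤ) = ((n - r : ℕ) : ℤ) + ((r : ℤ) - x2) := by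
    have := (abs_le.1 (show |(x2 : ℤ) - r| ≤ n / 1000 by omega)).2
    omega
  have g1 : |(r : ℤ) - x1| * 100 ≤ ((n - r : ℕ) : ℤ) := by rw [abs_sub_comm]; omega
  have g2 : |(r : ℤ) - x2| * 100 ≤ ((n - r : ℕ) : ℤ) := by rw [abs_sub_comm]; omega
  have ncol : ∃ v, v ∉ U c := by
    by_contra hcon
    push Not at hcon
    have : U c = univ := eq_univ_iff_forall.2 hcon
    rw [this] at hx0
    simp at hx0
    omega
  rcases Nat.lt_or_ge d 2 with hd2 | hd2
  · -- d = 1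
    have hd' : d = 1 := by omega
    have ha := arith_one ((n - r : ℕ) : ℤ) s d ((r : ℤ) - x1) ((r : ℤ) - x2) hs' (by omega)
      (by omega) (by omega) g1 g2 (by omega)
    rw [← hkap, ← e1, ← e2] at ha
    have ha' : kap (n - r) s ≤ (n - x1) * (n - x2) := by exact_mod_cast ha
    obtain ⟨v, hv⟩ := ncol
    have := hdeg ⟨0, by omega⟩ v hv
    have hpos : 0 < ((Av E U).filter (fun e => e 0 = ⟨0, by omega⟩ ∧ e c = v)).card := by omega
    obtain ⟨e, he⟩ := card_pos.1 hpos
    exact ⟨{e}, by simpa using (mem_filter.1 he).1, isM_singleton e, by simp [hd']⟩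
  by_cases hsp : ((s : ℤ) = 2 ∧ (d : ℤ) = 2 ∧ (r : ℤ) - x1 = 0 ∧ (r : ℤ) - x2 = 0)
  · obtain ⟨k1, k2, k3, k4⟩ := hsp
    have hall : ∀ c, c ≠ 0 → (U c).card = r :=
      hT.forall (P := fun c => (U c).card = r) (by omega) (by omega) (by omega)
    have hd' : d = 2 := by omega
    rw [hd']
    refine special (Av E U) (fun c => if c = 0 then univ else (U c)ᶜ) (by omega) ?_ ?_
    · intro c'
      by_cases h0 : c' = 0
      · simp [h0]; omega
      · simp only [h0, if_false, card_compl, Fintype.card_fin, hall c' h0]; omega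
    · intro c' h0 v hv i
      simp only [h0, if_false, mem_compl] at hv
      obtain ⟨c1', c2', hT'⟩ := trip_exists c' h0
      have := avoid_deg E _ hmis U hT' i v hv
      rw [hall _ hT'.ne.2.1, hall _ hT'.ne.2.2] at this
      have hs2 : s = 2 := by omega
      obtain ⟨q, hq⟩ : ∃ q, n - r = q + 1 := ⟨n - r - 1, by omega⟩
      rw [hq, hs2] at this
      simp [kap] at this
      nlinarith
  · have ha := arith_two ((n - r : ℕ) : ℤ) s d ((r : ℤ) - x1) ((r : ℤ) - x2) hs' (by omega)
      (by omega) (by omega) hsp g1 g2 (by omega)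
    rw [← hkap, ← e1, ← e2] at ha
    have ha' : kap (n - r) s * 10 + d * (n - r) ≤ (n - x1) * (n - x2) * 10 := by exact_mod_cast ha
    set a0 := d * (n - r) / 10 with ha0
    have hdeg' : ∀ i v, v ∉ U c → a0 ≤ ((Av E U).filter (fun e => e 0 = i ∧ e c = v)).card := by
      intro i v hv
      have := hdeg i v hv
      omega
    refine dense_matching (Av E U) ((n - x0) * a0) b d ?_ hbd ?_
    · intro i
      have hsub : ((U c)ᶜ).biUnion (fun v => (Av E U).filter (fun e => e 0 = i ∧ e c = v)) ⊆
          (Av E U).filter (fun e => e 0 = i) := by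
        intro e he
        simp only [mem_biUnion, mem_filter] at he
        obtain ⟨v, _, h1, h2, _⟩ := he
        exact mem_filter.2 ⟨h1, h2⟩
      refine le_trans ?_ (card_le_card hsub)
      rw [card_biUnion]
      · have : (n - x0) = ((U c)ᶜ).card := by rw [card_compl, Fintype.card_fin]
        rw [this, ← smul_eq_mul]
        exact card_nsmul_le_sum _ _ _ fun v hv => hdeg' i v (mem_compl.1 hv)
      · intro v _ w _ hvw
        rw [Function.onFun, disjoint_left]
        intro e he he'
        exact hvw ((mem_filter.1 he).2.2.symm.trans (mem_filter.1 he').2.2)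
    · exact arith_fin n d (n - x0) (n - r) (n - d) a0 b hbig hd1 (by omega) (by omega) (by omega) (by omega) hb

end RPM

open Finset
namespace RPM
open scoped Classical

lemma fibre_lower {α β : Type} [DecidableEq β] (S : Finset α) (T : Finset β) (f : α → β) (a : ℝ)
    (h : ∀ b ∈ T, a ≤ ((S.filter (fun x => f x = b)).card : ℝ)) : (T.card : ℝ) * a ≤ S.card := by
  calc (T.card : ℝ) * a ≤ ∑ b ∈ T, ((S.filter (fun x => f x = b)).card : ℝ) := by
        rw [← nsmul_eq_mul]; exact card_nsmul_le_sum _ _ _ h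
    _ = (((S.filter (fun x => f x ∈ T)).card : ℕ) : ℝ) := by
        rw [← sum_card_fiberwise_eq_card_filter]; push_cast; rfl
    _ ≤ S.card := by exact_mod_cast card_le_card (filter_subset _ _)

/-- missing `GG` tuples -/
noncomputable def Miss {n : ℕ} (E : Finset (Fin 4 → Fin n)) (W : Fin 4 → Finset (Fin n)) : Finset (Fin 4 → Fin n) :=
  univ.filter (fun e => GG W e ∧ e ∉ E)

lemma miss_c {n : ℕ} (E : Finset (Fin 4 → Fin n)) (κ : ℕ)
    (hmis : ∀ c, c ≠ 0 → ∀ i v,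
      ((univ : Finset (Fin 4 → Fin n)).filter (fun e => e 0 = i ∧ e c = v ∧ e ∉ E)).card + 1 ≤ κ)
    (W : Fin 4 → Finset (Fin n)) {c c1 c2 : Fin 4} (h : Trip c c1 c2) :
    ((univ : Finset (Fin 4 → Fin n)).filter
      (fun e => e ∉ E ∧ e c ∉ W c ∧ (e c1 ∈ W c1 ∨ e c2 ∈ W c2))).card +
      n * (n - (W c).card) * (n - (W c1).card) * (n - (W c2).card) ≤
      n * (n - (W c).card) * κ + (Av E W).card := by
  set S1 := ((univ : Finset (Fin 4 → Fin n)).filter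
      (fun e => e ∉ E ∧ e c ∉ W c ∧ (e c1 ∈ W c1 ∨ e c2 ∈ W c2)))
  set S2 := ((univ : Finset (Fin 4 → Fin n)).filter
      (fun e => e 0 ∈ (univ : Finset (Fin n)) ∧ e c ∈ (W c)ᶜ ∧ e c1 ∈ (W c1)ᶜ ∧ e c2 ∈ (W c2)ᶜ))
  set S3 := ((univ : Finset (Fin 4 → Fin n)).filter (fun e => e ∉ E ∧ e c ∉ W c))
  have hS2 : S2.card = n * (n - (W c).card) * (n - (W c1).card) * (n - (W c2).card) := by
    rw [card_trip h, card_compl, card_compl, card_compl]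
    simp
  have hS3 : S3.card ≤ κ * ((univ : Finset (Fin n)) ×ˢ (W c)ᶜ).card := by
    refine card_le_mul_card_image_of_maps_to (f := fun e => (e 0, e c)) ?_ _ ?_
    · intro e he
      simp only [S3, coe_filter, mem_filter, mem_univ, true_and] at he
      simp [he.2]
    · rintro ⟨i, v⟩ -
      refine le_trans (card_le_card ?_) ((Nat.le_succ _).trans (hmis c h.ne.1 i v))
      intro e he
      simp only [S3, mem_filter, mem_univ, true_and, Prod.mk.injEq] at he ⊢
      exact ⟨he.2.1, he.2.2, he.1.1⟩
  rw [card_product, card_compl] at hS3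
  simp only [card_univ, Fintype.card_fin] at hS3
  have hcup : S1.card + (S2 \ Av E W).card ≤ S3.card := by
    rw [← card_union_of_disjoint]
    · apply card_le_card
      intro e he
      rcases mem_union.1 he with he | he
      · simp only [S1, S3, mem_filter, mem_univ, true_and] at he ⊢
        exact ⟨he.1, he.2.1⟩
      · simp only [S2, S3, mem_sdiff, mem_filter, mem_univ, true_and, mem_compl] at he ⊢
        refine ⟨fun hE => he.2 (mem_filter.2 ⟨hE, ?_⟩), he.1.1⟩
        exact h.forall (P := fun c => e c ∉ W c) he.1.1 he.1.2.1 he.1.2.2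
    · rw [disjoint_left]
      intro e he he'
      simp only [S1, S2, mem_sdiff, mem_filter, mem_univ, true_and, mem_compl] at he he'
      rcases he.2.2 with k | k
      · exact he'.1.2.1 k
      · exact he'.1.2.2 k
  have h4 := le_card_sdiff (Av E W) S2
  rw [← hS2]
  have : n * (n - (W c).card) * κ = κ * (n * (n - (W c).card)) := by ring
  omega

/-- basic hypotheses on the extremal sets -/
structure ExtH (n r s : ℕ) (E : Finset (Fin 4 → Fin n)) (W : Fin 4 → Finset (Fin n)) : Prop where
  hn : n = 3 * r + s
  hs1 : 1 ≤ s
  hs3 : s ≤ 3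
  big : 10 ^ 16 ≤ n
  hmis : ∀ c, c ≠ 0 → ∀ i v,
      ((univ : Finset (Fin 4 → Fin n)).filter (fun e => e 0 = i ∧ e c = v ∧ e ∉ E)).card + 1
        ≤ kap (n - r) s
  hW : ∀ c, c ≠ 0 → |3 * ((W c).card : ℝ) - n| * 10 ^ 12 ≤ n
  hav : ((Av E W).card : ℝ) * 10 ^ 12 ≤ n ^ 4

variable {n r s : ℕ} {E : Finset (Fin 4 → Fin n)} {W : Fin 4 → Finset (Fin n)}

lemma ExtH.Wb (H : ExtH n r s E W) (c : Fin 4) (hc : c ≠ 0) :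
    ((W c).card : ℝ) * 3 ≤ n * (1 + 1 / 10 ^ 12) ∧ n * (1 - 1 / 10 ^ 12) ≤ ((W c).card : ℝ) * 3 := by
  have h := H.hW c hc
  have h2 : |3 * ((W c).card : ℝ) - n| ≤ n / 10 ^ 12 := by
    rw [le_div_iff₀ (by positivity)]; exact h
  rw [abs_le] at h2
  constructor <;> linarith [h2.1, h2.2]

lemma card_le_n (S : Finset (Fin n)) : S.card ≤ n := by
  simpa using card_le_univ S

lemma ExtH.kapb (H : ExtH n r s E W) : ((kap (n - r) s : ℕ) : ℝ) ≤ n ^ 2 * (4 / 9 + 1 / 10 ^ 14) := by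
  have h1 : kap (n - r) s ≤ (n - r) ^ 2 := by
    unfold kap
    obtain ⟨q, hq⟩ : ∃ q, n - r = q + 1 := ⟨n - r - 1, by have := H.hn; have := H.big; omega⟩
    rw [hq]
    split_ifs
    · exact le_rfl
    · simp; nlinarith
    · simp; nlinarith
  have h2 : ((n - r : ℕ) : ℝ) * 3 ≤ 2 * n + 3 := by
    have : (n - r) * 3 ≤ 2 * n + 3 := by have := H.hn; have := H.hs3; omega
    exact_mod_cast this
  have h3 : ((kap (n - r) s : ℕ) : ℝ) ≤ ((n - r : ℕ) : ℝ) ^ 2 := by exact_mod_cast h1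
  have h4 : (10 : ℝ) ^ 16 ≤ n := by exact_mod_cast H.big
  have h5 : (0 : ℝ) ≤ ((n - r : ℕ) : ℝ) := by positivity
  nlinarith

lemma ExtH.compl (H : ExtH n r s E W) (c : Fin 4) (hc : c ≠ 0) :
    ((n - (W c).card : ℕ) : ℝ) * 3 ≤ n * (2 + 1 / 10 ^ 12) ∧
      n * (2 - 1 / 10 ^ 12) ≤ ((n - (W c).card : ℕ) : ℝ) * 3 := by
  have h := H.Wb c hc
  rw [Nat.cast_sub (card_le_n _)]
  constructor <;> linarith [h.1, h.2]

lemma ExtH.miss_c (H : ExtH n r s E W) {c c1 c2 : Fin 4} (h : Trip c c1 c2) :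
    (((univ : Finset (Fin 4 → Fin n)).filter
      (fun e => e ∉ E ∧ e c ∉ W c ∧ (e c1 ∈ W c1 ∨ e c2 ∈ W c2))).card : ℝ) ≤ n ^ 4 * (3 / 10 ^ 12) := by
  have h1 := RPM.miss_c E _ H.hmis W h
  set S := ((univ : Finset (Fin 4 → Fin n)).filter
      (fun e => e ∉ E ∧ e c ∉ W c ∧ (e c1 ∈ W c1 ∨ e c2 ∈ W c2))).card
  have h1' : (S : ℝ) + n * ((n - (W c).card : ℕ) : ℝ) * ((n - (W c1).card : ℕ) : ℝ) * ((n - (W c2).card : ℕ) : ℝ)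
    ≤ n * ((n - (W c).card : ℕ) : ℝ) * ((kap (n - r) s : ℕ) : ℝ) + ((Av E W).card : ℝ) := by
    exact_mod_cast h1
  have k := H.kapb
  have a0 := H.compl c h.ne.1
  have a1 := H.compl c1 h.ne.2.1
  have a2 := H.compl c2 h.ne.2.2
  have hav := H.hav
  have h4 : (10 : ℝ) ^ 16 ≤ n := by exact_mod_cast H.big
  set N : ℝ := (n : ℝ)
  set x : ℝ := ((n - (W c).card : ℕ) : ℝ)
  set y : ℝ := ((n - (W c1).card : ℕ) : ℝ)
  set z : ℝ := ((n - (W c2).card : ℕ) : ℝ)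
  set κ : ℝ := ((kap (n - r) s : ℕ) : ℝ)
  have hx : 0 ≤ x := by positivity
  have hy : 0 ≤ y := by positivity
  have hN : 0 ≤ N := by positivity
  have hxN : x ≤ N := by linarith [a0.1]
  have hyz : N ^ 2 * (4 / 9 - 1 / 10 ^ 12) ≤ y * z := by
    have : (N * (2 - 1 / 10 ^ 12)) * (N * (2 - 1 / 10 ^ 12)) ≤ (y * 3) * (z * 3) :=
      mul_le_mul a1.2 a2.2 (by positivity) (by positivity)
    nlinarith
  have h5 : N * x * (κ - y * z) ≤ N * N * (N ^ 2 * (11 / 10 / 10 ^ 12)) := by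
    have hN2 : 0 ≤ N ^ 2 := by positivity
    have e1 : κ - y * z ≤ N ^ 2 * (11 / 10 / 10 ^ 12) := by linarith
    calc N * x * (κ - y * z) ≤ N * x * (N ^ 2 * (11 / 10 / 10 ^ 12)) :=
          mul_le_mul_of_nonneg_left e1 (by positivity)
      _ ≤ _ := by
          apply mul_le_mul_of_nonneg_right _ (by positivity)
          exact mul_le_mul_of_nonneg_left hxN hN
  have h6 : ((Av E W).card : ℝ) ≤ N ^ 4 * (1 / 10 ^ 12) := by linarith
  have h7 : N * N * (N ^ 2 * (11 / 10 / 10 ^ 12)) = N ^ 4 * (11 / 10 / 10 ^ 12) := by ring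
  have h8 : (0 : ℝ) ≤ N ^ 4 := by positivity
  linarith

lemma ExtH.miss (H : ExtH n r s E W) : ((Miss E W).card : ℝ) ≤ n ^ 4 * (1 / 10 ^ 11) := by
  have h1 := H.miss_c (c := 1) (c1 := 2) (c2 := 3) (Or.inl ⟨rfl, rfl, rfl⟩)
  have h2 := H.miss_c (c := 2) (c1 := 1) (c2 := 3) (Or.inr (Or.inl ⟨rfl, rfl, rfl⟩))
  have h3 := H.miss_c (c := 3) (c1 := 1) (c2 := 2) (Or.inr (Or.inr ⟨rfl, rfl, rfl⟩))
  set S1 := ((univ : Finset (Fin 4 → Fin n)).filter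
      (fun e => e ∉ E ∧ e 1 ∉ W 1 ∧ (e 2 ∈ W 2 ∨ e 3 ∈ W 3)))
  set S2 := ((univ : Finset (Fin 4 → Fin n)).filter
      (fun e => e ∉ E ∧ e 2 ∉ W 2 ∧ (e 1 ∈ W 1 ∨ e 3 ∈ W 3)))
  set S3 := ((univ : Finset (Fin 4 → Fin n)).filter
      (fun e => e ∉ E ∧ e 3 ∉ W 3 ∧ (e 1 ∈ W 1 ∨ e 2 ∈ W 2)))
  have hsub : Miss E W ⊆ S1 ∪ S2 ∪ S3 := by
    intro e he
    simp only [Miss, mem_filter, mem_univ, true_and] at he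
    obtain ⟨⟨⟨a, ha, ha'⟩, ⟨b, hb, hb'⟩⟩, hE⟩ := he
    simp only [S1, S2, S3, mem_union, mem_filter, mem_univ, true_and]
    have hall : (e 1 ∈ W 1 ∨ e 2 ∈ W 2 ∨ e 3 ∈ W 3) := by
      fin_cases a
      exacts [absurd rfl ha, Or.inl ha', Or.inr (Or.inl ha'), Or.inr (Or.inr ha')]
    have hall' : (e 1 ∉ W 1 ∨ e 2 ∉ W 2 ∨ e 3 ∉ W 3) := by
      fin_cases b
      exacts [absurd rfl hb, Or.inl hb', Or.inr (Or.inl hb'), Or.inr (Or.inr hb')]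
    tauto
  have h4 : (Miss E W).card ≤ S1.card + S2.card + S3.card :=
    (card_le_card hsub).trans ((card_union_le _ _).trans (Nat.add_le_add_right (card_union_le _ _) _))
  have h5 : ((Miss E W).card : ℝ) ≤ S1.card + S2.card + S3.card := by exact_mod_cast h4
  have h8 : (0 : ℝ) ≤ (n : ℝ) ^ 4 := by positivity
  linarith

/-- missing degree -/
noncomputable def md (E : Finset (Fin 4 → Fin n)) (W : Fin 4 → Finset (Fin n)) (c : Fin 4) (v : Fin n) : ℕ :=
  ((univ : Finset (Fin 4 → Fin n)).filter (fun e => e c = v ∧ GG W e ∧ e ∉ E)).card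

noncomputable def atyp (E : Finset (Fin 4 → Fin n)) (W : Fin 4 → Finset (Fin n)) (c : Fin 4) : Finset (Fin n) :=
  univ.filter (fun v => n ^ 3 < 10 ^ 4 * md E W c v)

noncomputable def hiS (E : Finset (Fin 4 → Fin n)) (W : Fin 4 → Finset (Fin n)) (c : Fin 4) (v : Fin n) :
    Finset (Fin 4 → Fin n) :=
  E.filter (fun e => e c = v ∧ ∀ c', c' ≠ 0 → c' ≠ c → e c' ∉ W c')

noncomputable def UU (E : Finset (Fin 4 → Fin n)) (W : Fin 4 → Finset (Fin n)) (c : Fin 4) : Finset (Fin n) :=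
  univ.filter (fun v => c ≠ 0 ∧ n ^ 3 ≤ 10 ^ 5 * (hiS E W c v).card)

lemma card_add_card_sdiff_comm' (A B : Finset (Fin n)) :
    A.card + (B \ A).card = B.card + (A \ B).card := by
  have h1 := card_sdiff_add_card B A
  have h2 := card_sdiff_add_card A B
  rw [union_comm] at h2
  omega

lemma ExtH.atyp_card (H : ExtH n r s E W) (c : Fin 4) : ((atyp E W c).card : ℝ) * 10 ^ 7 ≤ n := by
  have h1 : ((atyp E W c).card : ℝ) * ((n : ℝ) ^ 3 / 10 ^ 4) ≤ (Miss E W).card := by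
    refine fibre_lower (Miss E W) (atyp E W c) (fun e => e c) _ ?_
    intro v hv
    simp only [atyp, mem_filter, mem_univ, true_and] at hv
    have h2 : ((n : ℝ)) ^ 3 < 10 ^ 4 * (md E W c v : ℝ) := by exact_mod_cast hv
    have h3 : md E W c v ≤ ((Miss E W).filter (fun e => e c = v)).card := by
      refine card_le_card ?_
      intro e he
      simp only [Miss, mem_filter, mem_univ, true_and] at he ⊢
      exact ⟨he.2, he.1⟩
    have h4 : (md E W c v : ℝ) ≤ ((Miss E W).filter (fun e => e c = v)).card := by exact_mod_cast h3
    linarith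
  have h2 := H.miss
  have h4 : (10 : ℝ) ^ 16 ≤ n := by exact_mod_cast H.big
  have h5 : (0 : ℝ) < (n : ℝ) ^ 3 := by positivity
  have h6 : (n : ℝ) ^ 3 * (((atyp E W c).card : ℝ) * 10 ^ 7) ≤ (n : ℝ) ^ 3 * n := by nlinarith
  exact le_of_mul_le_mul_left h6 h5

lemma ExtH.UW_card (H : ExtH n r s E W) (c : Fin 4) : ((UU E W c \ W c).card : ℝ) * 10 ^ 7 ≤ n := by
  have h1 : ((UU E W c \ W c).card : ℝ) * ((n : ℝ) ^ 3 / 10 ^ 5) ≤ (Av E W).card := by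
    refine fibre_lower (Av E W) (UU E W c \ W c) (fun e => e c) _ ?_
    intro v hv
    simp only [UU, mem_sdiff, mem_filter, mem_univ, true_and] at hv
    have h2 : ((n : ℝ)) ^ 3 ≤ 10 ^ 5 * ((hiS E W c v).card : ℝ) := by exact_mod_cast hv.1.2
    have h3 : (hiS E W c v).card ≤ ((Av E W).filter (fun e => e c = v)).card := by
      refine card_le_card ?_
      intro e he
      simp only [hiS, Av, mem_filter] at he ⊢
      refine ⟨⟨he.1, fun c' hc' => ?_⟩, he.2.1⟩
      by_cases h : c' = c
      · subst h; rw [he.2.1]; exact hv.2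
      · exact he.2.2 c' hc' h
    have h4 : ((hiS E W c v).card : ℝ) ≤ ((Av E W).filter (fun e => e c = v)).card := by exact_mod_cast h3
    linarith
  have h2 := H.hav
  have h4 : (10 : ℝ) ^ 16 ≤ n := by exact_mod_cast H.big
  have h5 : (0 : ℝ) < (n : ℝ) ^ 3 := by positivity
  have h6 : (n : ℝ) ^ 3 * (((UU E W c \ W c).card : ℝ) * 10 ^ 7) ≤ (n : ℝ) ^ 3 * n := by nlinarith
  exact le_of_mul_le_mul_left h6 h5

lemma ExtH.WU_sub (H : ExtH n r s E W) (c : Fin 4) (hc : c ≠ 0) : W c \ UU E W c ⊆ atyp E W c := by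
  intro v hv
  by_contra hat
  simp only [UU, atyp, mem_sdiff, mem_filter, mem_univ, true_and, not_and, not_le, not_lt] at hv hat
  obtain ⟨hvW, hvU⟩ := hv
  have hvU := hvU hc
  obtain ⟨c1, c2, hT⟩ := trip_exists c hc
  have h1 := card_trip hT (univ : Finset (Fin n)) {v} (W c1)ᶜ (W c2)ᶜ
  set S := ((univ : Finset (Fin 4 → Fin n)).filter
      (fun e => e 0 ∈ (univ : Finset (Fin n)) ∧ e c ∈ ({v} : Finset (Fin n)) ∧ e c1 ∈ (W c1)ᶜ ∧ e c2 ∈ (W c2)ᶜ))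
  have hsub : S ⊆ hiS E W c v ∪ univ.filter (fun e => e c = v ∧ GG W e ∧ e ∉ E) := by
    intro e he
    simp only [S, mem_filter, mem_univ, true_and, mem_singleton, mem_compl] at he
    rw [mem_union]
    by_cases hE : e ∈ E
    · left
      refine mem_filter.2 ⟨hE, he.1, ?_⟩
      intro c' h0 hne
      exact hT.forall (P := fun c' => c' ≠ c → e c' ∉ W c') (fun h => absurd rfl h)
        (fun _ => he.2.1) (fun _ => he.2.2) c' h0 hne
    · right
      refine mem_filter.2 ⟨mem_univ _, he.1, ⟨⟨c, hc, by rw [he.1]; exact hvW⟩, ⟨c1, hT.ne.2.1, he.2.1⟩⟩, hE⟩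
  have h2 : S.card ≤ (hiS E W c v).card + md E W c v := (card_le_card hsub).trans (card_union_le _ _)
  rw [h1] at h2
  simp only [card_univ, Fintype.card_fin, card_singleton, mul_one, card_compl] at h2
  have h2' : (n : ℝ) * ((n - (W c1).card : ℕ) : ℝ) * ((n - (W c2).card : ℕ) : ℝ) ≤
      (hiS E W c v).card + md E W c v := by exact_mod_cast h2
  have a1 := (H.compl c1 hT.ne.2.1).2
  have a2 := (H.compl c2 hT.ne.2.2).2
  have h4 : (10 : ℝ) ^ 16 ≤ n := by exact_mod_cast H.big
  have b1 : (10 : ℝ) ^ 5 * ((hiS E W c v).card : ℝ) < (n : ℝ) ^ 3 := by exact_mod_cast hvU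
  have b2 : (10 : ℝ) ^ 4 * (md E W c v : ℝ) ≤ (n : ℝ) ^ 3 := by exact_mod_cast hat
  set N : ℝ := (n : ℝ)
  set y : ℝ := ((n - (W c1).card : ℕ) : ℝ)
  set z : ℝ := ((n - (W c2).card : ℕ) : ℝ)
  have hN : 0 < N := by positivity
  have c1' : N * (1 / 2) ≤ y := by linarith
  have c2' : N * (1 / 2) ≤ z := by linarith
  have h5 : (N * (1 / 2)) * (N * (1 / 2)) ≤ y * z :=
    mul_le_mul c1' c2' (by positivity) (by positivity)
  have h6 : N * ((N * (1 / 2)) * (N * (1 / 2))) ≤ N * (y * z) := mul_le_mul_of_nonneg_left h5 hN.le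
  have h7 : (0 : ℝ) < N ^ 3 := by positivity
  nlinarith

lemma ExtH.WU_card (H : ExtH n r s E W) (c : Fin 4) (hc : c ≠ 0) :
    ((W c \ UU E W c).card : ℝ) * 10 ^ 7 ≤ n := by
  refine le_trans ?_ (H.atyp_card c)
  have := card_le_card (H.WU_sub c hc)
  have : ((W c \ UU E W c).card : ℝ) ≤ (atyp E W c).card := by exact_mod_cast this
  linarith

lemma ExtH.U_card (H : ExtH n r s E W) (c : Fin 4) (hc : c ≠ 0) :
    ((UU E W c).card : ℝ) * 3 ≤ n * (1 + 4 / 10 ^ 7) ∧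
      n * (1 - 4 / 10 ^ 7) ≤ ((UU E W c).card : ℝ) * 3 := by
  have h1 : (UU E W c).card + (W c \ UU E W c).card = (W c).card + (UU E W c \ W c).card :=
    card_add_card_sdiff_comm' _ _
  have h1' : ((UU E W c).card : ℝ) + (W c \ UU E W c).card = (W c).card + (UU E W c \ W c).card := by
    exact_mod_cast h1
  have a := H.UW_card c
  have b := H.WU_card c hc
  have d := H.Wb c hc
  have h4 : (10 : ℝ) ^ 16 ≤ n := by exact_mod_cast H.big
  have e1 : (0 : ℝ) ≤ (W c \ UU E W c).card := by positivity
  have e2 : (0 : ℝ) ≤ (UU E W c \ W c).card := by positivity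
  constructor <;> linarith [d.1, d.2]

end RPM

open Finset
namespace RPM
open scoped Classical
variable {n r s : ℕ} {E : Finset (Fin 4 → Fin n)} {W : Fin 4 → Finset (Fin n)}

lemma card_fix_in (c c' : Fin 4) (h : c ≠ c') (v : Fin n) (S : Finset (Fin n)) :
    ((univ : Finset (Fin 4 → Fin n)).filter (fun e => e c = v ∧ e c' ∈ S)).card ≤ n ^ 2 * S.card := by
  refine card_le_mul_card_image_of_maps_to (f := fun e => e c') ?_ _ ?_
  · intro e he
    exact (mem_filter.1 he).2.2
  · intro w _
    rw [← card_fix2 c c' h v w]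
    apply card_le_card
    intro e he
    simp only [mem_filter, mem_univ, true_and] at he ⊢
    exact ⟨he.1.1, he.2⟩

lemma card_fix_in2 {c c1 c2 : Fin 4} (h : Trip c c1 c2) (v : Fin n) (S : Fin 4 → Finset (Fin n)) (a : ℝ)
    (hS : ∀ c, c ≠ 0 → ((S c).card : ℝ) ≤ a) :
    (((univ : Finset (Fin 4 → Fin n)).filter (fun e => e c = v ∧ (e c1 ∈ S c1 ∨ e c2 ∈ S c2))).card : ℝ)
      ≤ 2 * a * n ^ 2 := by
  have h1 := card_fix_in c c1 h.ne'.1.symm v (S c1)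
  have h2 := card_fix_in c c2 h.ne'.2.1.symm v (S c2)
  have h3 : ((univ : Finset (Fin 4 → Fin n)).filter (fun e => e c = v ∧ (e c1 ∈ S c1 ∨ e c2 ∈ S c2))).card
      ≤ n ^ 2 * (S c1).card + n ^ 2 * (S c2).card := by
    refine le_trans ?_ (Nat.add_le_add h1 h2)
    refine (card_le_card ?_).trans (card_union_le _ _)
    intro e he
    simp only [mem_filter, mem_univ, true_and, mem_union] at he ⊢
    tauto
  have h3' : (((univ : Finset (Fin 4 → Fin n)).filter (fun e => e c = v ∧ (e c1 ∈ S c1 ∨ e c2 ∈ S c2))).card : ℝ)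
      ≤ (n : ℝ) ^ 2 * (S c1).card + (n : ℝ) ^ 2 * (S c2).card := by exact_mod_cast h3
  have a1 := hS c1 h.ne.2.1
  have a2 := hS c2 h.ne.2.2
  have : (0 : ℝ) ≤ (n : ℝ) ^ 2 := by positivity
  nlinarith

lemma ExtH.stepD (H : ExtH n r s E W) :
    ∃ D ⊆ Av E (UU E W), IsM D ∧ n ≤ (UU E W 1).card + (UU E W 2).card + (UU E W 3).card + D.card ∧
      (D.card : ℝ) * 10 ^ 6 ≤ n := by
  have hbig : (10 : ℝ) ^ 16 ≤ n := by exact_mod_cast H.big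
  have hbig' := H.big
  have hn := H.hn
  have hs3 := H.hs3
  have u1 := H.U_card 1 (by decide)
  have u2 := H.U_card 2 (by decide)
  have u3 := H.U_card 3 (by decide)
  rcases Nat.lt_or_ge ((UU E W 1).card + (UU E W 2).card + (UU E W 3).card) n with hlt | hge
  swap
  · exact ⟨∅, by simp, isM_empty, by simpa using hge, by simp⟩
  obtain ⟨d, hd⟩ : ∃ d, (UU E W 1).card + (UU E W 2).card + (UU E W 3).card + d = n :=
    ⟨n - ((UU E W 1).card + (UU E W 2).card + (UU E W 3).card), by omega⟩
  have hd' : ((UU E W 1).card : ℝ) + (UU E W 2).card + (UU E W 3).card + d = n := by exact_mod_cast hd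
  have hdn : (d : ℝ) * 10 ^ 6 ≤ n := by linarith [u1.2, u2.2, u3.2]
  have hrn : |(r : ℝ) * 3 - n| ≤ 3 := by
    have : (n : ℝ) = 3 * r + s := by exact_mod_cast hn
    have h3 : (s : ℝ) ≤ 3 := by exact_mod_cast hs3
    rw [this, abs_le]; constructor <;> linarith [(Nat.cast_nonneg s : (0:ℝ) ≤ s)]
  rw [abs_le] at hrn
  obtain ⟨D, h1, h2, h3⟩ := D_matching E r s H.hn H.hs1 H.hs3 (by omega) H.hmis (UU E W) d (by omega) hd
    (by have : (d : ℝ) * 1000 ≤ n := by linarith [(Nat.cast_nonneg d : (0:ℝ) ≤ d)]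
        exact_mod_cast this)
    (by
      intro c hc
      have u := H.U_card c hc
      have : |((UU E W c).card : ℝ) - r| * 1000 ≤ n := by
        have : |((UU E W c).card : ℝ) - r| ≤ n / 1000 := by
          rw [abs_le]; constructor <;> linarith [u.1, u.2, hrn.1, hrn.2]
        linarith
      exact_mod_cast this) (n ^ 3 / 10000) (Nat.div_mul_le_self _ _)
    (by
      intro c hc v
      rw [Nat.le_div_iff_mul_le (by norm_num)]
      by_cases hv : v ∈ UU E W c
      · have : ((Av E (UU E W)).filter (fun e => e c = v)) = ∅ := by
          apply filter_eq_empty_iff.2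
          intro e he hev
          exact (mem_filter.1 he).2 c hc (hev ▸ hv)
        rw [this]; simp
      · obtain ⟨c1, c2, hT⟩ := trip_exists c hc
        have hv' := hv
        simp only [UU, mem_filter, mem_univ, true_and, not_and, not_le] at hv'
        have hv2 := hv' hc
        have b1 : (10 : ℝ) ^ 5 * ((hiS E W c v).card : ℝ) < (n : ℝ) ^ 3 := by exact_mod_cast hv2
        have b2 := card_fix_in2 hT v (fun c => W c \ UU E W c) ((n : ℝ) / 10 ^ 7) (by
          intro c hc
          have := H.WU_card c hc
          rw [le_div_iff₀ (by positivity)]; exact this)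
        have b3 : (((Av E (UU E W)).filter (fun e => e c = v)).card : ℝ) ≤ (hiS E W c v).card +
          ((univ : Finset (Fin 4 → Fin n)).filter (fun e => e c = v ∧
            (e c1 ∈ W c1 \ UU E W c1 ∨ e c2 ∈ W c2 \ UU E W c2))).card := by
          norm_cast
          refine le_trans (card_le_card ?_) (card_union_le _ _)
          intro e he
          obtain ⟨he1, he2⟩ := mem_filter.1 he
          obtain ⟨heE, heU⟩ := mem_filter.1 he1
          rw [mem_union]
          by_cases hw : e c1 ∈ W c1 ∨ e c2 ∈ W c2
          · right
            refine mem_filter.2 ⟨mem_univ _, he2, ?_⟩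
            rcases hw with hw | hw
            · left; exact mem_sdiff.2 ⟨hw, heU _ hT.ne.2.1⟩
            · right; exact mem_sdiff.2 ⟨hw, heU _ hT.ne.2.2⟩
          · push Not at hw
            left
            refine mem_filter.2 ⟨heE, he2, ?_⟩
            intro c' h0 hne
            exact hT.forall (P := fun c' => c' ≠ c → e c' ∉ W c') (fun h => absurd rfl h)
              (fun _ => hw.1) (fun _ => hw.2) c' h0 hne
        have h7 : (0 : ℝ) < (n : ℝ) ^ 3 := by positivity
        have : (((Av E (UU E W)).filter (fun e => e c = v)).card : ℝ) * 10000 ≤ (n : ℝ) ^ 3 := by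
          have e1 : 2 * ((n : ℝ) / 10 ^ 7) * n ^ 2 = n ^ 3 * (2 / 10 ^ 7) := by ring
          rw [e1] at b2
          linarith
        exact_mod_cast this)
  exact ⟨D, h1, h2, by omega, by rw [h3]; exact hdn⟩

/-- edges with at most one coordinate in `U` -/
noncomputable def AA (E : Finset (Fin 4 → Fin n)) (U : Fin 4 → Finset (Fin n)) : Finset (Fin 4 → Fin n) :=
  E.filter (fun e => ∀ c c', c ≠ 0 → c' ≠ 0 → c ≠ c' → e c ∈ U c → e c' ∉ U c')

lemma AA_of_trip {U : Fin 4 → Finset (Fin n)} {e : Fin 4 → Fin n} {c c1 c2 : Fin 4} (h : Trip c c1 c2)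
    (hE : e ∈ E) (h1 : e c1 ∉ U c1) (h2 : e c2 ∉ U c2) : e ∈ AA E U := by
  refine mem_filter.2 ⟨hE, ?_⟩
  intro a b ha hb hab haU hbU
  have hac : a = c := by
    by_contra hne
    exact h.forall (P := fun a => a ≠ c → e a ∉ U a) (fun h => absurd rfl h) (fun _ => h1) (fun _ => h2)
      a ha hne haU
  have hbc : b = c := by
    by_contra hne
    exact h.forall (P := fun a => a ≠ c → e a ∉ U a) (fun h => absurd rfl h) (fun _ => h1) (fun _ => h2)
      b hb hne hbU
  exact hab (hac.trans hbc.symm)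

lemma AA_of_two {U : Fin 4 → Finset (Fin n)} {e : Fin 4 → Fin n} {c c1 c2 : Fin 4} (h : Trip c c1 c2)
    (hE : e ∈ E) (h0 : e c ∉ U c) (h1 : ¬ (e c1 ∈ U c1 ∧ e c2 ∈ U c2)) : e ∈ AA E U := by
  by_cases h2 : e c1 ∈ U c1
  · have h3 : e c2 ∉ U c2 := fun h => h1 ⟨h2, h⟩
    refine mem_filter.2 ⟨hE, ?_⟩
    have key : ∀ a, a ≠ 0 → a ≠ c1 → e a ∉ U a := fun a ha hne =>
      h.forall (P := fun a => a ≠ c1 → e a ∉ U a) (fun _ => h0) (fun h => absurd rfl h) (fun _ => h3) a ha hne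
    intro a b ha hb hab haU hbU
    have hac : a = c1 := by by_contra hne; exact key a ha hne haU
    have hbc : b = c1 := by by_contra hne; exact key b hb hne hbU
    exact hab (hac.trans hbc.symm)
  · refine mem_filter.2 ⟨hE, ?_⟩
    have key : ∀ a, a ≠ 0 → a ≠ c2 → e a ∉ U a := fun a ha hne =>
      h.forall (P := fun a => a ≠ c2 → e a ∉ U a) (fun _ => h0) (fun _ => h2) (fun h => absurd rfl h) a ha hne
    intro a b ha hb hab haU hbU
    have hac : a = c2 := by by_contra hne; exact key a ha hne haU
    have hbc : b = c2 := by by_contra hne; exact key b hb hne hbU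
    exact hab (hac.trans hbc.symm)

lemma miss_fix1 (H : ExtH n r s E W) (c a : Fin 4) (hc : c ≠ 0) (ha : a = 0 ∨ a = c) (v : Fin n) :
    (((univ : Finset (Fin 4 → Fin n)).filter (fun e => e a = v ∧ e ∉ E)).card : ℝ) ≤
      n ^ 3 * (4 / 9 + 1 / 10 ^ 14) := by
  have h1 : ((univ : Finset (Fin 4 → Fin n)).filter (fun e => e a = v ∧ e ∉ E)).card ≤
      kap (n - r) s * (univ : Finset (Fin n)).card := by
    rcases ha with rfl | rfl
    · refine card_le_mul_card_image_of_maps_to (f := fun e => e c) (fun _ _ => by simp) _ ?_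
      intro w _
      refine le_trans (card_le_card ?_) ((Nat.le_succ _).trans (H.hmis c hc v w))
      intro e he
      simp only [mem_filter, mem_univ, true_and] at he ⊢
      tauto
    · refine card_le_mul_card_image_of_maps_to (f := fun e => e 0) (fun _ _ => by simp) _ ?_
      intro w _
      refine le_trans (card_le_card ?_) ((Nat.le_succ _).trans (H.hmis a hc w v))
      intro e he
      simp only [mem_filter, mem_univ, true_and] at he ⊢
      tauto
  simp only [card_univ, Fintype.card_fin] at h1
  have h2 : (((univ : Finset (Fin 4 → Fin n)).filter (fun e => e a = v ∧ e ∉ E)).card : ℝ) ≤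
      (kap (n - r) s : ℝ) * n := by exact_mod_cast h1
  have h3 := H.kapb
  have : (0 : ℝ) ≤ n := by positivity
  nlinarith

end RPM

open Finset
namespace RPM
open scoped Classical
variable {n r s : ℕ} {E : Finset (Fin 4 → Fin n)} {W : Fin 4 → Finset (Fin n)}

lemma uu_prod (H : ExtH n r s E W) (a b : Fin 4) (ha : a ≠ 0) (hb : b ≠ 0) :
    (n : ℝ) * ((UU E W a).card : ℝ) * ((UU E W b).card : ℝ) ≤ n ^ 3 * (112 / 1000) := by
  have h1 := (H.U_card a ha).1
  have h2 := (H.U_card b hb).1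
  set x : ℝ := ((UU E W a).card : ℝ)
  set y : ℝ := ((UU E W b).card : ℝ)
  have hx : 0 ≤ x := by positivity
  have hy : 0 ≤ y := by positivity
  have hN : (0 : ℝ) ≤ n := by positivity
  have h3 : x ≤ n * (334 / 1000) := by linarith
  have h4 : y ≤ n * (334 / 1000) := by linarith
  have h5 : x * y ≤ (n * (334 / 1000)) * (n * (334 / 1000)) := mul_le_mul h3 h4 hy (by positivity)
  have h6 : (n : ℝ) * (x * y) ≤ n * ((n * (334 / 1000)) * (n * (334 / 1000))) :=
    mul_le_mul_of_nonneg_left h5 hN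
  have h7 : (0 : ℝ) ≤ (n : ℝ) ^ 3 := by positivity
  nlinarith

lemma ExtH.AA_deg (H : ExtH n r s E W) (c : Fin 4) (v : Fin n) :
    (n : ℝ) ^ 3 * (98 / 10 ^ 7) ≤ (((AA E (UU E W)).filter (fun e => e c = v)).card : ℝ) := by
  have h7 : (0 : ℝ) ≤ (n : ℝ) ^ 3 := by positivity
  by_cases hc : c = 0
  · subst hc
    have hT : Trip 1 2 3 := Or.inl ⟨rfl, rfl, rfl⟩
    have m := miss_fix1 H 1 0 (by decide) (Or.inl rfl) v
    have t1 := card_trip hT {v} (UU E W 1) (UU E W 2) univ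
    have t2 := card_trip hT {v} (UU E W 1) univ (UU E W 3)
    have t3 := card_trip hT {v} univ (UU E W 2) (UU E W 3)
    simp only [card_singleton, card_univ, Fintype.card_fin, one_mul] at t1 t2 t3
    have hc := card_fix1 (n := n) 0 v
    set S1 := ((univ : Finset (Fin 4 → Fin n)).filter
      (fun e => e 0 ∈ ({v} : Finset (Fin n)) ∧ e 1 ∈ UU E W 1 ∧ e 2 ∈ UU E W 2 ∧ e 3 ∈ (univ : Finset (Fin n)))) with hS1
    set S2 := ((univ : Finset (Fin 4 → Fin n)).filter
      (fun e => e 0 ∈ ({v} : Finset (Fin n)) ∧ e 1 ∈ UU E W 1 ∧ e 2 ∈ (univ : Finset (Fin n)) ∧ e 3 ∈ UU E W 3)) with hS2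
    set S3 := ((univ : Finset (Fin 4 → Fin n)).filter
      (fun e => e 0 ∈ ({v} : Finset (Fin n)) ∧ e 1 ∈ (univ : Finset (Fin n)) ∧ e 2 ∈ UU E W 2 ∧ e 3 ∈ UU E W 3)) with hS3
    set S0 := (univ : Finset (Fin 4 → Fin n)).filter (fun e => e 0 = v ∧ e ∉ E)
    set A := (AA E (UU E W)).filter (fun e => e 0 = v)
    have hsub : ((univ : Finset (Fin 4 → Fin n)).filter (fun e => e 0 = v)) ⊆ A ∪ S0 ∪ S1 ∪ S2 ∪ S3 := by
      intro e he
      have he := (mem_filter.1 he).2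
      by_contra hcon
      simp only [mem_union, not_or] at hcon
      obtain ⟨⟨⟨⟨h0, h1⟩, h2⟩, h3⟩, h4⟩ := hcon
      have hE : e ∈ E := by
        by_contra h; exact h1 (mem_filter.2 ⟨mem_univ _, he, h⟩)
      simp only [hS1, hS2, hS3, mem_filter, mem_univ, true_and, mem_singleton, and_true, not_and, he,
        true_implies] at h2 h3 h4
      apply h0
      refine mem_filter.2 ⟨?_, he⟩
      by_cases k : e 1 ∈ UU E W 1
      · exact AA_of_trip hT hE (h2 k) (h3 k)
      · exact AA_of_two hT hE k (by rintro ⟨a, b⟩; exact h4 a b)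
    have hcard := card_le_card hsub
    rw [hc] at hcard
    have hc2 : n ^ 3 ≤ A.card + S0.card + S1.card + S2.card + S3.card := by
      have k1 := card_union_le (A ∪ S0 ∪ S1 ∪ S2) S3
      have k2 := card_union_le (A ∪ S0 ∪ S1) S2
      have k3 := card_union_le (A ∪ S0) S1
      have k4 := card_union_le A S0
      omega
    have hc3 : (n : ℝ) ^ 3 ≤ A.card + S0.card + S1.card + S2.card + S3.card := by exact_mod_cast hc2
    have r1 : (S1.card : ℝ) = n * (UU E W 1).card * (UU E W 2).card := by
      rw [t1]; push_cast; ring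
    have r2 : (S2.card : ℝ) = n * (UU E W 1).card * (UU E W 3).card := by
      rw [t2]; push_cast; ring
    have r3 : (S3.card : ℝ) = n * (UU E W 2).card * (UU E W 3).card := by
      rw [t3]; push_cast; ring
    have q1 := uu_prod H 1 2 (by decide) (by decide)
    have q2 := uu_prod H 1 3 (by decide) (by decide)
    have q3 := uu_prod H 2 3 (by decide) (by decide)
    linarith
  · obtain ⟨c1, c2, hT⟩ := trip_exists c hc
    by_cases hv : v ∈ UU E W c
    · have hv' := hv
      simp only [UU, mem_filter, mem_univ, true_and] at hv'
      have b1 : (n : ℝ) ^ 3 ≤ (10 : ℝ) ^ 5 * ((hiS E W c v).card : ℝ) := by exact_mod_cast hv'.2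
      have b2 := card_fix_in2 hT v (fun c => UU E W c \ W c) ((n : ℝ) / 10 ^ 7) (by
          intro c hc
          have := H.UW_card c
          rw [le_div_iff₀ (by positivity)]; exact this)
      have b3 : ((hiS E W c v).card : ℝ) ≤ ((AA E (UU E W)).filter (fun e => e c = v)).card +
          ((univ : Finset (Fin 4 → Fin n)).filter (fun e => e c = v ∧
            (e c1 ∈ UU E W c1 \ W c1 ∨ e c2 ∈ UU E W c2 \ W c2))).card := by
        norm_cast
        refine le_trans (card_le_card ?_) (card_union_le _ _)
        intro e he
        obtain ⟨heE, he2, he3⟩ := mem_filter.1 he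
        rw [mem_union]
        have w1 := he3 c1 hT.ne.2.1 hT.ne'.1
        have w2 := he3 c2 hT.ne.2.2 hT.ne'.2.1
        by_cases hw : e c1 ∈ UU E W c1 ∨ e c2 ∈ UU E W c2
        · right
          refine mem_filter.2 ⟨mem_univ _, he2, ?_⟩
          rcases hw with hw | hw
          · left; exact mem_sdiff.2 ⟨hw, w1⟩
          · right; exact mem_sdiff.2 ⟨hw, w2⟩
        · push Not at hw
          left
          exact mem_filter.2 ⟨AA_of_trip hT heE hw.1 hw.2, he2⟩
      have e1 : 2 * ((n : ℝ) / 10 ^ 7) * n ^ 2 = n ^ 3 * (2 / 10 ^ 7) := by ring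
      rw [e1] at b2
      linarith
    · have m := miss_fix1 H c c hc (Or.inr rfl) v
      have t1 := card_trip hT univ {v} (UU E W c1) (UU E W c2)
      simp only [card_singleton, card_univ, Fintype.card_fin, mul_one] at t1
      have hcc := card_fix1 (n := n) c v
      set S1 := ((univ : Finset (Fin 4 → Fin n)).filter
        (fun e => e 0 ∈ (univ : Finset (Fin n)) ∧ e c ∈ ({v} : Finset (Fin n)) ∧ e c1 ∈ UU E W c1 ∧ e c2 ∈ UU E W c2)) with hS1
      set S0 := (univ : Finset (Fin 4 → Fin n)).filter (fun e => e c = v ∧ e ∉ E)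
      set A := (AA E (UU E W)).filter (fun e => e c = v)
      have hsub : ((univ : Finset (Fin 4 → Fin n)).filter (fun e => e c = v)) ⊆ A ∪ S0 ∪ S1 := by
        intro e he
        have he := (mem_filter.1 he).2
        by_contra hcon
        simp only [mem_union, not_or] at hcon
        obtain ⟨⟨h0, h1⟩, h2⟩ := hcon
        have hE : e ∈ E := by
          by_contra h; exact h1 (mem_filter.2 ⟨mem_univ _, he, h⟩)
        apply h0
        refine mem_filter.2 ⟨AA_of_two hT hE (by rw [he]; exact hv) ?_, he⟩
        rintro ⟨a, b⟩
        exact h2 (mem_filter.2 ⟨mem_univ _, mem_univ _, mem_singleton.2 he, a, b⟩)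
      have hcard := card_le_card hsub
      rw [hcc] at hcard
      have hc2 : n ^ 3 ≤ A.card + S0.card + S1.card := by
        have k3 := card_union_le (A ∪ S0) S1
        have k4 := card_union_le A S0
        omega
      have hc3 : (n : ℝ) ^ 3 ≤ A.card + S0.card + S1.card := by exact_mod_cast hc2
      have r1 : (S1.card : ℝ) = n * (UU E W c1).card * (UU E W c2).card := by
        rw [t1]; push_cast; ring
      have q1 := uu_prod H c1 c2 hT.ne.2.1 hT.ne.2.2
      linarith

/-- exceptional objects -/
noncomputable def Zs (E : Finset (Fin 4 → Fin n)) (W : Fin 4 → Finset (Fin n)) : Finset (Fin 4 × Fin n) :=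
  (univ : Finset (Fin 4)).biUnion (fun c => (atyp E W c ∪ (UU E W c \ W c)).image (fun v => (c, v)))

lemma ExtH.Zs_card (H : ExtH n r s E W) : ((Zs E W).card : ℝ) * 10 ^ 7 ≤ 8 * n := by
  have h1 : (Zs E W).card ≤ ∑ c : Fin 4, ((atyp E W c).card + (UU E W c \ W c).card) := by
    refine card_biUnion_le.trans (sum_le_sum fun c _ => ?_)
    exact card_image_le.trans (card_union_le _ _)
  rw [Fin.sum_univ_four] at h1
  have h2 : ((Zs E W).card : ℝ) ≤ ((atyp E W 0).card + (UU E W 0 \ W 0).card) +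
    ((atyp E W 1).card + (UU E W 1 \ W 1).card) + ((atyp E W 2).card + (UU E W 2 \ W 2).card)
    + ((atyp E W 3).card + (UU E W 3 \ W 3).card) := by exact_mod_cast h1
  linarith [H.atyp_card 0, H.atyp_card 1, H.atyp_card 2, H.atyp_card 3, H.UW_card 0, H.UW_card 1,
    H.UW_card 2, H.UW_card 3]

lemma ExtH.step6 (H : ExtH n r s E W) : ∃ D M : Finset (Fin 4 → Fin n), D ⊆ Av E (UU E W) ∧
    n ≤ (UU E W 1).card + (UU E W 2).card + (UU E W 3).card + D.card ∧ IsM M ∧ D ⊆ M ∧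
    (∀ e ∈ M, e ∈ D ∨ e ∈ AA E (UU E W)) ∧ (M.card : ℝ) * 10 ^ 5 ≤ n ∧
    (∀ c v, v ∈ atyp E W c ∪ (UU E W c \ W c) → ∃ e ∈ M, e c = v) := by
  obtain ⟨D, d1, d2, d3, d4⟩ := H.stepD
  have hbig : (10 : ℝ) ^ 16 ≤ n := by exact_mod_cast H.big
  have z := H.Zs_card
  have hK : (n : ℝ) ^ 3 ≤ 110000 * ((n ^ 3 / 110000 : ℕ) : ℝ) + 110000 := by
    have := Nat.div_add_mod (n ^ 3) 110000
    have h2 := Nat.mod_lt (n ^ 3) (show 110000 > 0 by norm_num)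
    have h3 : n ^ 3 ≤ 110000 * (n ^ 3 / 110000) + 110000 := by omega
    exact_mod_cast h3
  have hK2 : ((n ^ 3 / 110000 : ℕ) : ℝ) * 110000 ≤ (n : ℝ) ^ 3 := by
    exact_mod_cast Nat.div_mul_le_self (n ^ 3) 110000
  have h7 : (0 : ℝ) < (n : ℝ) ^ 2 := by positivity
  have h7' : (10 : ℝ) ^ 16 ≤ (n : ℝ) ^ 3 := by nlinarith
  obtain ⟨M, m1, m2, m3, m4, m5⟩ := greedy (AA E (UU E W)) D d2 (n ^ 3 / 110000) (Zs E W)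
    (by
      have : (3 : ℝ) * ((D.card : ℝ) + (Zs E W).card) * n ^ 2 < ((n ^ 3 / 110000 : ℕ) : ℝ) := by
        have h8 : (3 : ℝ) * ((D.card : ℝ) + (Zs E W).card) ≤ n * (54 / 10 ^ 7) := by linarith
        have h9 : (3 : ℝ) * ((D.card : ℝ) + (Zs E W).card) * n ^ 2 ≤ n * (54 / 10 ^ 7) * n ^ 2 :=
          mul_le_mul_of_nonneg_right h8 h7.le
        have : (n : ℝ) * (54 / 10 ^ 7) * n ^ 2 = n ^ 3 * (54 / 10 ^ 7) := by ring
        linarith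
      exact_mod_cast this)
    (by
      intro z _
      have := H.AA_deg z.1 z.2
      have h8 : ((n ^ 3 / 110000 : ℕ) : ℝ) ≤ (((AA E (UU E W)).filter (fun e => e z.1 = z.2)).card : ℝ) := by
        linarith
      exact_mod_cast h8)
  refine ⟨D, M, d1, d3, m1, m2, m3, ?_, ?_⟩
  · have : (M.card : ℝ) ≤ D.card + (Zs E W).card := by exact_mod_cast m4
    linarith
  · intro c v hv
    exact m5 (c, v) (mem_biUnion.2 ⟨c, mem_univ _, mem_image.2 ⟨v, hv, rfl⟩⟩)

end RPM

open Finset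
namespace RPM
open scoped Classical
variable {n r s : ℕ} {E : Finset (Fin 4 → Fin n)} {W : Fin 4 → Finset (Fin n)}

theorem ExtH.hasPM (H : ExtH n r s E W) : HasPM E := by
  obtain ⟨D, M, d1, d2, m1, m2, m3, m4, m5⟩ := H.step6
  have hbig : (10 : ℝ) ^ 16 ≤ n := by exact_mod_cast H.big
  have hbig' := H.big
  have u1 := H.U_card 1 (by decide)
  have u2 := H.U_card 2 (by decide)
  have u3 := H.U_card 3 (by decide)
  set U := UU E W with hU
  set X : Fin 4 → Finset (Fin n) := fun c => univ \ M.image (fun e => e c) with hX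
  have hME : M ⊆ E := by
    intro e he
    rcases m3 e he with h | h
    · exact (mem_filter.1 (d1 h)).1
    · exact (mem_filter.1 h).1
  have hMn : M.card ≤ n := by
    have := card_image_of_injOn (m1.injOn 0)
    rw [← this]; exact card_le_n _
  have hXc : ∀ c, (X c).card = n - M.card := by
    intro c
    rw [hX]; simp only
    rw [card_sdiff_of_subset (subset_univ _), card_image_of_injOn (m1.injOn c)]
    simp
  have hUX : ∀ c, (U c).card ≤ (U c ∩ X c).card + (M.filter (fun e => e c ∈ U c)).card := by
    intro c
    have h1 : U c ⊆ (U c ∩ X c) ∪ (M.filter (fun e => e c ∈ U c)).image (fun e => e c) := by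
      intro v hv
      by_cases h : v ∈ X c
      · exact mem_union_left _ (mem_inter.2 ⟨hv, h⟩)
      · have : v ∈ M.image (fun e => e c) := by
          by_contra h'; exact h (mem_sdiff.2 ⟨mem_univ _, h'⟩)
        obtain ⟨e, he, rfl⟩ := mem_image.1 this
        exact mem_union_right _ (mem_image.2 ⟨e, mem_filter.2 ⟨he, hv⟩, rfl⟩)
    exact (card_le_card h1).trans ((card_union_le _ _).trans (Nat.add_le_add_left card_image_le _))
  have hMU : (M.filter (fun e => e 1 ∈ U 1)).card + (M.filter (fun e => e 2 ∈ U 2)).card +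
      (M.filter (fun e => e 3 ∈ U 3)).card + D.card ≤ M.card := by
    have hA : ∀ e ∈ M, ∀ c c', c ≠ 0 → c' ≠ 0 → c ≠ c' → e c ∈ U c → e c' ∉ U c' := by
      intro e he c c' h0 h0' hne hc
      rcases m3 e he with h | h
      · exact absurd hc ((mem_filter.1 (d1 h)).2 c h0)
      · exact (mem_filter.1 h).2 c c' h0 h0' hne hc
    have hD : ∀ e ∈ D, ∀ c, c ≠ 0 → e c ∉ U c := fun e he => (mem_filter.1 (d1 he)).2
    rw [← card_union_of_disjoint, ← card_union_of_disjoint, ← card_union_of_disjoint]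
    · apply card_le_card
      intro e he
      simp only [mem_union, mem_filter] at he
      rcases he with ((h | h) | h) | h
      exacts [h.1, h.1, h.1, m2 h]
    · rw [disjoint_left]
      intro e he hd
      simp only [mem_union, mem_filter] at he
      rcases he with (h | h) | h
      exacts [hD e hd 1 (by decide) h.2, hD e hd 2 (by decide) h.2, hD e hd 3 (by decide) h.2]
    · rw [disjoint_left]
      intro e he hd
      simp only [mem_union, mem_filter] at he hd
      rcases he with h | h
      exacts [hA e h.1 1 3 (by decide) (by decide) (by decide) h.2 hd.2,
        hA e h.1 2 3 (by decide) (by decide) (by decide) h.2 hd.2]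
    · rw [disjoint_left]
      intro e he hd
      simp only [mem_filter] at he hd
      exact hA e he.1 1 2 (by decide) (by decide) (by decide) he.2 hd.2
  have a1 := hUX 1
  have a2 := hUX 2
  have a3 := hUX 3
  have b2 : (U 2 ∩ X 2).card ≤ (U 2).card := card_le_card inter_subset_left
  have b3 : (U 3 ∩ X 3).card ≤ (U 3).card := card_le_card inter_subset_left
  have b4 : (U 2).card * 10 ≤ n * 4 := by
    have : ((U 2).card : ℝ) * 10 ≤ n * 4 := by linarith
    exact_mod_cast this
  have b5 : (U 3).card * 10 ≤ n * 4 := by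
    have : ((U 3).card : ℝ) * 10 ≤ n * 4 := by linarith
    exact_mod_cast this
  have b6 : M.card * 10 ^ 5 ≤ n := by exact_mod_cast m4
  obtain ⟨R1, hR1, hR1c⟩ := exists_subset_card_eq
    (show n - M.card - (U 2 ∩ X 2).card - (U 3 ∩ X 3).card ≤ (U 1 ∩ X 1).card by omega)
  set R : Fin 4 → Finset (Fin n) := ![∅, R1, U 2 ∩ X 2, U 3 ∩ X 3] with hR
  have hUW : ∀ c, ∀ v ∈ X c, v ∈ U c → v ∈ W c := by
    intro c v hvX hvU
    by_contra hw
    obtain ⟨e, he, hev⟩ := m5 c v (mem_union_right _ (mem_sdiff.2 ⟨hvU, hw⟩))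
    exact (mem_sdiff.1 hvX).2 (mem_image.2 ⟨e, he, hev⟩)
  have hWU : ∀ c, c ≠ 0 → ∀ v ∈ X c, v ∈ W c → v ∈ U c := by
    intro c hc v hvX hvW
    by_contra hw
    obtain ⟨e, he, hev⟩ := m5 c v (mem_union_left _ (H.WU_sub c hc (mem_sdiff.2 ⟨hvW, hw⟩)))
    exact (mem_sdiff.1 hvX).2 (mem_image.2 ⟨e, he, hev⟩)
  have hc1 : n * 1 ≤ (R1.card) * 4 := by
    rw [hR1c]
    have : ((U 2).card : ℝ) * 10 ^ 4 ≤ n * 3334 := by linarith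
    have k1 : (U 2).card * 10 ^ 4 ≤ n * 3334 := by exact_mod_cast this
    have : ((U 3).card : ℝ) * 10 ^ 4 ≤ n * 3334 := by linarith
    have k2 : (U 3).card * 10 ^ 4 ≤ n * 3334 := by exact_mod_cast this
    omega
  have hc2 : ∀ c, c ≠ 0 → n * 1 ≤ (U c ∩ X c).card * 4 := by
    intro c hc
    have h := H.U_card c hc
    have k1 : n * 33 ≤ (U c).card * 100 := by
      have : (n : ℝ) * 33 ≤ (U c).card * 100 := by linarith [h.2]
      exact_mod_cast this
    have k2 := hUX c
    have k3 : (M.filter (fun e => e c ∈ U c)).card ≤ M.card := card_le_card (filter_subset _ _)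
    omega
  have hc2' := hc2 2 (by decide)
  have hc3' := hc2 3 (by decide)
  obtain ⟨M', p1, p2, p3, p4⟩ := blocks E W X R (n - M.card) hXc
    (by
      intro c; fin_cases c
      · exact empty_subset _
      · exact hR1.trans inter_subset_right
      · exact inter_subset_right
      · exact inter_subset_right)
    (by
      show R1.card + (U 2 ∩ X 2).card + (U 3 ∩ X 3).card = _
      omega)
    (n / 4) (by omega)
    (by show n / 4 ≤ R1.card; omega)
    (by show n / 4 ≤ (U 2 ∩ X 2).card; omega)
    (by show n / 4 ≤ (U 3 ∩ X 3).card; omega)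
    (by
      intro c; fin_cases c
      · exact empty_subset _
      · intro v hv
        have := mem_inter.1 (hR1 hv)
        exact hUW 1 v this.2 this.1
      · intro v hv
        have := mem_inter.1 hv
        exact hUW 2 v this.2 this.1
      · intro v hv
        have := mem_inter.1 hv
        exact hUW 3 v this.2 this.1)
    (fun v hv hvR hw => hvR (mem_inter.2 ⟨hWU 2 (by decide) v hv hw, hv⟩))
    (fun v hv hvR hw => hvR (mem_inter.2 ⟨hWU 3 (by decide) v hv hw, hv⟩))
    (by
      intro c v hv
      have hat : v ∉ atyp E W c := by
        intro h
        obtain ⟨e, he, hev⟩ := m5 c v (mem_union_left _ h)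
        exact (mem_sdiff.1 hv).2 (mem_image.2 ⟨e, he, hev⟩)
      simp only [atyp, mem_filter, mem_univ, true_and, not_lt] at hat
      change md E W c v * 100 ≤ (n / 4) ^ 3
      have h4 : n * 24 ≤ (n / 4) * 100 := by omega
      have h5 : (n * 24) ^ 3 ≤ ((n / 4) * 100) ^ 3 := Nat.pow_le_pow_left h4 3
      have h6 : n ^ 3 * 13824 ≤ (n / 4) ^ 3 * 1000000 := by
        calc n ^ 3 * 13824 = (n * 24) ^ 3 := by ring
          _ ≤ _ := h5
          _ = _ := by ring
      omega)
  have hdis : ∀ a ∈ M, ∀ b ∈ M', ∀ c, a c ≠ b c := by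
    intro a ha b hb c hab
    exact (mem_sdiff.1 (p4 b hb c)).2 (mem_image.2 ⟨a, ha, hab⟩)
  refine ⟨M ∪ M', union_subset hME p1, m1.union p2 hdis, ?_⟩
  rw [card_union_of_disjoint, p3]
  · omega
  · rw [disjoint_left]
    intro a ha hb
    exact hdis a ha a hb 0 rfl

/-- the exact degree condition -/
def DegH (n r s : ℕ) (E : Finset (Fin 4 → Fin n)) : Prop :=
  ∀ c, c ≠ 0 → ∀ i v,
      ((univ : Finset (Fin 4 → Fin n)).filter (fun e => e 0 = i ∧ e c = v ∧ e ∉ E)).card + 1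
        ≤ kap (n - r) s

lemma degH_of_deg (hn : n = 3 * r + s) (hs1 : 1 ≤ s) (hs3 : s ≤ 3)
    (h : ∀ c, c ≠ 0 → ∀ i v, deltaLM n r s < (E.filter (fun e => e 0 = i ∧ e c = v)).card) :
    DegH n r s E := by
  intro c hc i v
  have h1 := card_fix2 (n := n) 0 c hc.symm i v
  have h2 := h c hc i v
  set A := ((univ : Finset (Fin 4 → Fin n)).filter (fun e => e 0 = i ∧ e c = v))
  have h3 : (A.filter (fun e => e ∈ E)).card + (A.filter (fun e => e ∉ E)).card = A.card :=
    card_filter_add_card_filter_not _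
  have h4 : (E.filter (fun e => e 0 = i ∧ e c = v)) = A.filter (fun e => e ∈ E) := by
    ext e; simp [A]; tauto
  have h5 : ((univ : Finset (Fin 4 → Fin n)).filter (fun e => e 0 = i ∧ e c = v ∧ e ∉ E)) =
      A.filter (fun e => e ∉ E) := by
    ext e; simp [A]; tauto
  rw [h4] at h2
  rw [h5]
  have h6 : n ^ 2 ≤ deltaLM n r s + kap (n - r) s := by
    unfold deltaLM kap
    split_ifs <;> omega
  omega

end RPM

open Finset
namespace RPM
open scoped Classical

lemma card_not_inj (k n : ℕ) :
    ((univ : Finset (Fin k → Fin n)).filter (fun g => ¬ Function.Injective g)).card * n ≤ k ^ 2 * n ^ k := by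
  have hsub : ((univ : Finset (Fin k → Fin n)).filter (fun g => ¬ Function.Injective g)) ⊆
      ((univ : Finset (Fin k × Fin k)).filter (fun p => p.1 ≠ p.2)).biUnion
        (fun p => univ.filter (fun g : Fin k → Fin n => g p.1 = g p.2)) := by
    intro g hg
    have hg := (mem_filter.1 hg).2
    unfold Function.Injective at hg
    push Not at hg
    obtain ⟨a, b, h1, h2⟩ := hg
    exact mem_biUnion.2 ⟨(a, b), mem_filter.2 ⟨mem_univ _, h2⟩, mem_filter.2 ⟨mem_univ _, h1⟩⟩
  have h1 : ∀ p ∈ ((univ : Finset (Fin k × Fin k)).filter (fun p => p.1 ≠ p.2)),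
      ((univ : Finset (Fin k → Fin n)).filter (fun g => g p.1 = g p.2)).card * n ≤ n ^ k := by
    intro p hp
    have hp := (mem_filter.1 hp).2
    have : (((univ : Finset (Fin k → Fin n)).filter (fun g => g p.1 = g p.2)) ×ˢ (univ : Finset (Fin n))).card
        ≤ (univ : Finset (Fin k → Fin n)).card := by
      refine card_le_card_of_injOn (fun q => Function.update q.1 p.1 q.2) (fun _ _ => mem_univ _) ?_
      rintro ⟨g, x⟩ hg ⟨g', x'⟩ hg' heq
      have hg := (mem_filter.1 (mem_product.1 hg).1).2
      have hg' := (mem_filter.1 (mem_product.1 hg').1).2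
      simp only at heq hg hg'
      have e1 := congrFun heq p.1
      simp only [Function.update_self] at e1
      have e2 : ∀ a, a ≠ p.1 → g a = g' a := by
        intro a ha
        have := congrFun heq a
        simpa [Function.update_of_ne ha] using this
      have : g = g' := by
        funext a
        by_cases ha : a = p.1
        · subst ha; rw [hg, hg']; exact e2 _ hp.symm
        · exact e2 a ha
      rw [this, e1]
    simpa [card_product] using this
  calc _ ≤ (∑ p ∈ ((univ : Finset (Fin k × Fin k)).filter (fun p => p.1 ≠ p.2)),
        ((univ : Finset (Fin k → Fin n)).filter (fun g => g p.1 = g p.2)).card) * n :=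
        Nat.mul_le_mul_right _ ((card_le_card hsub).trans card_biUnion_le)
    _ = ∑ p ∈ ((univ : Finset (Fin k × Fin k)).filter (fun p => p.1 ≠ p.2)),
        ((univ : Finset (Fin k → Fin n)).filter (fun g => g p.1 = g p.2)).card * n := by rw [sum_mul]
    _ ≤ ∑ p ∈ ((univ : Finset (Fin k × Fin k)).filter (fun p => p.1 ≠ p.2)), n ^ k := sum_le_sum h1
    _ = ((univ : Finset (Fin k × Fin k)).filter (fun p => p.1 ≠ p.2)).card * n ^ k := by
        rw [sum_const, smul_eq_mul]
    _ ≤ k ^ 2 * n ^ k := by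
        apply Nat.mul_le_mul_right
        refine (card_le_univ _).trans ?_
        simp [sq]

/-- one step of the box theorem -/
lemma box_step (k n N : ℕ) (hN : 1 ≤ N) (δ : ℝ) (hδ : 0 < δ) (hn : 2 * (N : ℝ) ^ 2 / δ ^ N + 1 ≤ n)
    (G : Finset (Fin (k + 1) → Fin n)) (hG : δ * n ^ (k + 1) ≤ G.card) :
    ∃ g : Fin N → Fin n, Function.Injective g ∧ δ ^ N / 2 * n ^ k ≤
      ((univ : Finset (Fin k → Fin n)).filter (fun y => ∀ j, (Fin.cons (g j) y : Fin (k + 1) → Fin n) ∈ G)).card := by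
  have hd : (0 : ℝ) < δ ^ N := by positivity
  have hn0 : (0 : ℝ) < n := by
    have : 0 ≤ 2 * (N : ℝ) ^ 2 / δ ^ N := by positivity
    linarith
  set d : (Fin k → Fin n) → ℕ := fun y => ((univ : Finset (Fin n)).filter (fun x => (Fin.cons x y : Fin (k + 1) → Fin n) ∈ G)).card with hdd
  have h1 : ∑ y, d y = G.card := by
    have : G.card = ∑ q : Fin n × (Fin k → Fin n), if (Fin.cons q.1 q.2 : Fin (k + 1) → Fin n) ∈ G then 1 else 0 := by
      rw [card_eq_sum_ones]
      rw [← sum_filter]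
      refine sum_bij' (fun e _ => (e 0, Fin.tail e)) (fun q _ => Fin.cons q.1 q.2) ?_ ?_ ?_ ?_ ?_ <;> simp
    rw [this, Fintype.sum_prod_type, sum_comm]
    refine sum_congr rfl fun y _ => ?_
    rw [hdd]; simp only [card_filter]
  set c : (Fin N → Fin n) → ℕ := fun g => ((univ : Finset (Fin k → Fin n)).filter (fun y => ∀ j, (Fin.cons (g j) y : Fin (k + 1) → Fin n) ∈ G)).card with hcc
  have h2 : ∑ g, c g = ∑ y, d y ^ N := by
    have e1 : ∀ g, c g = ∑ y, if (∀ j, (Fin.cons (g j) y : Fin (k + 1) → Fin n) ∈ G) then 1 else 0 := by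
      intro g; rw [hcc]; simp only [card_filter]
    simp_rw [e1]
    rw [sum_comm]
    refine sum_congr rfl fun y _ => ?_
    rw [← card_filter]
    have : ((univ : Finset (Fin N → Fin n)).filter (fun g => ∀ j, (Fin.cons (g j) y : Fin (k + 1) → Fin n) ∈ G)) =
        Fintype.piFinset (fun _ : Fin N => (univ : Finset (Fin n)).filter (fun x => (Fin.cons x y : Fin (k + 1) → Fin n) ∈ G)) := by
      ext g; simp
    rw [this, Fintype.card_piFinset]
    simp [hdd]
  have h3 : δ ^ N * n ^ (k + N) ≤ ∑ y, (d y : ℝ) ^ N := by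
    obtain ⟨m, rfl⟩ : ∃ m, N = m + 1 := ⟨N - 1, by omega⟩
    have := pow_sum_div_card_le_sum_pow (s := (univ : Finset (Fin k → Fin n))) (f := fun y => (d y : ℝ))
      (fun y _ => by positivity) m
    refine le_trans ?_ this
    have h4 : ∑ y, (d y : ℝ) = G.card := by exact_mod_cast h1
    rw [h4]
    have h5 : (((univ : Finset (Fin k → Fin n)).card : ℕ) : ℝ) = (n : ℝ) ^ k := by simp
    rw [h5, le_div_iff₀ (by positivity)]
    calc δ ^ (m + 1) * (n : ℝ) ^ (k + (m + 1)) * ((n : ℝ) ^ k) ^ m = (δ * n ^ (k + 1)) ^ (m + 1) := by ring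
      _ ≤ _ := pow_le_pow_left₀ (by positivity) hG _
  by_contra hcon
  push Not at hcon
  have h4 : ∑ g, (c g : ℝ) = ∑ y, (d y : ℝ) ^ N := by exact_mod_cast h2
  have h5 : ∑ g ∈ univ.filter (fun g : Fin N → Fin n => Function.Injective g), (c g : ℝ) ≤ n ^ N * (δ ^ N / 2 * n ^ k) := by
    calc _ ≤ ∑ g ∈ univ.filter (fun g : Fin N → Fin n => Function.Injective g), (δ ^ N / 2 * n ^ k) :=
          sum_le_sum fun g hg => (hcon g (mem_filter.1 hg).2).le
      _ = ((univ.filter (fun g : Fin N → Fin n => Function.Injective g)).card : ℝ) * (δ ^ N / 2 * n ^ k) := by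
          rw [sum_const, nsmul_eq_mul]
      _ ≤ _ := by
          apply mul_le_mul_of_nonneg_right _ (by positivity)
          have := card_le_univ (univ.filter (fun g : Fin N → Fin n => Function.Injective g))
          rw [Fintype.card_fun, Fintype.card_fin, Fintype.card_fin] at this
          exact_mod_cast this
  have h6 : (∑ g ∈ univ.filter (fun g : Fin N → Fin n => ¬ Function.Injective g), (c g : ℝ)) * n ≤ N ^ 2 * n ^ N * n ^ k := by
    have : ∀ g, (c g : ℝ) ≤ n ^ k := by
      intro g
      have := card_le_univ ((univ : Finset (Fin k → Fin n)).filter (fun y => ∀ j, (Fin.cons (g j) y : Fin (k + 1) → Fin n) ∈ G))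
      rw [Fintype.card_fun, Fintype.card_fin, Fintype.card_fin] at this
      exact_mod_cast this
    have h7 : (∑ g ∈ univ.filter (fun g : Fin N → Fin n => ¬ Function.Injective g), (c g : ℝ)) ≤
        ((univ.filter (fun g : Fin N → Fin n => ¬ Function.Injective g)).card : ℝ) * n ^ k := by
      rw [← nsmul_eq_mul]; exact sum_le_card_nsmul _ _ _ (fun g _ => this g)
    have h8 : ((univ.filter (fun g : Fin N → Fin n => ¬ Function.Injective g)).card : ℝ) * n ≤ N ^ 2 * n ^ N := by
      exact_mod_cast card_not_inj N n
    calc _ ≤ ((univ.filter (fun g : Fin N → Fin n => ¬ Function.Injective g)).card : ℝ) * n ^ k * n :=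
          mul_le_mul_of_nonneg_right h7 hn0.le
      _ = (((univ.filter (fun g : Fin N → Fin n => ¬ Function.Injective g)).card : ℝ) * n) * n ^ k := by ring
      _ ≤ _ := mul_le_mul_of_nonneg_right h8 (by positivity)
  have h9 := sum_filter_add_sum_filter_not (univ : Finset (Fin N → Fin n)) (fun g => Function.Injective g) (fun g => (c g : ℝ))
  set S1 := ∑ g ∈ univ.filter (fun g : Fin N → Fin n => Function.Injective g), (c g : ℝ)
  set S2 := ∑ g ∈ univ.filter (fun g : Fin N → Fin n => ¬ Function.Injective g), (c g : ℝ)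
  have h10 : δ ^ N * (n : ℝ) ^ (k + N) ≤ S1 + S2 := by rw [h9, h4]; exact h3
  set Q : ℝ := (n : ℝ) ^ (k + N) with hQ
  have hQ0 : 0 < Q := by positivity
  have h5' : S1 ≤ δ ^ N / 2 * Q := by
    calc S1 ≤ _ := h5
      _ = _ := by rw [hQ]; ring
  have h6' : S2 * n ≤ N ^ 2 * Q := by
    calc S2 * n ≤ _ := h6
      _ = _ := by rw [hQ]; ring
  have h11 : δ ^ N / 2 * Q ≤ S2 := by linarith
  have h12 : δ ^ N / 2 * Q * n ≤ N ^ 2 * Q := (mul_le_mul_of_nonneg_right h11 hn0.le).trans h6'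
  have h13 : 2 * (N : ℝ) ^ 2 < n * δ ^ N := by
    have : 2 * (N : ℝ) ^ 2 / δ ^ N < n := by linarith
    rwa [div_lt_iff₀ hd] at this
  nlinarith

theorem box (N : ℕ) (hN : 1 ≤ N) (k : ℕ) : ∀ δ : ℝ, 0 < δ → ∃ n0 : ℕ, ∀ n, n0 ≤ n → ∀ G : Finset (Fin k → Fin n),
    δ * n ^ k ≤ G.card → ∃ A : Fin k → Finset (Fin n), (∀ p, (A p).card = N) ∧ ∀ s, (∀ p, s p ∈ A p) → s ∈ G := by
  induction k with
  | zero =>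
    intro δ hδ
    refine ⟨0, fun n _ G hG => ⟨fun _ => ∅, fun p => p.elim0, fun s _ => ?_⟩⟩
    have : 0 < G.card := by
      have : (0 : ℝ) < G.card := by simp at hG; linarith
      exact_mod_cast this
    obtain ⟨x, hx⟩ := card_pos.1 this
    rwa [Subsingleton.elim s x]
  | succ k ih =>
    intro δ hδ
    obtain ⟨n0, h0⟩ := ih (δ ^ N / 2) (by positivity)
    obtain ⟨n1, hn1⟩ := exists_nat_ge (2 * (N : ℝ) ^ 2 / δ ^ N + 1)
    refine ⟨max n0 n1, fun n hn G hG => ?_⟩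
    obtain ⟨g, hg, hg2⟩ := box_step k n N hN δ hδ
      (hn1.trans (by exact_mod_cast (le_max_right _ _).trans hn)) G hG
    obtain ⟨A, hA1, hA2⟩ := h0 n ((le_max_left _ _).trans hn) _ hg2
    refine ⟨Fin.cons (univ.image g) A, ?_, ?_⟩
    · intro p
      refine Fin.cases ?_ (fun p => ?_) p
      · simp [card_image_of_injective _ hg]
      · simpa using hA1 p
    · intro s hs
      have h1 := hs 0
      simp only [Fin.cons_zero, mem_image, mem_univ, true_and] at h1
      obtain ⟨j, hj⟩ := h1
      have h2 := hA2 (Fin.tail s) (fun p => by simpa [Fin.tail] using hs p.succ)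
      have h3 := (mem_filter.1 h2).2 j
      rw [hj, Fin.cons_self_tail] at h3
      exact h3

end RPM

open Finset
namespace RPM
open scoped Classical

lemma exp_sum_le (n : ℕ) (f : Fin n → ℝ) (hf : ∀ y, |f y| ≤ 1) (hs : ∑ y, f y = 0) (l : ℝ) (hl : |l| ≤ 1) :
    ∑ y, Real.exp (l * f y) ≤ n * Real.exp (l ^ 2) := by
  have h1 : ∀ y, Real.exp (l * f y) ≤ 1 + l * f y + l ^ 2 := by
    intro y
    have hy : |l * f y| ≤ 1 := by
      rw [abs_mul]; exact mul_le_one₀ hl (abs_nonneg _) (hf y)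
    have := Real.abs_exp_sub_one_sub_id_le hy
    rw [abs_le] at this
    have h2 : (l * f y) ^ 2 ≤ l ^ 2 := by
      rw [mul_pow]
      have : f y ^ 2 ≤ 1 := by rw [← sq_abs]; exact pow_le_one₀ (abs_nonneg _) (hf y)
      nlinarith [sq_nonneg l]
    linarith [this.2]
  calc ∑ y, Real.exp (l * f y) ≤ ∑ y, (1 + l * f y + l ^ 2) := sum_le_sum fun y _ => h1 y
    _ = n * (1 + l ^ 2) := by
        rw [sum_add_distrib, sum_add_distrib, ← mul_sum, hs]; simp; ring
    _ ≤ _ := by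
        apply mul_le_mul_of_nonneg_left _ (by positivity)
        have := Real.add_one_le_exp (l ^ 2)
        linarith

/-- upper tail in a box with some coordinates frozen -/
lemma tail_bound (k n : ℕ) (S : Finset (Fin k)) (σ : Fin k → Fin n) (f : Fin n → ℝ)
    (hf : ∀ y, |f y| ≤ 1) (hs : ∑ y, f y = 0) (ε : ℝ) (hε : 0 < ε) (hε1 : ε ≤ 1) (hS : (S.card : ℝ) ≤ ε / 2 * k)
    (B : Finset (Fin k → Fin n)) (hB : ∀ s ∈ B, (∀ p ∈ S, s p = σ p) ∧ ε * k < ∑ p, f (s p)) :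
    (B.card : ℝ) ≤ n ^ (k - S.card) * Real.exp (- ε ^ 2 / 16 * k) := by
  set l : ℝ := ε / 4 with hl
  set t : Fin k → Finset (Fin n) := fun p => if p ∈ S then {σ p} else univ with ht
  set g : Fin k → Fin n → ℝ := fun p y => if p ∈ S then 1 else Real.exp (l * f y) with hg
  have h1 := prod_univ_sum t g
  have h2 : ∏ p, ∑ y ∈ t p, g p y ≤ ∏ p, if p ∈ S then 1 else (n * Real.exp (l ^ 2)) := by
    refine prod_le_prod (fun p _ => sum_nonneg fun y _ => ?_) (fun p _ => ?_)
    · simp only [hg]; split_ifs <;> positivity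
    · by_cases hp : p ∈ S
      · simp [ht, hg, hp]
      · simp only [ht, hg, hp, if_false]
        exact exp_sum_le n f hf hs l (by rw [abs_of_pos (by positivity)]; rw [hl]; linarith)
  have h3 : (∏ p, if p ∈ S then (1 : ℝ) else (n * Real.exp (l ^ 2))) = (n * Real.exp (l ^ 2)) ^ (k - S.card) := by
    rw [prod_ite]
    simp only [prod_const_one, prod_const, one_mul]
    congr 1
    rw [filter_not, card_sdiff_of_subset (filter_subset _ _)]
    simp
  have h4 : (B.card : ℝ) * Real.exp (l * (ε / 2 * k)) ≤ ∑ s ∈ Fintype.piFinset t, ∏ p, g p (s p) := by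
    have hsub : B ⊆ Fintype.piFinset t := by
      intro s hs
      rw [Fintype.mem_piFinset]
      intro p
      by_cases hp : p ∈ S
      · simp [ht, hp, (hB s hs).1 p hp]
      · simp [ht, hp]
    calc (B.card : ℝ) * Real.exp (l * (ε / 2 * k)) ≤ ∑ s ∈ B, ∏ p, g p (s p) := by
          rw [← nsmul_eq_mul]
          refine card_nsmul_le_sum _ _ _ fun s hs => ?_
          have e1 : ∏ p, g p (s p) = Real.exp (∑ p, if p ∈ S then 0 else l * f (s p)) := by
            rw [Real.exp_sum]
            refine prod_congr rfl fun p _ => ?_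
            simp only [hg]; split_ifs <;> simp
          rw [e1]
          apply Real.exp_le_exp.2
          have e2 : ∑ p, l * f (s p) ≤ (∑ p, if p ∈ S then 0 else l * f (s p)) + l * S.card := by
            have : (l * S.card) = ∑ p : Fin k, if p ∈ S then l else 0 := by
              rw [sum_ite_mem]; simp; ring
            rw [this, ← sum_add_distrib]
            refine sum_le_sum fun p _ => ?_
            split_ifs
            · have := (abs_le.1 (hf (s p))).2
              have hl0 : 0 < l := by positivity
              nlinarith
            · simp
          rw [← mul_sum] at e2
          have e3 := (hB s hs).2
          have hl0 : 0 < l := by positivity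
          have e4 : l * S.card ≤ l * (ε / 2 * k) := mul_le_mul_of_nonneg_left hS hl0.le
          have e5 : l * (ε * k) ≤ l * ∑ p, f (s p) := mul_le_mul_of_nonneg_left e3.le hl0.le
          nlinarith
      _ ≤ _ := by
          refine sum_le_sum_of_subset_of_nonneg hsub fun s _ _ => prod_nonneg fun p _ => ?_
          simp only [hg]; split_ifs <;> positivity
  rw [← h1] at h4
  have h5 := (h4.trans h2).trans_eq h3
  rw [mul_pow, ← Real.exp_nat_mul] at h5
  have h6 : Real.exp (((k - S.card : ℕ) : ℝ) * l ^ 2) ≤ Real.exp (k * l ^ 2) := by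
    apply Real.exp_le_exp.2
    apply mul_le_mul_of_nonneg_right _ (by positivity)
    exact_mod_cast Nat.sub_le _ _
  have h7 : (B.card : ℝ) * Real.exp (l * (ε / 2 * k)) ≤ (n : ℝ) ^ (k - S.card) * Real.exp (k * l ^ 2) :=
    h5.trans (mul_le_mul_of_nonneg_left h6 (by positivity))
  have h8 : (B.card : ℝ) = (B.card : ℝ) * Real.exp (l * (ε / 2 * k)) * Real.exp (- (l * (ε / 2 * k))) := by
    rw [mul_assoc, ← Real.exp_add]; simp
  rw [h8]
  calc _ ≤ (n : ℝ) ^ (k - S.card) * Real.exp (k * l ^ 2) * Real.exp (- (l * (ε / 2 * k))) :=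
        mul_le_mul_of_nonneg_right h7 (by positivity)
    _ = _ := by
        rw [mul_assoc, ← Real.exp_add]
        congr 2
        rw [hl]; ring

/-- counting by frozen coordinates -/
lemma freeze (k n : ℕ) (S : Finset (Fin k)) (B : Finset (Fin k → Fin n)) (δ : ℝ) (hn : 0 < n)
    (h : ∀ σ : Fin k → Fin n, ((B.filter (fun s => ∀ p ∈ S, s p = σ p)).card : ℝ) ≤ n ^ (k - S.card) * δ) :
    (B.card : ℝ) ≤ n ^ k * δ := by
  have hc : ∀ s : Fin k → Fin n, ((univ : Finset (Fin k → Fin n)).filter (fun σ => ∀ p ∈ S, s p = σ p)).card = n ^ (k - S.card) := by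
    intro s
    have : ((univ : Finset (Fin k → Fin n)).filter (fun σ => ∀ p ∈ S, s p = σ p)) =
        Fintype.piFinset (fun p => if p ∈ S then {s p} else univ) := by
      ext σ
      simp only [mem_filter, mem_univ, true_and, Fintype.mem_piFinset]
      refine forall_congr' fun p => ?_
      by_cases hp : p ∈ S <;> simp [hp, eq_comm]
    rw [this, Fintype.card_piFinset]
    have : ∀ p, (if p ∈ S then ({s p} : Finset (Fin n)) else univ).card = if p ∈ S then 1 else n := by
      intro p; split_ifs <;> simp
    simp_rw [this]
    rw [prod_ite]
    simp only [prod_const_one, prod_const, one_mul]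
    congr 1
    rw [filter_not, card_sdiff_of_subset (filter_subset _ _)]
    simp
  have h1 : ∑ σ : Fin k → Fin n, (B.filter (fun s => ∀ p ∈ S, s p = σ p)).card = B.card * n ^ (k - S.card) := by
    simp_rw [card_filter]
    rw [sum_comm]
    rw [← smul_eq_mul, ← sum_const]
    refine sum_congr rfl fun s _ => ?_
    rw [← hc s, card_filter]
  have h2 : ((B.card : ℝ)) * n ^ (k - S.card) ≤ ∑ σ : Fin k → Fin n, (n : ℝ) ^ (k - S.card) * δ := by
    have : ((B.card : ℝ)) * n ^ (k - S.card) = ∑ σ : Fin k → Fin n, ((B.filter (fun s => ∀ p ∈ S, s p = σ p)).card : ℝ) := by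
      exact_mod_cast h1.symm
    rw [this]
    exact sum_le_sum fun σ _ => h σ
  rw [sum_const, card_univ, Fintype.card_fun, Fintype.card_fin, Fintype.card_fin, nsmul_eq_mul] at h2
  have h3 : (0 : ℝ) < (n : ℝ) ^ (k - S.card) := by positivity
  have h4 : (n : ℝ) ^ (k - S.card) * B.card ≤ (n : ℝ) ^ (k - S.card) * (n ^ k * δ) := by
    push_cast at h2; linarith
  exact le_of_mul_le_mul_left h4 h3

end RPM

open Finset
namespace RPM
open scoped Classical

lemma samp_phi (u k n : ℕ) (hn : 0 < n) (hk : 0 < k) (φ : Fin u → Fin k) (f : (Fin u → Fin n) → Fin n → ℝ)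
    (hf : ∀ x y, 0 ≤ f x y ∧ f x y ≤ 1) (ε : ℝ) (hε : 0 < ε) (hε1 : ε ≤ 1) (hu : (u : ℝ) ≤ ε / 2 * k) :
    (((univ : Finset (Fin k → Fin n)).filter (fun s =>
      ε < |(∑ p, f (s ∘ φ) (s p)) / k - (∑ y, f (s ∘ φ) y) / n|)).card : ℝ) ≤
      n ^ k * (2 * Real.exp (- ε ^ 2 / 16 * k)) := by
  have hn' : (0 : ℝ) < n := by exact_mod_cast hn
  have hk' : (0 : ℝ) < k := by exact_mod_cast hk
  set S : Finset (Fin k) := univ.image φ with hS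
  have hSc : (S.card : ℝ) ≤ ε / 2 * k := by
    refine le_trans ?_ hu
    have : S.card ≤ u := card_image_le.trans (by simp)
    exact_mod_cast this
  refine freeze k n S _ _ hn fun σ => ?_
  set μ : ℝ := (∑ y, f (σ ∘ φ) y) / n with hμ
  have hμ01 : 0 ≤ μ ∧ μ ≤ 1 := by
    constructor
    · exact div_nonneg (sum_nonneg fun y _ => (hf _ y).1) hn'.le
    · rw [hμ, div_le_one hn']
      calc _ ≤ ∑ y : Fin n, (1 : ℝ) := sum_le_sum fun y _ => (hf _ y).2
        _ = n := by simp
  set g : Fin n → ℝ := fun y => f (σ ∘ φ) y - μ with hg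
  have hg1 : ∀ y, |g y| ≤ 1 := by
    intro y
    have := hf (σ ∘ φ) y
    rw [abs_le]; simp only [hg]; constructor <;> linarith [hμ01.1, hμ01.2]
  have hg0 : ∑ y, g y = 0 := by
    simp only [hg, sum_sub_distrib, sum_const, card_univ, Fintype.card_fin, nsmul_eq_mul]
    rw [hμ]; field_simp; ring
  set B := ((univ : Finset (Fin k → Fin n)).filter (fun s =>
      ε < |(∑ p, f (s ∘ φ) (s p)) / k - (∑ y, f (s ∘ φ) y) / n|)).filter (fun s => ∀ p ∈ S, s p = σ p) with hBdef
  have hkey : ∀ s ∈ B, (∀ p ∈ S, s p = σ p) ∧ ε * k < |∑ p, g (s p)| := by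
    intro s hs
    obtain ⟨h1, h2⟩ := mem_filter.1 hs
    refine ⟨h2, ?_⟩
    have h1 := (mem_filter.1 h1).2
    have h3 : s ∘ φ = σ ∘ φ := by
      funext j; exact h2 _ (mem_image_of_mem _ (mem_univ _))
    rw [h3] at h1
    have h4 : ∑ p, g (s p) = ((∑ p, f (σ ∘ φ) (s p)) / k - μ) * k := by
      simp only [hg, sum_sub_distrib, sum_const, card_univ, Fintype.card_fin, nsmul_eq_mul]
      field_simp
    rw [h4, abs_mul, abs_of_pos hk']
    exact mul_lt_mul_of_pos_right h1 hk'
  have b1 := tail_bound k n S σ g hg1 hg0 ε hε hε1 hSc (B.filter (fun s => ε * k < ∑ p, g (s p)))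
    (by intro s hs
        obtain ⟨h1, h2⟩ := mem_filter.1 hs
        exact ⟨(hkey s h1).1, h2⟩)
  have b2 := tail_bound k n S σ (fun y => - g y) (by intro y; rw [abs_neg]; exact hg1 y)
    (by rw [sum_neg_distrib, hg0, neg_zero]) ε hε hε1 hSc (B.filter (fun s => ¬ ε * k < ∑ p, g (s p)))
    (by intro s hs
        obtain ⟨h1, h2⟩ := mem_filter.1 hs
        refine ⟨(hkey s h1).1, ?_⟩
        rw [sum_neg_distrib]
        rcases lt_abs.1 (hkey s h1).2 with h | h
        · exact absurd h h2
        · exact h)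
  have h5 : B.card = (B.filter (fun s => ε * k < ∑ p, g (s p))).card + (B.filter (fun s => ¬ ε * k < ∑ p, g (s p))).card :=
    (card_filter_add_card_filter_not _).symm
  have h5' : (B.card : ℝ) = (B.filter (fun s => ε * k < ∑ p, g (s p))).card + (B.filter (fun s => ¬ ε * k < ∑ p, g (s p))).card := by
    exact_mod_cast h5
  linarith

/-- eventually the union bound is small -/
lemma exp_small (u : ℕ) (ε : ℝ) (hε : 0 < ε) : ∃ k0 : ℕ, ∀ k, k0 ≤ k →
    (k : ℝ) ^ u * (2 * Real.exp (- ε ^ 2 / 16 * k)) ≤ ε ∧ (u : ℝ) ≤ ε / 2 * k ∧ 0 < k := by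
  have h1 : Filter.Tendsto (fun x : ℝ => x ^ u * Real.exp (- (ε ^ 2 / 16) * x)) Filter.atTop (nhds 0) := by
    have := Real.tendsto_pow_mul_exp_neg_atTop_nhds_zero u
    have h2 : Filter.Tendsto (fun x : ℝ => (ε ^ 2 / 16) * x) Filter.atTop Filter.atTop :=
      Filter.tendsto_id.const_mul_atTop (by positivity)
    have h3 := this.comp h2
    have h4 := h3.const_mul (((ε ^ 2 / 16) ^ u)⁻¹)
    rw [mul_zero] at h4
    refine h4.congr fun x => ?_
    simp only [Function.comp]
    have : (ε ^ 2 / 16) ^ u ≠ 0 := by positivity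
    rw [mul_pow]
    field_simp
  have h2 := (h1.comp tendsto_natCast_atTop_atTop).eventually (gt_mem_nhds (show (0 : ℝ) < ε / 2 by positivity))
  obtain ⟨k1, hk1⟩ := Filter.eventually_atTop.1 h2
  obtain ⟨k2, hk2⟩ := exists_nat_ge ((u : ℝ) / (ε / 2))
  refine ⟨max k1 (max k2 1), fun k hk => ⟨?_, ?_, by omega⟩⟩
  · have := hk1 k (by omega)
    simp only [Function.comp] at this
    have e : - (ε ^ 2 / 16) * (k : ℝ) = - ε ^ 2 / 16 * k := by ring
    rw [e] at this
    linarith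
  · have h3 : (k2 : ℝ) ≤ k := by exact_mod_cast (by omega : k2 ≤ k)
    have h4 := hk2.trans h3
    rwa [div_le_iff₀ (by positivity), mul_comm] at h4

lemma samp1 (u : ℕ) (ε : ℝ) (hε : 0 < ε) (hε1 : ε ≤ 1) : ∃ k0 : ℕ, ∀ k, k0 ≤ k → ∀ n, 0 < n →
    ∀ f : (Fin u → Fin n) → Fin n → ℝ, (∀ x y, 0 ≤ f x y ∧ f x y ≤ 1) →
    (((univ : Finset (Fin k → Fin n)).filter (fun s => ∃ φ : Fin u → Fin k,
      ε < |(∑ p, f (s ∘ φ) (s p)) / k - (∑ y, f (s ∘ φ) y) / n|)).card : ℝ) ≤ ε * n ^ k := by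
  obtain ⟨k0, hk0⟩ := exp_small u ε hε
  refine ⟨k0, fun k hk n hn f hf => ?_⟩
  obtain ⟨h1, h2, h3⟩ := hk0 k hk
  have hsub : ((univ : Finset (Fin k → Fin n)).filter (fun s => ∃ φ : Fin u → Fin k,
      ε < |(∑ p, f (s ∘ φ) (s p)) / k - (∑ y, f (s ∘ φ) y) / n|)) ⊆
      (univ : Finset (Fin u → Fin k)).biUnion (fun φ => (univ : Finset (Fin k → Fin n)).filter (fun s =>
      ε < |(∑ p, f (s ∘ φ) (s p)) / k - (∑ y, f (s ∘ φ) y) / n|)) := by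
    intro s hs
    obtain ⟨φ, hφ⟩ := (mem_filter.1 hs).2
    exact mem_biUnion.2 ⟨φ, mem_univ _, mem_filter.2 ⟨mem_univ _, hφ⟩⟩
  have h4 := (card_le_card hsub).trans card_biUnion_le
  have h5 : (((univ : Finset (Fin k → Fin n)).filter (fun s => ∃ φ : Fin u → Fin k,
      ε < |(∑ p, f (s ∘ φ) (s p)) / k - (∑ y, f (s ∘ φ) y) / n|)).card : ℝ) ≤
      ∑ φ : Fin u → Fin k, (((univ : Finset (Fin k → Fin n)).filter (fun s =>
      ε < |(∑ p, f (s ∘ φ) (s p)) / k - (∑ y, f (s ∘ φ) y) / n|)).card : ℝ) := by exact_mod_cast h4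
  refine h5.trans ((sum_le_sum fun φ _ => samp_phi u k n hn h3 φ f hf ε hε hε1 h2).trans ?_)
  rw [sum_const, card_univ, Fintype.card_fun, Fintype.card_fin, Fintype.card_fin, nsmul_eq_mul]
  push_cast
  calc (k : ℝ) ^ u * (n ^ k * (2 * Real.exp (- ε ^ 2 / 16 * k)))
      = ((k : ℝ) ^ u * (2 * Real.exp (- ε ^ 2 / 16 * k))) * n ^ k := by ring
    _ ≤ _ := mul_le_mul_of_nonneg_right h1 (by positivity)

lemma sum_cons (m : ℕ) {X : Type} [Fintype X] (F : (Fin (m + 1) → X) → ℝ) :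
    ∑ y, F y = ∑ x, ∑ y : Fin m → X, F (Fin.cons x y) := by
  rw [← Fintype.sum_prod_type']
  refine Fintype.sum_equiv (Fin.consEquiv (fun _ => X)).symm _ _ ?_
  intro y
  simp [Fin.consEquiv, Fin.cons_self_tail]

/-- deviation of the sample mean -/
noncomputable def dev {k n u m : ℕ} (F : (Fin u → Fin n) → (Fin m → Fin n) → ℝ) (s : Fin k → Fin n)
    (φ : Fin u → Fin k) : ℝ :=
  |(∑ ψ : Fin m → Fin k, F (s ∘ φ) (s ∘ ψ)) / k ^ m - (∑ y : Fin m → Fin n, F (s ∘ φ) y) / n ^ m|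

lemma samp (m : ℕ) : ∀ (u : ℕ) (ε : ℝ), 0 < ε → ε ≤ 1 → ∃ k0 : ℕ, ∀ k, k0 ≤ k → ∀ n, 0 < n →
    ∀ F : (Fin u → Fin n) → (Fin m → Fin n) → ℝ, (∀ x y, 0 ≤ F x y ∧ F x y ≤ 1) →
    (((univ : Finset (Fin k → Fin n)).filter (fun s => ∃ φ : Fin u → Fin k, ε < dev F s φ)).card : ℝ)
      ≤ ε * n ^ k := by
  induction m with
  | zero =>
    intro u ε hε _
    refine ⟨0, fun k _ n hn F _ => ?_⟩
    have : ((univ : Finset (Fin k → Fin n)).filter (fun s => ∃ φ : Fin u → Fin k, ε < dev F s φ)) = ∅ := by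
      apply filter_eq_empty_iff.2
      rintro s - ⟨φ, hφ⟩
      have : dev F s φ = 0 := by
        unfold dev
        have e1 : ∑ ψ : Fin 0 → Fin k, F (s ∘ φ) (s ∘ ψ) = F (s ∘ φ) (fun i => i.elim0) := by
          rw [Fintype.sum_unique]
          exact congrArg _ (Subsingleton.elim _ _)
        have e2 : ∑ y : Fin 0 → Fin n, F (s ∘ φ) y = F (s ∘ φ) (fun i => i.elim0) := by
          rw [Fintype.sum_unique]
          exact congrArg _ (Subsingleton.elim _ _)
        rw [e1, e2]; simp
      linarith
    rw [this]; simp; positivity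
  | succ m ih =>
    intro u ε hε hε1
    obtain ⟨k1, h1⟩ := ih (u + 1) (ε / 2) (by positivity) (by linarith)
    obtain ⟨k2, h2⟩ := samp1 u (ε / 2) (by positivity) (by linarith)
    refine ⟨max 1 (max k1 k2), fun k hk n hn F hF => ?_⟩
    have hk0 : (0 : ℝ) < k := by exact_mod_cast (by omega : 0 < k)
    have hn0 : (0 : ℝ) < n := by exact_mod_cast hn
    have b1 := h1 k (by omega) n hn (fun x y => F (Fin.tail x) (Fin.cons (x 0) y)) (fun x y => hF _ _)
    have b2 := h2 k (by omega) n hn (fun x z => (∑ y : Fin m → Fin n, F x (Fin.cons z y)) / n ^ m) (by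
      intro x z
      constructor
      · exact div_nonneg (sum_nonneg fun y _ => (hF _ _).1) (by positivity)
      · rw [div_le_one (by positivity)]
        calc _ ≤ ∑ y : Fin m → Fin n, (1 : ℝ) := sum_le_sum fun y _ => (hF _ _).2
          _ = _ := by simp)
    set B1 := ((univ : Finset (Fin k → Fin n)).filter (fun s => ∃ φ : Fin (u + 1) → Fin k,
      ε / 2 < dev (fun x y => F (Fin.tail x) (Fin.cons (x 0) y)) s φ))
    set B2 := ((univ : Finset (Fin k → Fin n)).filter (fun s => ∃ φ : Fin u → Fin k,
      ε / 2 < |(∑ p, (∑ y : Fin m → Fin n, F (s ∘ φ) (Fin.cons (s p) y)) / n ^ m) / k -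
        (∑ z, (∑ y : Fin m → Fin n, F (s ∘ φ) (Fin.cons z y)) / n ^ m) / n|))
    have hsub : ((univ : Finset (Fin k → Fin n)).filter (fun s => ∃ φ : Fin u → Fin k, ε < dev F s φ)) ⊆ B1 ∪ B2 := by
      intro s hs
      obtain ⟨φ, hφ⟩ := (mem_filter.1 hs).2
      by_contra hcon
      simp only [mem_union, not_or, B1, B2, mem_filter, mem_univ, true_and, not_exists, not_lt] at hcon
      obtain ⟨c1, c2⟩ := hcon
      have c2 := c2 φ
      have c3 : ∀ p : Fin k, |(∑ ψ : Fin m → Fin k, F (s ∘ φ) (s ∘ (Fin.cons p ψ : Fin (m + 1) → Fin k))) / k ^ m -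
          (∑ y : Fin m → Fin n, F (s ∘ φ) (Fin.cons (s p) y)) / n ^ m| ≤ ε / 2 := by
        intro p
        have := c1 (Fin.cons p φ)
        unfold dev at this
        have e1 : Fin.tail (s ∘ (Fin.cons p φ : Fin (u + 1) → Fin k)) = s ∘ φ := by
          funext j; simp [Fin.tail]
        have e2 : (s ∘ (Fin.cons p φ : Fin (u + 1) → Fin k)) 0 = s p := by simp
        have e3 : ∀ ψ : Fin m → Fin k, (s ∘ (Fin.cons p ψ : Fin (m + 1) → Fin k)) = (Fin.cons (s p) (s ∘ ψ) : Fin (m + 1) → Fin n) := by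
          intro ψ
          funext j
          refine Fin.cases ?_ (fun j => ?_) j <;> simp
        simp only [e1, e2] at this
        simp only [e3]
        exact this
      have c4 : dev F s φ ≤ ε := by
        unfold dev
        rw [sum_cons, sum_cons]
        set a : Fin k → ℝ := fun p => (∑ ψ : Fin m → Fin k, F (s ∘ φ) (s ∘ (Fin.cons p ψ : Fin (m + 1) → Fin k))) / k ^ m
        set b : Fin k → ℝ := fun p => (∑ y : Fin m → Fin n, F (s ∘ φ) (Fin.cons (s p) y)) / n ^ m
        have e1 : (∑ p, ∑ ψ : Fin m → Fin k, F (s ∘ φ) (s ∘ (Fin.cons p ψ : Fin (m + 1) → Fin k))) / (k : ℝ) ^ (m + 1)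
            = (∑ p, a p) / k := by
          simp only [a]
          rw [← sum_div, div_div, pow_succ]
        have e2 : (∑ z, ∑ y : Fin m → Fin n, F (s ∘ φ) (Fin.cons z y)) / (n : ℝ) ^ (m + 1) =
            (∑ z, (∑ y : Fin m → Fin n, F (s ∘ φ) (Fin.cons z y)) / n ^ m) / n := by
          rw [← sum_div, div_div, pow_succ]
        rw [e1, e2]
        have e3 : |(∑ p, a p) / k - (∑ p, b p) / k| ≤ ε / 2 := by
          rw [← sub_div, abs_div, abs_of_pos hk0, div_le_iff₀ hk0, ← sum_sub_distrib]
          calc |∑ p, (a p - b p)| ≤ ∑ p, |a p - b p| := abs_sum_le_sum_abs _ _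
            _ ≤ ∑ p : Fin k, ε / 2 := sum_le_sum fun p _ => c3 p
            _ = _ := by simp; ring
        calc _ ≤ |(∑ p, a p) / k - (∑ p, b p) / k| + _ := abs_sub_le _ ((∑ p, b p) / k) _
          _ ≤ ε / 2 + ε / 2 := add_le_add e3 c2
          _ = ε := by ring
      linarith
    have h5 : (((univ : Finset (Fin k → Fin n)).filter (fun s => ∃ φ : Fin u → Fin k, ε < dev F s φ)).card : ℝ) ≤
        B1.card + B2.card := by exact_mod_cast (card_le_card hsub).trans (card_union_le _ _)
    linarith

/-- boolean version with `4` parameters, `4` variables and a finite family -/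
theorem samp_fam (ι : Type) [Fintype ι] (ε : ℝ) (hε : 0 < ε) (hε1 : ε ≤ 1) : ∃ k0 : ℕ, ∀ k, k0 ≤ k → ∀ n, 0 < n →
    ∀ Q : ι → (Fin 4 → Fin n) → (Fin 4 → Fin n) → Prop,
    (((univ : Finset (Fin k → Fin n)).filter (fun s => ∃ j, ∃ φ : Fin 4 → Fin k,
      ε < |(((univ : Finset (Fin 4 → Fin k)).filter (fun ψ => Q j (s ∘ φ) (s ∘ ψ))).card : ℝ) / k ^ 4
        - (((univ : Finset (Fin 4 → Fin n)).filter (fun y => Q j (s ∘ φ) y)).card : ℝ) / n ^ 4|)).card : ℝ)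
      ≤ ε * n ^ k := by
  set δ : ℝ := ε / (Fintype.card ι + 1) with hδ
  have hδε : δ ≤ ε := by
    rw [hδ, div_le_iff₀ (by positivity)]
    nlinarith [(Nat.cast_nonneg (Fintype.card ι) : (0 : ℝ) ≤ Fintype.card ι)]
  obtain ⟨k0, h0⟩ := samp 4 4 δ (by positivity) (hδε.trans hε1)
  refine ⟨k0, fun k hk n hn Q => ?_⟩
  have h1 := fun j => h0 k hk n hn (fun x y => if Q j x y then 1 else 0) (by
    intro x y; split_ifs <;> norm_num)
  have hsub : ((univ : Finset (Fin k → Fin n)).filter (fun s => ∃ j, ∃ φ : Fin 4 → Fin k,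
      ε < |(((univ : Finset (Fin 4 → Fin k)).filter (fun ψ => Q j (s ∘ φ) (s ∘ ψ))).card : ℝ) / k ^ 4
        - (((univ : Finset (Fin 4 → Fin n)).filter (fun y => Q j (s ∘ φ) y)).card : ℝ) / n ^ 4|)) ⊆
      (univ : Finset ι).biUnion (fun j => (univ : Finset (Fin k → Fin n)).filter (fun s => ∃ φ : Fin 4 → Fin k,
        δ < dev (fun x y => if Q j x y then 1 else 0) s φ)) := by
    intro s hs
    obtain ⟨j, φ, h⟩ := (mem_filter.1 hs).2
    refine mem_biUnion.2 ⟨j, mem_univ _, mem_filter.2 ⟨mem_univ _, φ, ?_⟩⟩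
    unfold dev
    simp only [sum_boole]
    exact hδε.trans_lt h
  have h2 := (card_le_card hsub).trans card_biUnion_le
  have h2' := (Nat.cast_le (α := ℝ)).2 h2
  rw [Nat.cast_sum] at h2'
  refine h2'.trans ?_
  refine (sum_le_sum fun j _ => h1 j).trans ?_
  rw [sum_const, nsmul_eq_mul, card_univ]
  have : (Fintype.card ι : ℝ) * δ ≤ ε := by
    rw [hδ, mul_div_assoc', div_le_iff₀ (by positivity)]
    nlinarith
  calc (Fintype.card ι : ℝ) * (δ * n ^ k) = (Fintype.card ι : ℝ) * δ * n ^ k := by ring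
    _ ≤ _ := mul_le_mul_of_nonneg_right this (by positivity)

end RPM

open Finset
namespace RPM
open scoped Classical

/-- indicator vector of a tuple -/
def chiZ {k : ℕ} (e : Fin 4 → Fin k) : Fin 4 → Fin k → ℤ := fun c p => if e c = p then 1 else 0

def LatH {k : ℕ} (P : Finset (Fin 4 → Fin k)) : Prop :=
  ∀ c p q, p ≠ q → ∃ e ∈ P, ∃ e' ∈ P, (∀ c', c' ≠ c → e c' = e' c') ∧ e c = p ∧ e' c = q

lemma lat_span {k : ℕ} (hk : 0 < k) (P : Finset (Fin 4 → Fin k)) (hP : LatH P) (d : Fin 4 → Fin k → ℤ)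
    (hd : ∀ c, ∑ p, d c p = 0) : d ∈ Submodule.span ℤ (Set.image chiZ (P : Set (Fin 4 → Fin k))) := by
  set p0 : Fin k := ⟨0, hk⟩
  set S := Submodule.span ℤ (Set.image chiZ (P : Set (Fin 4 → Fin k)))
  have key : ∀ c p, (fun c' q => if c' = c then ((if p = q then 1 else 0) - (if p0 = q then 1 else 0) : ℤ) else 0) ∈ S := by
    intro c p
    by_cases h : p = p0
    · have : (fun c' q => if c' = c then ((if p = q then 1 else 0) - (if p0 = q then 1 else 0) : ℤ) else 0) = (0 : Fin 4 → Fin k → ℤ) := by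
        funext c' q; rw [h]; simp
      rw [this]; exact S.zero_mem
    · obtain ⟨e, he, e', he', h1, h2, h3⟩ := hP c p p0 h
      have : (fun c' q => if c' = c then ((if p = q then 1 else 0) - (if p0 = q then 1 else 0) : ℤ) else 0) = chiZ e - chiZ e' := by
        funext c' q
        simp only [Pi.sub_apply, chiZ]
        by_cases hc : c' = c
        · subst hc; simp [h2, h3]
        · simp [hc, h1 c' hc]
      rw [this]
      exact S.sub_mem (Submodule.subset_span ⟨e, he, rfl⟩) (Submodule.subset_span ⟨e', he', rfl⟩)
  have hsum : d = ∑ c, ∑ p, d c p • (fun c' q => if c' = c then ((if p = q then 1 else 0) - (if p0 = q then 1 else 0) : ℤ) else 0) := by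
    funext c' q
    simp only [Finset.sum_apply, Pi.smul_apply, smul_eq_mul]
    rw [Finset.sum_eq_single c']
    · simp only [if_true, mul_sub, sum_sub_distrib, ← sum_mul, hd]
      simp
    · intro b _ hb
      simp [Ne.symm hb]
    · simp
  rw [hsum]
  exact S.sum_mem fun c _ => S.sum_mem fun p _ => S.smul_mem _ (key c p)

lemma lat_rep {k : ℕ} (hk : 0 < k) (P : Finset (Fin 4 → Fin k)) (hP : LatH P) (hne : P.Nonempty) (d : Fin 4 → Fin k → ℤ)
    (D : ℤ) (hd : ∀ c, ∑ p, d c p = D) : ∃ y : (Fin 4 → Fin k) → ℤ, ∀ c p, ∑ e ∈ P.filter (fun e => e c = p), y e = d c p := by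
  obtain ⟨e0, he0⟩ := hne
  have h1 := lat_span hk P hP (d - D • chiZ e0) (by
    intro c
    simp only [Pi.sub_apply, Pi.smul_apply, smul_eq_mul, sum_sub_distrib, hd, ← mul_sum]
    simp [chiZ])
  have h2 : d ∈ Submodule.span ℤ (Set.image chiZ (P : Set (Fin 4 → Fin k))) := by
    have := Submodule.add_mem _ h1 (Submodule.smul_mem _ D (Submodule.subset_span ⟨e0, he0, rfl⟩))
    simpa using this
  rw [Submodule.mem_span_image_finset_iff_exists_fun] at h2
  obtain ⟨y, hy⟩ := h2
  refine ⟨fun e => if h : e ∈ P then y ⟨e, h⟩ else 0, fun c p => ?_⟩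
  rw [← hy]
  simp only [Finset.sum_apply, Pi.smul_apply, smul_eq_mul, chiZ]
  rw [sum_filter, ← sum_coe_sort P]
  refine sum_congr rfl fun e _ => ?_
  by_cases h : (e : Fin 4 → Fin k) c = p <;> simp [h]

theorem intsol {k : ℕ} (hk : 0 < k) (P : Finset (Fin 4 → Fin k)) (hP : LatH P) (hne : P.Nonempty)
    (w : (Fin 4 → Fin k) → ℝ) (hw : ∀ e ∈ P, 0 < w e)
    (hw1 : ∀ c p, ∑ e ∈ P.filter (fun e => e c = p), w e = 1)
    (u : Fin 4 → Fin k → ℕ) (U : ℕ) (hu : ∀ c, ∑ p, u c p = U) :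
    ∃ (N : ℕ) (z : (Fin 4 → Fin k) → ℕ), 1 ≤ N ∧ ∀ c p, ∑ e ∈ P.filter (fun e => e c = p), z e + u c p = N := by
  have hrep : ∀ d : Fin 4 → Fin k → ℤ, ∃ y : (Fin 4 → Fin k) → ℤ, (∃ D, ∀ c, ∑ p, d c p = D) →
      ∀ c p, ∑ e ∈ P.filter (fun e => e c = p), y e = d c p := by
    intro d
    by_cases h : ∃ D, ∀ c, ∑ p, d c p = D
    · obtain ⟨D, hD⟩ := h
      obtain ⟨y, hy⟩ := lat_rep hk P hP hne d D hD
      exact ⟨y, fun _ => hy⟩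
    · exact ⟨0, fun h' => absurd h' h⟩
  choose y hy using hrep
  set B : ℤ := P.card + U with hB
  set S : Finset (Fin 4 → Fin k → ℤ) := Fintype.piFinset fun _ => Fintype.piFinset fun _ => Finset.Icc (-B) B
  set Y : ℤ := ∑ d ∈ S, ∑ e, |y d e| with hY
  have hYb : ∀ d ∈ S, ∀ e, |y d e| ≤ Y := by
    intro d hd e
    calc |y d e| ≤ ∑ e, |y d e| := single_le_sum (f := fun e => |y d e|) (fun e _ => abs_nonneg _) (mem_univ e)
      _ ≤ Y := single_le_sum (f := fun d => ∑ e, |y d e|) (fun d _ => sum_nonneg fun e _ => abs_nonneg _) hd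
  have hK : ∃ K : ℕ, 1 ≤ K ∧ ∀ e ∈ P, (Y : ℝ) + 1 ≤ K * w e := by
    obtain ⟨K, hK⟩ := exists_nat_ge (∑ e ∈ P, |((Y : ℝ) + 1) / w e|)
    refine ⟨K + 1, by omega, fun e he => ?_⟩
    have h1 : |((Y : ℝ) + 1) / w e| ≤ K := (single_le_sum (f := fun e => |((Y : ℝ) + 1) / w e|) (fun e _ => abs_nonneg _) he).trans hK
    have h2 := (le_abs_self _).trans h1
    rw [div_le_iff₀ (hw e he)] at h2
    push_cast
    nlinarith [hw e he]
  obtain ⟨K, hK1, hK⟩ := hK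
  set fl : (Fin 4 → Fin k) → ℤ := fun e => ⌊(K : ℝ) * w e⌋ with hfl
  set d : Fin 4 → Fin k → ℤ := fun c p => K - u c p - ∑ e ∈ P.filter (fun e => e c = p), fl e with hd
  have hfib : ∀ c (f : (Fin 4 → Fin k) → ℤ), ∑ p, ∑ e ∈ P.filter (fun e => e c = p), f e = ∑ e ∈ P, f e := by
    intro c f
    exact sum_fiberwise P (fun e => e c) f
  have hdD : ∃ D, ∀ c, ∑ p, d c p = D := by
    refine ⟨k * K - U - ∑ e ∈ P, fl e, fun c => ?_⟩
    simp only [hd, sum_sub_distrib, hfib]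
    have := hu c
    simp only [sum_const, card_univ, Fintype.card_fin, nsmul_eq_mul]
    rw [← this]; push_cast; ring
  have hdS : d ∈ S := by
    simp only [S, Fintype.mem_piFinset, Finset.mem_Icc]
    intro c p
    have h1 : (u c p : ℤ) ≤ U := by
      have := single_le_sum (f := fun p => u c p) (fun p _ => Nat.zero_le _) (mem_univ p)
      rw [hu] at this
      exact_mod_cast this
    have h1' : (0 : ℤ) ≤ u c p := by positivity
    have h2 : ((K : ℝ) - ∑ e ∈ P.filter (fun e => e c = p), (fl e : ℝ)) = ∑ e ∈ P.filter (fun e => e c = p), (K * w e - fl e) := by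
      rw [sum_sub_distrib, ← mul_sum, hw1]; ring
    have h3 : (0 : ℝ) ≤ ∑ e ∈ P.filter (fun e => e c = p), (K * w e - fl e) :=
      sum_nonneg fun e _ => sub_nonneg.2 (Int.floor_le _)
    have h4 : ∑ e ∈ P.filter (fun e => e c = p), (K * w e - fl e) ≤ P.card := by
      calc _ ≤ ∑ e ∈ P.filter (fun e => e c = p), (1 : ℝ) := sum_le_sum fun e _ => by
            have := Int.lt_floor_add_one ((K : ℝ) * w e)
            simp only [hfl]; linarith
        _ ≤ _ := by
          simp only [sum_const, nsmul_eq_mul, mul_one]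
          exact_mod_cast card_le_card (filter_subset _ _)
    rw [← h2] at h3 h4
    have h3' : (0 : ℤ) ≤ K - ∑ e ∈ P.filter (fun e => e c = p), fl e := by exact_mod_cast h3
    have h4' : (K : ℤ) - ∑ e ∈ P.filter (fun e => e c = p), fl e ≤ P.card := by exact_mod_cast h4
    have h5 : (0 : ℤ) ≤ P.card := by positivity
    simp only [hd, hB]
    constructor <;> linarith
  have hpos : ∀ e ∈ P, 0 ≤ fl e + y d e := by
    intro e he
    have h1 := hYb d hdS e
    have h2 : Y ≤ fl e := by
      simp only [hfl]
      apply Int.le_floor.2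
      linarith [hK e he]
    linarith [neg_abs_le (y d e)]
  refine ⟨K, fun e => (fl e + y d e).toNat, hK1, fun c p => ?_⟩
  have h1 := hy d hdD c p
  zify
  have h2 : ∑ e ∈ P.filter (fun e => e c = p), ((fl e + y d e).toNat : ℤ) = ∑ e ∈ P.filter (fun e => e c = p), (fl e + y d e) :=
    sum_congr rfl fun e he => Int.toNat_of_nonneg (hpos e (mem_filter.1 he).1)
  rw [h2, sum_add_distrib, h1]
  simp only [hd]; ring

end RPM

open Finset
namespace RPM
open scoped Classical

def nx : Fin 4 → Fin 4 := ![0, 2, 3, 1]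

lemma nx_ne (c : Fin 4) (hc : c ≠ 0) : nx c ≠ 0 ∧ nx (nx c) ≠ 0 ∧ nx c ≠ c ∧ nx (nx c) ≠ c ∧ nx (nx c) ≠ nx c := by
  revert hc; revert c; decide

lemma nx_cases (c : Fin 4) (hc : c ≠ 0) (d : Fin 4) : d = 0 ∨ d = c ∨ d = nx c ∨ d = nx (nx c) := by
  revert d; revert hc; revert c; decide

lemma nx3 (c : Fin 4) (hc : c ≠ 0) : nx (nx (nx c)) = c := by
  revert hc; revert c; decide

lemma sum4 (f : Fin 4 → ℝ) (c : Fin 4) (hc : c ≠ 0) : ∑ i, f i = f 0 + f c + f (nx c) + f (nx (nx c)) := by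
  rw [Fin.sum_univ_four]
  fin_cases c
  · exact absurd rfl hc
  · simp [nx]
  · simp [nx]; ring
  · simp [nx]; ring

/-- one-sided product bound -/
lemma num0 (m1 d1 m2 d2 : ℝ) (h1 : 2 / 3 ≤ m1) (hd1 : d1 ≤ 1 - m1) (h0 : 0 ≤ d1) (h2 : 0 ≤ d2) (hd2 : d2 ≤ m2) :
    m1 * m2 ≤ m1 * m2 + m1 * d2 + m2 * d1 - 3 * d1 * d2 := by
  nlinarith [mul_nonneg h2 (show 0 ≤ m1 - 2 * d1 by linarith), mul_nonneg h0 (sub_nonneg.2 hd2)]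

/-- `fq` : the number of forbidden pairs -/
def fq (a1 b1 a2 b2 : ℝ) : ℝ := a1 * b2 + b1 * a2 - a1 * a2

lemma fq_comm (a1 b1 a2 b2 : ℝ) : fq a1 b1 a2 b2 = fq a2 b2 a1 b1 := by unfold fq; ring

lemma num1 (a1 b1 a2 b2 ε : ℝ) (h1 : a1 ≤ b1) (h1' : b1 ≤ 1) (h2 : 0 ≤ a2) (h2' : a2 ≤ b2)
    (hf : fq a1 b1 a2 b2 ≤ 4 / 9 + ε) (hm : 2 / 3 ≤ (a1 + b1) / 2) :
    (a1 + b1) / 2 * ((a2 + b2) / 2) ≤ 4 / 9 + ε := by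
  refine le_trans (num0 ((a1 + b1) / 2) ((b1 - a1) / 2) ((a2 + b2) / 2) ((b2 - a2) / 2) hm (by linarith) (by linarith) (by linarith) (by linarith)) ?_
  refine le_trans (le_of_eq ?_) hf
  unfold fq; ring

lemma num2 (m m' m'' ε δ : ℝ) (hm : 2 / 3 ≤ m) (hm1 : m ≤ 1) (h1 : m * m' ≤ 4 / 9 + ε) (h2 : m * m'' ≤ 4 / 9 + ε) (hε : 0 ≤ ε) :
    m + m' + m'' ≤ 2 + 3 * ε ∧ (2 - δ ≤ m + m' + m'' → m ≤ 2 / 3 + 3 * (δ + 3 * ε)) ∧ m' ≤ 2 / 3 + 3 / 2 * ε := by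
  have hm0 : 0 < m := by linarith
  have e1 : m' ≤ (4 / 9 + ε) / m := by rw [le_div_iff₀ hm0]; linarith
  have e2 : m'' ≤ (4 / 9 + ε) / m := by rw [le_div_iff₀ hm0]; linarith
  have e3 : ε / m ≤ 3 / 2 * ε := by rw [div_le_iff₀ hm0]; nlinarith
  have e4 : m + 8 / 9 / m = 2 - (m - 2 / 3) * (4 / 3 - m) / m := by field_simp; ring
  have e5 : (4 / 9 + ε) / m = (8 / 9 / m) / 2 + ε / m := by field_simp; ring
  have e6 : (m - 2 / 3) * (1 / 3) ≤ (m - 2 / 3) * (4 / 3 - m) / m := by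
    rw [le_div_iff₀ hm0]
    have : (1 / 3 : ℝ) * m ≤ 4 / 3 - m := by nlinarith
    nlinarith [mul_le_mul_of_nonneg_left this (show 0 ≤ m - 2 / 3 by linarith)]
  refine ⟨by linarith, fun h => by linarith, ?_⟩
  by_contra hcon
  push Not at hcon
  nlinarith

structure AB (a b : ℝ) : Prop where
  a0 : 0 ≤ a
  ab : a ≤ b
  b1 : b ≤ 1

lemma num3 (a b : Fin 4 → ℝ) (hab : ∀ c, AB (a c) (b c)) (ε : ℝ) (hε : 0 ≤ ε)
    (hf : ∀ c, c ≠ 0 → fq (a c) (b c) (a (nx c)) (b (nx c)) ≤ 4 / 9 + ε) :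
    (∑ c ∈ univ.filter (fun c : Fin 4 => c ≠ 0), (a c + b c) / 2 ≤ 2 + 3 * ε) ∧
    ∀ δ, ε ≤ δ → 2 - δ ≤ ∑ c ∈ univ.filter (fun c : Fin 4 => c ≠ 0), (a c + b c) / 2 →
      ∀ c, c ≠ 0 → |(a c + b c) / 2 - 2 / 3| ≤ 16 * δ := by
  have hs : ∀ c, c ≠ 0 → ∑ c ∈ univ.filter (fun c : Fin 4 => c ≠ 0), (a c + b c) / 2 =
      (a c + b c) / 2 + (a (nx c) + b (nx c)) / 2 + (a (nx (nx c)) + b (nx (nx c))) / 2 := by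
    intro c hc
    have := sum4 (fun c => if c ≠ 0 then (a c + b c) / 2 else 0) c hc
    rw [sum_filter, this]
    simp [hc, nx_ne c hc]
  by_cases hcase : ∃ c, c ≠ 0 ∧ 2 / 3 ≤ (a c + b c) / 2
  · obtain ⟨c, hc, hm⟩ := hcase
    obtain ⟨h1, h2, h3, h4, h5⟩ := nx_ne c hc
    have n3 : nx (nx (nx c)) = c := nx3 c hc
    have A := hab c
    have A1 := hab (nx c)
    have A2 := hab (nx (nx c))
    have p1 := num1 _ _ _ _ ε A.ab A.b1 A1.a0 A1.ab (hf c hc) hm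
    have p2 := num1 _ _ _ _ ε A.ab A.b1 A2.a0 A2.ab (by
      have := hf (nx (nx c)) h2
      rw [n3, fq_comm] at this
      exact this) hm
    have A0 := A.b1
    have A0' := A.ab
    rw [hs c hc]
    refine ⟨(num2 _ _ _ ε 0 hm (by linarith) p1 p2 hε).1, fun δ hδ hS => ?_⟩
    have q1 := num2 _ _ _ ε δ hm (by linarith) p1 p2 hε
    have q2 := num2 _ _ _ ε δ hm (by linarith) p2 p1 hε
    have q3 := q1.2.1 hS
    have q4 := q1.2.2
    have q5 := q2.2.2
    intro d hd
    rcases nx_cases c hc d with h | h | h | h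
    · exact absurd h hd
    all_goals
      rw [h, abs_le]; constructor <;> linarith
  · push Not at hcase
    have r1 := hcase 1 (by decide)
    have r2 := hcase 2 (by decide)
    have r3 := hcase 3 (by decide)
    have e := hs 1 (by decide)
    have e2 : nx 1 = 2 := rfl
    have e3 : nx 2 = 3 := rfl
    rw [e2, e3] at e
    rw [e]
    refine ⟨by linarith, fun δ hδ hS => ?_⟩
    intro d hd
    have hd' : d = 1 ∨ d = 2 ∨ d = 3 := by
      have := nx_cases 1 (by decide) d
      rw [e2, e3] at this
      tauto
    rcases hd' with h | h | h <;>
    · rw [h, abs_le]; constructor <;> linarith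

lemma num4 (a1 b1 a2 b2 ε δ : ℝ) (hA : AB a1 b1) (hA2 : AB a2 b2) (h1 : |(a1 + b1) / 2 - 2 / 3| ≤ 16 * δ) (h2 : |(a2 + b2) / 2 - 2 / 3| ≤ 16 * δ)
    (hε : 0 ≤ ε) (hεδ : ε ≤ δ) (hδ : δ ≤ 1 / 10000) (hf : fq a1 b1 a2 b2 ≤ 4 / 9 + ε) :
    (b1 - a1) / 2 ≤ 100 * δ := by
  obtain ⟨x1, x2⟩ := abs_le.1 h1
  obtain ⟨y1, y2⟩ := abs_le.1 h2
  have := hA.a0; have := hA.ab; have := hA.b1; have := hA2.a0; have := hA2.ab; have := hA2.b1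
  set m1 := (a1 + b1) / 2 with hm1
  set m2 := (a2 + b2) / 2 with hm2
  set d1 := (b1 - a1) / 2 with hd1
  set d2 := (b2 - a2) / 2 with hd2
  have e : fq a1 b1 a2 b2 = m1 * m2 + m1 * d2 + m2 * d1 - 3 * d1 * d2 := by
    simp only [hm1, hm2, hd1, hd2]; unfold fq; ring
  rw [e] at hf
  have k1 : 0 ≤ d1 := by linarith
  have k2 : 0 ≤ d2 := by linarith
  have k3 : d1 ≤ 1 / 3 + 16 * δ := by linarith
  have k4 : d2 ≤ 1 / 3 + 16 * δ := by linarith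
  have hδ0 : 0 ≤ δ := hε.trans hεδ
  have s1 : (2 / 3 - 16 * δ) * (2 / 3 - 16 * δ) ≤ m1 * m2 :=
    mul_le_mul (by linarith) (by linarith) (by linarith) (by linarith)
  have s2 : (2 / 3 - 16 * δ) * d2 ≤ m1 * d2 := mul_le_mul_of_nonneg_right (by linarith) k2
  have s3 : (2 / 3 - 16 * δ) * d1 ≤ m2 * d1 := mul_le_mul_of_nonneg_right (by linarith) k1
  have s4 : δ * d1 ≤ δ * (1 / 2) := mul_le_mul_of_nonneg_left (by linarith) hδ0
  have s5 : δ * d2 ≤ δ * (1 / 2) := mul_le_mul_of_nonneg_left (by linarith) hδ0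
  have s6 : 2 / 3 * d1 + 2 / 3 * d2 - 3 * d1 * d2 ≤ 40 * δ := by
    nlinarith [sq_nonneg δ]
  by_cases hd : d1 ≤ 2 / 9
  · nlinarith [mul_nonneg k2 (show 0 ≤ 2 / 3 - 3 * d1 by linarith)]
  · push Not at hd
    exfalso
    have s7 : d2 * (3 * d1 - 2 / 3) ≤ (1 / 3 + 16 * δ) * (3 * d1 - 2 / 3) := mul_le_mul_of_nonneg_right k4 (by linarith)
    nlinarith

end RPM

open Finset
namespace RPM
open scoped Classical

/-- fraction of points with value below `x` -/
noncomputable def lo {k : ℕ} (g : Fin k → ℝ) (x : ℝ) : ℝ := ((univ.filter (fun p => g p < x)).card : ℝ) / k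

lemma lo_nonneg {k : ℕ} (g : Fin k → ℝ) (x : ℝ) : 0 ≤ lo g x := by unfold lo; positivity

lemma lo_le_one {k : ℕ} (g : Fin k → ℝ) (x : ℝ) : lo g x ≤ 1 := by
  unfold lo
  apply div_le_one_of_le₀ _ (by positivity)
  exact_mod_cast (card_le_univ _).trans (by simp)

lemma lo_mono {k : ℕ} (g : Fin k → ℝ) {x y : ℝ} (h : x ≤ y) : lo g x ≤ lo g y := by
  unfold lo
  apply div_le_div_of_nonneg_right _ (by positivity)
  have : univ.filter (fun p => g p < x) ⊆ univ.filter (fun p => g p < y) :=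
    fun p hp => mem_filter.2 ⟨mem_univ _, (mem_filter.1 hp).2.trans_le h⟩
  exact_mod_cast card_le_card this

lemma lo_ab {k : ℕ} (g : Fin k → ℝ) {x y : ℝ} (h : x ≤ y) : AB (lo g x) (lo g y) :=
  ⟨lo_nonneg _ _, lo_mono _ h, lo_le_one _ _⟩

lemma pair_count {k : ℕ} (hk : 0 < k) (g1 g2 : Fin k → ℝ) (ε θ : ℝ) (hθ : θ ≤ 1 - θ)
    (h : (5 / 9 - ε) * k ^ 2 ≤ ((univ.filter (fun q : Fin k × Fin k => 1 ≤ g1 q.1 + g2 q.2)).card : ℝ)) :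
    fq (lo g1 θ) (lo g1 (1 - θ)) (lo g2 θ) (lo g2 (1 - θ)) ≤ 4 / 9 + ε := by
  have hk' : (0 : ℝ) < k := by exact_mod_cast hk
  set A1 := univ.filter (fun p => g1 p < θ)
  set B1 := univ.filter (fun p => g1 p < 1 - θ)
  set A2 := univ.filter (fun p => g2 p < θ)
  set B2 := univ.filter (fun p => g2 p < 1 - θ)
  set S := univ.filter (fun q : Fin k × Fin k => 1 ≤ g1 q.1 + g2 q.2)
  have hA1 : A1 ⊆ B1 := fun p hp => mem_filter.2 ⟨mem_univ _, (mem_filter.1 hp).2.trans_le hθ⟩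
  have hA2 : A2 ⊆ B2 := fun p hp => mem_filter.2 ⟨mem_univ _, (mem_filter.1 hp).2.trans_le hθ⟩
  have hinter : (A1 ×ˢ B2) ∩ (B1 ×ˢ A2) = A1 ×ˢ A2 := by
    ext ⟨x, y⟩
    simp only [mem_inter, mem_product]
    constructor
    · rintro ⟨⟨h1, -⟩, -, h2⟩; exact ⟨h1, h2⟩
    · rintro ⟨h1, h2⟩; exact ⟨⟨h1, hA2 h2⟩, hA1 h1, h2⟩
  have hc := card_union_add_card_inter (A1 ×ˢ B2) (B1 ×ˢ A2)
  rw [hinter] at hc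
  simp only [card_product] at hc
  have hdisj : Disjoint S ((A1 ×ˢ B2) ∪ (B1 ×ˢ A2)) := by
    rw [disjoint_left]
    rintro ⟨x, y⟩ h1 h2
    have h1 := (mem_filter.1 h1).2
    simp only [mem_union, mem_product] at h2
    simp only at h1
    rcases h2 with ⟨h2, h3⟩ | ⟨h2, h3⟩
    · have := (mem_filter.1 h2).2; have := (mem_filter.1 h3).2; linarith
    · have := (mem_filter.1 h2).2; have := (mem_filter.1 h3).2; linarith
  have h2 : S.card + ((A1 ×ˢ B2) ∪ (B1 ×ˢ A2)).card ≤ k ^ 2 := by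
    rw [← card_union_of_disjoint hdisj]
    refine (card_le_univ _).trans ?_
    simp [sq]
  have hcR : ((((A1 ×ˢ B2) ∪ (B1 ×ˢ A2)).card : ℝ) + A1.card * A2.card = A1.card * B2.card + B1.card * A2.card) := by exact_mod_cast hc
  have h2R : (S.card : ℝ) + ((A1 ×ˢ B2) ∪ (B1 ×ˢ A2)).card ≤ k ^ 2 := by exact_mod_cast h2
  have e : fq (lo g1 θ) (lo g1 (1 - θ)) (lo g2 θ) (lo g2 (1 - θ)) =
      ((A1.card : ℝ) * B2.card + B1.card * A2.card - A1.card * A2.card) / k ^ 2 := by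
    unfold fq lo
    field_simp
    rfl
  rw [e, div_le_iff₀ (by positivity)]
  linarith

lemma mean_bound {k L : ℕ} (hk : 0 < k) (g : Fin k → ℝ) (hg : ∀ p, 0 ≤ g p) :
    ∑ j ∈ Icc 1 L, (1 - (lo g ((j : ℝ) / (2 * L + 1)) + lo g (1 - (j : ℝ) / (2 * L + 1))) / 2) ≤
      (L + 1 / 2) * ((∑ p, g p) / k) := by
  have hk' : (0 : ℝ) < k := by exact_mod_cast hk
  have hJ : (0 : ℝ) < 2 * L + 1 := by positivity
  have key : ∀ p, (∑ j ∈ Icc 1 L, (((if g p < (j : ℝ) / (2 * L + 1) then (0 : ℝ) else 1) + (if g p < 1 - (j : ℝ) / (2 * L + 1) then 0 else 1)))) ≤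
      (2 * L + 1) * g p := by
    intro p
    have e1 : ∑ j ∈ Icc 1 L, (if g p < 1 - (j : ℝ) / (2 * L + 1) then (0 : ℝ) else 1) =
        ∑ j ∈ Icc (L + 1) (2 * L), (if g p < (j : ℝ) / (2 * L + 1) then (0 : ℝ) else 1) := by
      refine sum_nbij' (fun j => 2 * L + 1 - j) (fun j => 2 * L + 1 - j) ?_ ?_ ?_ ?_ ?_
      · intro j hj; simp only [mem_Icc] at *; omega
      · intro j hj; simp only [mem_Icc] at *; omega
      · intro j hj; simp only [mem_Icc] at *; omega
      · intro j hj; simp only [mem_Icc] at *; omega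
      · intro j hj
        simp only [mem_Icc] at hj
        have : ((2 * L + 1 - j : ℕ) : ℝ) = 2 * L + 1 - j := by
          rw [Nat.cast_sub (by omega)]; push_cast; ring
        rw [this, sub_div, div_self hJ.ne']
    rw [sum_add_distrib, e1]
    have e2 : ∑ j ∈ Icc 1 L, (if g p < (j : ℝ) / (2 * L + 1) then (0 : ℝ) else 1) +
        ∑ j ∈ Icc (L + 1) (2 * L), (if g p < (j : ℝ) / (2 * L + 1) then (0 : ℝ) else 1) =
        ∑ j ∈ Icc 1 (2 * L), (if g p < (j : ℝ) / (2 * L + 1) then (0 : ℝ) else 1) := by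
      rw [← sum_union]
      · congr 1
        ext j; simp only [mem_union, mem_Icc]; omega
      · rw [disjoint_left]; intro j; simp only [mem_Icc]; omega
    rw [e2]
    have e3 : ∑ j ∈ Icc 1 (2 * L), (if g p < (j : ℝ) / (2 * L + 1) then (0 : ℝ) else 1) ≤
        ∑ j ∈ Icc 1 ⌊(2 * L + 1) * g p⌋₊, (1 : ℝ) := by
      have : ∑ j ∈ Icc 1 (2 * L), (if g p < (j : ℝ) / (2 * L + 1) then (0 : ℝ) else 1) =
          ∑ j ∈ (Icc 1 (2 * L)).filter (fun j : ℕ => ¬ g p < (j : ℝ) / (2 * L + 1)), (1 : ℝ) := by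
        rw [sum_filter]
        refine sum_congr rfl fun j _ => ?_
        split_ifs <;> rfl
      rw [this]
      refine sum_le_sum_of_subset_of_nonneg ?_ (fun _ _ _ => zero_le_one)
      intro j hj
      obtain ⟨h1, h2⟩ := mem_filter.1 hj
      rw [mem_Icc] at h1 ⊢
      refine ⟨h1.1, Nat.le_floor ?_⟩
      push Not at h2
      rw [div_le_iff₀ hJ] at h2
      linarith
    refine e3.trans ?_
    simp only [sum_const, Nat.card_Icc, Nat.add_sub_cancel, nsmul_eq_mul, mul_one]
    exact Nat.floor_le (mul_nonneg hJ.le (hg p))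
  have hlo : ∀ x, 1 - lo g x = (∑ p, (if g p < x then (0 : ℝ) else 1)) / k := by
    intro x
    unfold lo
    have : ∑ p, (if g p < x then (0 : ℝ) else 1) = ∑ p : Fin k, (1 - (if g p < x then (1 : ℝ) else 0)) :=
      sum_congr rfl fun p _ => by split_ifs <;> norm_num
    rw [this, sum_sub_distrib, sum_boole]
    simp only [sum_const, card_univ, Fintype.card_fin, nsmul_eq_mul, mul_one]
    field_simp
  have h1 : ∑ j ∈ Icc 1 L, (1 - (lo g ((j : ℝ) / (2 * L + 1)) + lo g (1 - (j : ℝ) / (2 * L + 1))) / 2) =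
      (∑ p, ∑ j ∈ Icc 1 L, (((if g p < (j : ℝ) / (2 * L + 1) then (0 : ℝ) else 1) + (if g p < 1 - (j : ℝ) / (2 * L + 1) then 0 else 1)))) / (2 * k) := by
    rw [sum_comm, sum_div]
    refine sum_congr rfl fun j _ => ?_
    rw [sum_add_distrib]
    have a1 := hlo ((j : ℝ) / (2 * L + 1))
    have a2 := hlo (1 - (j : ℝ) / (2 * L + 1))
    have : (1 - (lo g ((j : ℝ) / (2 * L + 1)) + lo g (1 - (j : ℝ) / (2 * L + 1))) / 2) =
      ((1 - lo g ((j : ℝ) / (2 * L + 1))) + (1 - lo g (1 - (j : ℝ) / (2 * L + 1)))) / 2 := by ring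
    rw [this, a1, a2, ← add_div, div_div, mul_comm (k : ℝ) 2]
  rw [h1, div_le_iff₀ (by positivity)]
  calc _ ≤ ∑ p, (2 * (L : ℝ) + 1) * g p := sum_le_sum fun p _ => key p
    _ = _ := by rw [← mul_sum]; field_simp

/-- averaging -/
lemma choose_j (q : ℕ) (M : ℕ → ℝ) (δ ε ε1 β : ℝ) (hq : 1 ≤ q * δ) (hδ : δ ≤ 1) (hε : 0 ≤ ε) (hε' : ε ≤ δ / 100) (hε1 : 0 ≤ ε1) (hε1' : ε1 ≤ δ / 100)
    (hM : ∀ j ∈ Icc 1 (6 * q), M j ≤ 2 + 3 * ε)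
    (hB : ∑ j ∈ Icc 1 (6 * q), (3 - M j) ≤ (((6 * q : ℕ) : ℝ) + 1 / 2) * β) (hβ : β ≤ 1 + ε1) :
    (∃ j ∈ Icc 1 q, 2 - δ ≤ M j) ∧ 1 - δ / 6 ≤ β := by
  push_cast at hB
  have hδ0 : 0 ≤ δ := by linarith
  have hq0 : (0 : ℝ) ≤ q := by positivity
  constructor
  · by_contra hcon
    push Not at hcon
    have h1 : ∑ j ∈ Icc 1 (6 * q), (3 - M j) = ∑ j ∈ Icc 1 q, (3 - M j) + ∑ j ∈ Icc (q + 1) (6 * q), (3 - M j) := by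
      rw [← sum_union]
      · congr 1
        ext j; simp only [mem_union, mem_Icc]; omega
      · rw [disjoint_left]; intro j; simp only [mem_Icc]; omega
    have h2 : ∑ j ∈ Icc 1 q, (1 + δ) ≤ ∑ j ∈ Icc 1 q, (3 - M j) := sum_le_sum fun j hj => by
      linarith [hcon j hj]
    have h3 : ∑ j ∈ Icc (q + 1) (6 * q), (1 - 3 * ε) ≤ ∑ j ∈ Icc (q + 1) (6 * q), (3 - M j) := sum_le_sum fun j hj => by
      have := hM j (by rw [mem_Icc] at *; omega)
      linarith
    have e : 6 * q + 1 - (q + 1) = 5 * q := by omega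
    simp only [sum_const, Nat.card_Icc, nsmul_eq_mul, e, Nat.add_sub_cancel] at h2 h3
    push_cast at h3
    have h4 : (6 * q + 1 / 2 : ℝ) * β ≤ (6 * q + 1 / 2) * (1 + ε1) := mul_le_mul_of_nonneg_left hβ (by positivity)
    have h5 : q * ε ≤ q * (δ / 100) := mul_le_mul_of_nonneg_left hε' hq0
    have h6 : q * ε1 ≤ q * (δ / 100) := mul_le_mul_of_nonneg_left hε1' hq0
    nlinarith
  · have h3 : ∑ j ∈ Icc 1 (6 * q), (1 - 3 * ε) ≤ ∑ j ∈ Icc 1 (6 * q), (3 - M j) := sum_le_sum fun j hj => by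
      have := hM j hj
      linarith
    simp only [sum_const, Nat.card_Icc, nsmul_eq_mul, Nat.add_sub_cancel] at h3
    push_cast at h3
    by_contra hcon
    push Not at hcon
    have h4 : (6 * q + 1 / 2 : ℝ) * β ≤ (6 * q + 1 / 2) * (1 - δ / 6) := mul_le_mul_of_nonneg_left hcon.le (by positivity)
    have h5 : q * ε ≤ q * (δ / 100) := mul_le_mul_of_nonneg_left hε' hq0
    nlinarith

end RPM

open Finset
namespace RPM
open scoped Classical

/-- the tuple with `v` in class `c` and `w` in class `nx c` -/
def lk {k : ℕ} (b : Fin 4 → Fin k) (c : Fin 4) (v w : Fin k) : Fin 4 → Fin k :=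
  Function.update (Function.update b c v) (nx c) w

lemma lk_vals {k : ℕ} (b : Fin 4 → Fin k) (c : Fin 4) (hc : c ≠ 0) (v w : Fin k) :
    lk b c v w 0 = b 0 ∧ lk b c v w c = v ∧ lk b c v w (nx c) = w ∧ lk b c v w (nx (nx c)) = b (nx (nx c)) := by
  obtain ⟨h1, h2, h3, h4, h5⟩ := nx_ne c hc
  unfold lk
  simp [h1.symm, hc.symm, h3.symm, h4, h5]

/-- extremality of a pattern -/
def FText (η : ℝ) {k : ℕ} (P : Finset (Fin 4 → Fin k)) : Prop :=
  ∃ (b : Fin 4 → Fin k) (W : Fin 4 → Finset (Fin k)),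
    (∀ c, c ≠ 0 → |((W c).card : ℝ) - k / 3| ≤ η * k) ∧
    ((P.filter (fun e => ∀ c, c ≠ 0 → e c ∉ W c)).card : ℝ) ≤ η * k ^ 4 ∧
    (∀ c, c ≠ 0 → ∀ v, v ∉ W c → ((univ.filter (fun w => lk b c v w ∈ P)).card : ℝ) ≤ 1 / 2 * k) ∧
    (∀ c, c ≠ 0 → (((W c).filter (fun v => ((univ.filter (fun w => lk b c v w ∈ P)).card : ℝ) < 9 / 10 * k)).card : ℝ) ≤ η * k)

structure NF (k : ℕ) (P : Finset (Fin 4 → Fin k)) (g : Fin 4 → Fin k → ℝ) (b : Fin 4 → Fin k) (ε ε1 : ℝ) : Prop where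
  hg : ∀ c, c ≠ 0 → ∀ p, 0 ≤ g c p
  hb : ∀ c, g c (b c) = 0
  g0 : ∀ p, (∀ c, c ≠ 0 → p ≠ b c) → 0 ≤ g 0 p
  hP : ∀ e ∈ P, 1 < ∑ c, g c (e c)
  hB : ∑ p ∈ univ.filter (fun p => ∀ c, c ≠ 0 → p ≠ b c), g 0 p +
    ∑ c ∈ univ.filter (fun c : Fin 4 => c ≠ 0), ∑ p, g c p ≤ (1 + ε1) * k
  deg : ∀ c, c ≠ 0 → (5 / 9 - ε) * k ^ 2 ≤ ((P.filter (fun e => e 0 = b 0 ∧ e c = b c)).card : ℝ)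

variable {k : ℕ} {P : Finset (Fin 4 → Fin k)} {g : Fin 4 → Fin k → ℝ} {b : Fin 4 → Fin k} {ε ε1 : ℝ}

lemma NF.link (H : NF k P g b ε ε1) (c : Fin 4) (hc : c ≠ 0) :
    (5 / 9 - ε) * k ^ 2 ≤ ((univ.filter (fun q : Fin k × Fin k => lk b c q.1 q.2 ∈ P)).card : ℝ) := by
  obtain ⟨h1, h2, h3, h4, h5⟩ := nx_ne c hc
  refine (H.deg (nx (nx c)) h2).trans ?_
  norm_cast
  have hlk : ∀ e ∈ P.filter (fun e => e 0 = b 0 ∧ e (nx (nx c)) = b (nx (nx c))), lk b c (e c) (e (nx c)) = e := by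
    intro e he
    obtain ⟨-, q1, q2⟩ := mem_filter.1 he
    obtain ⟨l1, l2, l3, l4⟩ := lk_vals b c hc (e c) (e (nx c))
    funext d
    rcases nx_cases c hc d with h | h | h | h <;> rw [h]
    · rw [l1, q1]
    · exact l2
    · exact l3
    · rw [l4, q2]
  refine card_le_card_of_injOn (fun e => (e c, e (nx c))) ?_ ?_
  · intro e he
    refine mem_coe.2 (mem_filter.2 ⟨mem_univ _, ?_⟩)
    simp only
    rw [hlk e he]
    exact (mem_filter.1 he).1
  · intro e he e' he' h
    simp only [Prod.mk.injEq] at h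
    rw [← hlk e he, ← hlk e' he', h.1, h.2]

lemma NF.lk_sum (H : NF k P g b ε ε1) (c : Fin 4) (hc : c ≠ 0) (v w : Fin k) (h : lk b c v w ∈ P) :
    1 < g c v + g (nx c) w := by
  have := H.hP _ h
  rw [sum4 _ c hc] at this
  obtain ⟨l1, l2, l3, l4⟩ := lk_vals b c hc v w
  rw [l1, l2, l3, l4, H.hb, H.hb] at this
  linarith

lemma NF.fq (H : NF k P g b ε ε1) (hk : 0 < k) (c : Fin 4) (hc : c ≠ 0) (θ : ℝ) (hθ : θ ≤ 1 - θ) :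
    RPM.fq (lo (g c) θ) (lo (g c) (1 - θ)) (lo (g (nx c)) θ) (lo (g (nx c)) (1 - θ)) ≤ 4 / 9 + ε := by
  refine pair_count hk _ _ ε θ hθ ((H.link c hc).trans ?_)
  norm_cast
  refine card_le_card fun q hq => mem_filter.2 ⟨mem_univ _, ?_⟩
  exact (H.lk_sum c hc _ _ (mem_filter.1 hq).2).le

lemma card_in (c : Fin 4) (S : Finset (Fin k)) :
    ((univ : Finset (Fin 4 → Fin k)).filter (fun e => e c ∈ S)).card ≤ k ^ 3 * S.card := by
  refine card_le_mul_card_image_of_maps_to (f := fun e => e c) ?_ _ ?_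
  · intro e he
    exact (mem_filter.1 he).2
  · intro v hv
    refine le_trans (card_le_card ?_) (card_fix1 c v).le
    intro e he
    exact mem_filter.2 ⟨mem_univ _, (mem_filter.1 he).2⟩

/-- everything needed about the chosen threshold -/
lemma NF.thr (H : NF k P g b ε ε1) (hk : 0 < k) (δ : ℝ) (q : ℕ) (hq : 1 ≤ q * δ) (hδ : δ ≤ 1 / 10000)
    (hε : 0 ≤ ε) (hε' : ε ≤ δ / 100) (hε1 : 0 ≤ ε1) (hε1' : ε1 ≤ δ / 100) :
    ∃ θ, 0 ≤ θ ∧ θ ≤ 1 / 12 ∧ (∀ c, c ≠ 0 → |lo (g c) θ - 2 / 3| ≤ 116 * δ ∧ |lo (g c) (1 - θ) - 2 / 3| ≤ 116 * δ) ∧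
      ∑ p ∈ univ.filter (fun p => ∀ c, c ≠ 0 → p ≠ b c), g 0 p ≤ δ / 4 * k := by
  have hk' : (0 : ℝ) < k := by exact_mod_cast hk
  have hq0 : (0 : ℝ) ≤ q := by positivity
  set L : ℕ := 6 * q with hL
  set th : ℕ → ℝ := fun j => (j : ℝ) / (2 * (L : ℕ) + 1) with hth
  have hth2 : ∀ j ∈ Icc 1 L, th j ≤ 1 - th j := by
    intro j hj
    have : (j : ℝ) ≤ L := by exact_mod_cast (mem_Icc.1 hj).2
    have : th j ≤ 1 / 2 := by
      simp only [hth]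
      rw [div_le_iff₀ (by positivity)]; linarith
    linarith
  set M : ℕ → ℝ := fun j => ∑ c ∈ univ.filter (fun c : Fin 4 => c ≠ 0), (lo (g c) (th j) + lo (g c) (1 - th j)) / 2 with hM
  set β : ℝ := (∑ c ∈ univ.filter (fun c : Fin 4 => c ≠ 0), ∑ p, g c p) / k with hβ
  have hX0 : 0 ≤ ∑ p ∈ univ.filter (fun p => ∀ c, c ≠ 0 → p ≠ b c), g 0 p :=
    sum_nonneg fun p hp => H.g0 p (mem_filter.1 hp).2
  have hβ1 : β ≤ 1 + ε1 := by
    rw [hβ, div_le_iff₀ hk']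
    linarith [H.hB]
  have hcard3 : (univ.filter (fun c : Fin 4 => c ≠ 0)).card = 3 := by decide
  have n3 : ∀ j ∈ Icc 1 L, _ := fun j hj => num3 (fun c => lo (g c) (th j)) (fun c => lo (g c) (1 - th j))
    (fun c => lo_ab _ (hth2 j hj)) ε hε (fun c hc => H.fq hk c hc _ (hth2 j hj))
  have hB : ∑ j ∈ Icc 1 L, (3 - M j) ≤ (((L : ℕ) : ℝ) + 1 / 2) * β := by
    have e : ∀ j, 3 - M j = ∑ c ∈ univ.filter (fun c : Fin 4 => c ≠ 0), (1 - (lo (g c) (th j) + lo (g c) (1 - th j)) / 2) := by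
      intro j
      rw [sum_sub_distrib]
      simp only [sum_const, hcard3, hM]
      norm_num
    simp only [e]
    rw [sum_comm, hβ, sum_div, mul_sum]
    refine sum_le_sum fun c hc => ?_
    exact mean_bound hk (g c) (H.hg c (mem_filter.1 hc).2)
  obtain ⟨⟨j, hj, hj2⟩, hb2⟩ := choose_j q M δ ε ε1 β hq (by linarith) hε hε' hε1 hε1' (fun j hj => (n3 j hj).1) hB hβ1
  have hjL : j ∈ Icc 1 L := by rw [mem_Icc] at *; omega
  have hδ0 : 0 ≤ δ := by linarith
  refine ⟨th j, by simp only [hth]; positivity, ?_, ?_, ?_⟩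
  · simp only [hth]
    rw [div_le_iff₀ (by positivity)]
    have : (j : ℝ) ≤ q := by exact_mod_cast (mem_Icc.1 hj).2
    simp only [hL]; push_cast; linarith
  · intro c hc
    have m1 := (n3 j hjL).2 δ (by linarith) hj2
    have m2 := m1 c hc
    have m3 := m1 (nx c) (nx_ne c hc).1
    have d1 := num4 _ _ _ _ ε δ (lo_ab (g c) (hth2 j hjL)) (lo_ab (g (nx c)) (hth2 j hjL)) m2 m3 hε (by linarith) hδ
      (H.fq hk c hc _ (hth2 j hjL))
    have d0 := lo_mono (g c) (hth2 j hjL)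
    rw [abs_le] at m2
    constructor <;> rw [abs_le] <;> constructor <;> linarith [m2.1, m2.2]
  · have : (1 - δ / 6) * k ≤ ∑ c ∈ univ.filter (fun c : Fin 4 => c ≠ 0), ∑ p, g c p := by
      rw [hβ, le_div_iff₀ hk'] at hb2; exact hb2
    have h3 := H.hB
    have h4 : ε1 * k ≤ δ / 100 * k := mul_le_mul_of_nonneg_right hε1' hk'.le
    have h5 : 0 ≤ δ * k := by positivity
    linarith

lemma lo_card (g : Fin k → ℝ) (hk : 0 < k) (x : ℝ) : ((univ.filter (fun p => g p < x)).card : ℝ) = lo g x * k := by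
  have hk' : (0 : ℝ) < k := by exact_mod_cast hk
  unfold lo; field_simp

lemma lo_card' (g : Fin k → ℝ) (hk : 0 < k) (x : ℝ) : ((univ.filter (fun p => ¬ g p < x)).card : ℝ) = (1 - lo g x) * k := by
  have h1 := lo_card g hk x
  have h2 : (univ.filter (fun p => g p < x)).card + (univ.filter (fun p => ¬ g p < x)).card = k := by
    rw [card_filter_add_card_filter_not]; simp
  have h3 : ((univ.filter (fun p => g p < x)).card : ℝ) + (univ.filter (fun p => ¬ g p < x)).card = k := by exact_mod_cast h2
  linarith

lemma NF.ext (H : NF k P g b ε ε1) (η δ : ℝ) (q : ℕ) (hδη : δ = η / 10000) (hη : 0 < η) (hη1 : η ≤ 1) (hk : 3 ≤ δ * k)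
    (hq : 1 ≤ q * δ)
    (hε : 0 ≤ ε) (hε' : ε ≤ δ / 100) (hε1 : 0 ≤ ε1) (hε1' : ε1 ≤ δ / 100) : FText η P := by
  have hδ : δ ≤ 1 / 10000 := by linarith
  have hδ0 : 0 < δ := by linarith
  have hk0 : 0 < k := by
    rcases Nat.eq_zero_or_pos k with h | h
    · rw [h] at hk; norm_num at hk
    · exact h
  have hk' : (0 : ℝ) < k := by exact_mod_cast hk0
  obtain ⟨θ, hθ0, hθ1, hlo, hX⟩ := H.thr hk0 δ q hq hδ hε hε' hε1 hε1'
  set W : Fin 4 → Finset (Fin k) := fun c => univ.filter (fun p => ¬ g c p < 1 - θ) with hW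
  have hWc : ∀ c, c ≠ 0 → |((W c).card : ℝ) - k / 3| ≤ 116 * δ * k := by
    intro c hc
    rw [hW, lo_card' (g c) hk0]
    have e : (1 - lo (g c) (1 - θ)) * (k : ℝ) - k / 3 = -(lo (g c) (1 - θ) - 2 / 3) * k := by ring
    rw [e, abs_mul, abs_neg, abs_of_pos hk']
    exact mul_le_mul_of_nonneg_right (hlo c hc).2 hk'.le
  have hlow : ∀ c, c ≠ 0 → ∀ v, v ∉ W c → ((univ.filter (fun w => lk b c v w ∈ P)).card : ℝ) ≤ (1 / 3 + 116 * δ) * k := by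
    intro c hc v hv
    have hv' : g c v < 1 - θ := by
      by_contra h; exact hv (mem_filter.2 ⟨mem_univ _, h⟩)
    have h1 : (univ.filter (fun w => lk b c v w ∈ P)) ⊆ univ.filter (fun p => ¬ g (nx c) p < θ) := by
      intro w hw
      refine mem_filter.2 ⟨mem_univ _, ?_⟩
      have := H.lk_sum c hc v w (mem_filter.1 hw).2
      linarith
    have h2 : ((univ.filter (fun w => lk b c v w ∈ P)).card : ℝ) ≤ (univ.filter (fun p => ¬ g (nx c) p < θ)).card := by
      exact_mod_cast card_le_card h1
    rw [lo_card' _ hk0] at h2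
    refine h2.trans (mul_le_mul_of_nonneg_right ?_ hk'.le)
    have := (abs_le.1 (hlo (nx c) (nx_ne c hc).1).1).1
    linarith
  refine ⟨b, W, fun c hc => (hWc c hc).trans (mul_le_mul_of_nonneg_right (by linarith) hk'.le), ?_, ?_, ?_⟩
  · -- avoiding edges
    set Mid : Fin 4 → Finset (Fin k) := fun c => (univ.filter (fun p => g c p < 1 - θ)).filter (fun p => ¬ g c p < θ) with hMid
    set Hi : Finset (Fin k) := univ.filter (fun p => 3 / 4 ≤ g 0 p) with hHi
    have hMidc : ∀ c, c ≠ 0 → ((Mid c).card : ℝ) ≤ 232 * δ * k := by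
      intro c hc
      have h1 : ((univ.filter (fun p => g c p < 1 - θ)).filter (fun p => g c p < θ)).card + (Mid c).card = (univ.filter (fun p => g c p < 1 - θ)).card :=
        card_filter_add_card_filter_not _
      have h2 : (univ.filter (fun p => g c p < 1 - θ)).filter (fun p => g c p < θ) = univ.filter (fun p => g c p < θ) := by
        ext p
        simp only [mem_filter, mem_univ, true_and]
        constructor
        · exact fun h => h.2
        · exact fun h => ⟨by linarith, h⟩
      rw [h2] at h1
      have h3 : ((univ.filter (fun p => g c p < θ)).card : ℝ) + (Mid c).card = (univ.filter (fun p => g c p < 1 - θ)).card := by exact_mod_cast h1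
      rw [lo_card _ hk0, lo_card _ hk0] at h3
      have h4 := (abs_le.1 (hlo c hc).1).1
      have h5 := (abs_le.1 (hlo c hc).2).2
      have h6 : (lo (g c) (1 - θ) - lo (g c) θ) * k ≤ 232 * δ * k := mul_le_mul_of_nonneg_right (by linarith) hk'.le
      linarith
    have hHic : (Hi.card : ℝ) ≤ 2 * δ * k := by
      set X := univ.filter (fun p => ∀ c, c ≠ 0 → p ≠ b c) with hXd
      have h1 : Hi ⊆ Hi.filter (fun p => ∀ c, c ≠ 0 → p ≠ b c) ∪ (univ.erase 0).image b := by
        intro p hp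
        by_cases h : ∀ c, c ≠ 0 → p ≠ b c
        · exact mem_union_left _ (mem_filter.2 ⟨hp, h⟩)
        · push Not at h
          obtain ⟨c, hc, h⟩ := h
          exact mem_union_right _ (mem_image.2 ⟨c, mem_erase.2 ⟨hc, mem_univ _⟩, h.symm⟩)
      have h2 : ((univ.erase (0 : Fin 4)).image b).card ≤ 3 := card_image_le.trans (by decide)
      have h3 : 3 / 4 * ((Hi.filter (fun p => ∀ c, c ≠ 0 → p ≠ b c)).card : ℝ) ≤ ∑ p ∈ X, g 0 p := by
        have : ∑ p ∈ Hi.filter (fun p => ∀ c, c ≠ 0 → p ≠ b c), (3 / 4 : ℝ) ≤ ∑ p ∈ X, g 0 p := by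
          refine (sum_le_sum fun p hp => (mem_filter.1 (mem_filter.1 hp).1).2).trans ?_
          refine sum_le_sum_of_subset_of_nonneg ?_ ?_
          · intro p hp
            exact mem_filter.2 ⟨mem_univ _, (mem_filter.1 hp).2⟩
          · intro p hp _
            exact H.g0 p (mem_filter.1 hp).2
        rw [sum_const, nsmul_eq_mul] at this
        linarith
      have h4 : (Hi.card : ℝ) ≤ (Hi.filter (fun p => ∀ c, c ≠ 0 → p ≠ b c)).card + 3 := by
        have := (card_le_card h1).trans ((card_union_le _ _).trans (Nat.add_le_add_left h2 _))
        exact_mod_cast this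
      linarith
    have hsub : P.filter (fun e => ∀ c, c ≠ 0 → e c ∉ W c) ⊆
        univ.filter (fun e : Fin 4 → Fin k => e 0 ∈ Hi) ∪ (univ.erase (0 : Fin 4)).biUnion (fun c => univ.filter (fun e : Fin 4 → Fin k => e c ∈ Mid c)) := by
      intro e he
      obtain ⟨heP, heW⟩ := mem_filter.1 he
      have hlt : ∀ c, c ≠ 0 → g c (e c) < 1 - θ := by
        intro c hc
        by_contra h; exact heW c hc (mem_filter.2 ⟨mem_univ _, h⟩)
      by_cases h : ∃ c, c ≠ 0 ∧ ¬ g c (e c) < θ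
      · obtain ⟨c, hc, h⟩ := h
        refine mem_union_right _ (mem_biUnion.2 ⟨c, mem_erase.2 ⟨hc, mem_univ _⟩, mem_filter.2 ⟨mem_univ _, ?_⟩⟩)
        exact mem_filter.2 ⟨mem_filter.2 ⟨mem_univ _, hlt c hc⟩, h⟩
      · push Not at h
        refine mem_union_left _ (mem_filter.2 ⟨mem_univ _, mem_filter.2 ⟨mem_univ _, ?_⟩⟩)
        have h1 := H.hP e heP
        rw [Fin.sum_univ_four] at h1
        have := h 1 (by decide); have := h 2 (by decide); have := h 3 (by decide)
        linarith
    have hcard := (card_le_card hsub).trans ((card_union_le _ _).trans (Nat.add_le_add_left card_biUnion_le _))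
    have hR : ((P.filter (fun e => ∀ c, c ≠ 0 → e c ∉ W c)).card : ℝ) ≤ ((univ.filter (fun e : Fin 4 → Fin k => e 0 ∈ Hi)).card : ℝ) +
        ∑ c ∈ univ.erase (0 : Fin 4), ((univ.filter (fun e : Fin 4 → Fin k => e c ∈ Mid c)).card : ℝ) := by exact_mod_cast hcard
    have r1 : ((univ.filter (fun e : Fin 4 → Fin k => e 0 ∈ Hi)).card : ℝ) ≤ k ^ 3 * (2 * δ * k) := by
      have : ((univ.filter (fun e : Fin 4 → Fin k => e 0 ∈ Hi)).card : ℝ) ≤ k ^ 3 * Hi.card := by exact_mod_cast card_in 0 Hi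
      exact this.trans (mul_le_mul_of_nonneg_left hHic (by positivity))
    have r2 : ∑ c ∈ univ.erase (0 : Fin 4), ((univ.filter (fun e : Fin 4 → Fin k => e c ∈ Mid c)).card : ℝ) ≤
        ∑ c ∈ univ.erase (0 : Fin 4), k ^ 3 * (232 * δ * k) := by
      refine sum_le_sum fun c hc => ?_
      have : ((univ.filter (fun e : Fin 4 → Fin k => e c ∈ Mid c)).card : ℝ) ≤ k ^ 3 * (Mid c).card := by exact_mod_cast card_in c (Mid c)
      exact this.trans (mul_le_mul_of_nonneg_left (hMidc c (mem_erase.1 hc).1) (by positivity))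
    have hc3 : (univ.erase (0 : Fin 4)).card = 3 := by decide
    rw [sum_const, hc3, nsmul_eq_mul] at r2
    push_cast at r2
    have r3 : 0 ≤ η * k ^ 4 := by positivity
    have r4 : (k : ℝ) ^ 3 * (2 * δ * k) + 3 * (k ^ 3 * (232 * δ * k)) = 698 / 10000 * (η * k ^ 4) := by rw [hδη]; ring
    linarith
  · intro c hc v hv
    refine (hlow c hc v hv).trans (mul_le_mul_of_nonneg_right (by linarith) hk'.le)
  · intro c hc
    set D : Fin k → ℝ := fun v => ((univ.filter (fun w => lk b c v w ∈ P)).card : ℝ) with hD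
    set R := (W c).filter (fun v => D v < 9 / 10 * k) with hR
    have h1 : (5 / 9 - ε) * k ^ 2 ≤ ∑ v, D v := by
      refine (H.link c hc).trans (le_of_eq ?_)
      simp only [hD, card_filter]
      push_cast
      rw [Fintype.sum_prod_type]
    have hDk : ∀ v, D v ≤ k := by
      intro v
      simp only [hD]
      exact_mod_cast (card_le_univ _).trans (by simp)
    have h2 : ∑ v, D v = ∑ v ∈ (W c)ᶜ, D v + (∑ v ∈ R, D v + ∑ v ∈ (W c).filter (fun v => ¬ D v < 9 / 10 * k), D v) := by
      rw [hR, sum_filter_add_sum_filter_not, add_comm, sum_add_sum_compl]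
    have h3 : ∑ v ∈ (W c)ᶜ, D v ≤ ((W c)ᶜ.card : ℝ) * ((1 / 3 + 116 * δ) * k) := by
      rw [← nsmul_eq_mul]
      exact sum_le_card_nsmul _ _ _ fun v hv => hlow c hc v (mem_compl.1 hv)
    have h4 : ∑ v ∈ R, D v ≤ (R.card : ℝ) * (9 / 10 * k) := by
      rw [← nsmul_eq_mul]
      exact sum_le_card_nsmul _ _ _ fun v hv => (mem_filter.1 hv).2.le
    have h5 : ∑ v ∈ (W c).filter (fun v => ¬ D v < 9 / 10 * k), D v ≤ (((W c).filter (fun v => ¬ D v < 9 / 10 * k)).card : ℝ) * k := by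
      rw [← nsmul_eq_mul]
      exact sum_le_card_nsmul _ _ _ fun v hv => hDk v
    have h6 : (R.card : ℝ) + ((W c).filter (fun v => ¬ D v < 9 / 10 * k)).card = (W c).card := by
      have : R.card + ((W c).filter (fun v => ¬ D v < 9 / 10 * k)).card = (W c).card := card_filter_add_card_filter_not _
      exact_mod_cast this
    have h7 : (((W c)ᶜ.card : ℝ)) = k - (W c).card := by
      have : (W c)ᶜ.card + (W c).card = k := by rw [card_compl_add_card]; simp
      have : (((W c)ᶜ.card : ℝ)) + (W c).card = k := by exact_mod_cast this
      linarith
    obtain ⟨w1, w2⟩ := abs_le.1 (hWc c hc)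
    set Wc : ℝ := ((W c).card : ℝ)
    set Rc : ℝ := (R.card : ℝ)
    rw [h7] at h3
    have h8 : (k - Wc) * ((1 / 3 + 116 * δ) * k) ≤ ((2 / 3 + 116 * δ) * k) * ((1 / 3 + 116 * δ) * k) :=
      mul_le_mul_of_nonneg_right (by linarith) (by positivity)
    have h9 : Wc * k ≤ (1 / 3 + 116 * δ) * k * k := mul_le_mul_of_nonneg_right (by linarith) hk'.le
    have h10 : (((W c).filter (fun v => ¬ D v < 9 / 10 * k)).card : ℝ) * k = Wc * k - Rc * k := by
      rw [← h6]; ring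
    have h11 : Rc * k ≤ (η * k) * k := by
      have h12 : δ ^ 2 * k ^ 2 ≤ δ / 10000 * k ^ 2 := mul_le_mul_of_nonneg_right (by nlinarith) (by positivity)
      have h13 : ε * k ^ 2 ≤ δ / 100 * k ^ 2 := mul_le_mul_of_nonneg_right hε' (by positivity)
      have h14 : 0 ≤ δ * k ^ 2 := by positivity
      have h15 : η * k * k = 10000 * (δ * k ^ 2) := by rw [hδη]; ring
      nlinarith
    exact le_of_mul_le_mul_right h11 hk'

end RPM

open Finset
namespace RPM
open scoped Classical

variable {k : ℕ} {P : Finset (Fin 4 → Fin k)}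

def DegP (ε : ℝ) {k : ℕ} (P : Finset (Fin 4 → Fin k)) : Prop :=
  ∀ c, c ≠ 0 → ∀ i a, i ≠ a → (5 / 9 - ε) * k ^ 2 ≤ ((P.filter (fun e => e 0 = i ∧ e c = a)).card : ℝ)

lemma card_fix3 (c : Fin 4) (hc : c ≠ 0) (hc1 : c ≠ 1) (i a : Fin k) (S : Finset (Fin k)) :
    ((univ : Finset (Fin 4 → Fin k)).filter (fun e => e 0 = i ∧ e 1 = a ∧ e c ∈ S)).card ≤ k * S.card := by
  refine card_le_mul_card_image_of_maps_to (f := fun e => e c) ?_ _ ?_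
  · intro e he
    exact (mem_filter.1 he).2.2.2
  · intro v hv
    have h := card_fix (n := k) {0, 1, c} (fun d => if d = 0 then i else if d = 1 then a else v)
    have h3 : ({0, 1, c} : Finset (Fin 4)).card = 3 := by
      rw [card_insert_of_notMem, card_pair hc1.symm]
      simp [hc.symm]
    rw [h3] at h
    refine le_trans (card_le_card ?_) (h.le.trans (by simp))
    intro e he
    obtain ⟨h1, h2⟩ := mem_filter.1 he
    obtain ⟨-, h4, h5, -⟩ := mem_filter.1 h1
    refine mem_filter.2 ⟨mem_univ _, ?_⟩
    intro d hd
    simp only [mem_insert, mem_singleton] at hd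
    rcases hd with h | h | h
    · subst h; simpa using h4
    · subst h; simpa using h5
    · subst h; simpa [hc, hc1] using h2

lemma markov_edge (ε : ℝ) (hε : ε ≤ 1 / 100) (hk : 100 ≤ k) (hP : DegP ε P) (g : Fin 4 → Fin k → ℝ)
    (hg : ∀ c, c ≠ 0 → ∀ p, 0 ≤ g c p) (i : Fin k) :
    ∃ e ∈ P, e 0 = i ∧ ∀ c, c ≠ 0 → g c (e c) ≤ 8 * ((∑ p, g c p) / k) := by
  have hk' : (100 : ℝ) ≤ k := by exact_mod_cast hk
  set Bad : Fin 4 → Finset (Fin k) := fun c => univ.filter (fun p => 8 * ((∑ p, g c p) / k) < g c p) with hBad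
  have hBadc : ∀ c, c ≠ 0 → ((Bad c).card : ℝ) ≤ k / 8 := by
    intro c hc
    by_cases h0 : ∑ p, g c p = 0
    · have h1 := (sum_eq_zero_iff_of_nonneg (fun p _ => hg c hc p)).1 h0
      have : Bad c = ∅ := by
        apply filter_eq_empty_iff.2
        intro p _
        rw [h0, h1 p (mem_univ _)]; simp
      rw [this, card_empty]; push_cast; linarith
    · have hpos : 0 < ∑ p, g c p := lt_of_le_of_ne (sum_nonneg fun p _ => hg c hc p) (Ne.symm h0)
      have h1 : ((Bad c).card : ℝ) * (8 * ((∑ p, g c p) / k)) ≤ ∑ p, g c p := by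
        rw [← nsmul_eq_mul]
        refine (card_nsmul_le_sum _ _ _ fun p hp => (mem_filter.1 hp).2.le).trans ?_
        exact sum_le_sum_of_subset_of_nonneg (subset_univ _) fun p _ _ => hg c hc p
      have h2 : ((Bad c).card : ℝ) * (8 * ((∑ p, g c p) / k)) = (8 * (Bad c).card / k) * ∑ p, g c p := by ring
      rw [h2] at h1
      have h3 : 8 * ((Bad c).card : ℝ) / k ≤ 1 := by
        by_contra h; push Not at h
        nlinarith
      rw [div_le_one (by linarith)] at h3
      linarith
  have ha : ∃ a, a ∉ insert i (Bad 1) := by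
    by_contra hcon
    push Not at hcon
    have h1 : (univ : Finset (Fin k)).card ≤ (insert i (Bad 1)).card := card_le_card fun p _ => hcon p
    have h2 := h1.trans (card_insert_le _ _)
    rw [card_univ, Fintype.card_fin] at h2
    have h3 : (k : ℝ) ≤ (Bad 1).card + 1 := by exact_mod_cast h2
    linarith [hBadc 1 (by decide)]
  obtain ⟨a, ha⟩ := ha
  simp only [mem_insert, not_or] at ha
  have hd := hP 1 (by decide) i a (Ne.symm ha.1)
  by_contra hcon
  push Not at hcon
  have hsub : P.filter (fun e => e 0 = i ∧ e 1 = a) ⊆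
      (univ.filter (fun e : Fin 4 → Fin k => e 0 = i ∧ e 1 = a ∧ e 2 ∈ Bad 2)) ∪ (univ.filter (fun e : Fin 4 → Fin k => e 0 = i ∧ e 1 = a ∧ e 3 ∈ Bad 3)) := by
    intro e he
    obtain ⟨h1, h2, h3⟩ := mem_filter.1 he
    obtain ⟨c, hc, h4⟩ := hcon e h1 h2
    have h5 : e c ∈ Bad c := mem_filter.2 ⟨mem_univ _, h4⟩
    have hc' : c = 1 ∨ c = 2 ∨ c = 3 := by revert hc; clear * -; revert c; decide
    rcases hc' with h | h | h <;> subst h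
    · rw [h3] at h5; exact absurd h5 ha.2
    · exact mem_union_left _ (mem_filter.2 ⟨mem_univ _, h2, h3, h5⟩)
    · exact mem_union_right _ (mem_filter.2 ⟨mem_univ _, h2, h3, h5⟩)
  have h1 := (card_le_card hsub).trans ((card_union_le _ _).trans (Nat.add_le_add (card_fix3 2 (by decide) (by decide) i a _) (card_fix3 3 (by decide) (by decide) i a _)))
  have h2 : ((P.filter (fun e => e 0 = i ∧ e 1 = a)).card : ℝ) ≤ k * (Bad 2).card + k * (Bad 3).card := by exact_mod_cast h1
  have h3 := hBadc 2 (by decide)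
  have h4 := hBadc 3 (by decide)
  nlinarith

lemma ft_nf (ε ε1 : ℝ) (hε0 : 0 ≤ ε) (hε1 : ε1 ≤ 1 / 100) (hk : 100 ≤ k) (hεk : ε + 48 / k ≤ ε1 / 4) (hP : DegP ε P)
    (t : Fin 4 → Fin k → ℝ) (ht : ∀ c p, |k * t c p - 1| ≤ ε) (ht1 : ∀ c, ∑ p, t c p = 1)
    (h : Fin 4 → Fin k → ℝ) (hh : ∀ e ∈ P, ∑ c, ∑ p, t c p * h c p < ∑ c, h c (e c)) :
    ∃ g b, NF k P g b ε ε1 := by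
  have hk' : (100 : ℝ) ≤ k := by exact_mod_cast hk
  have hk0 : (0 : ℝ) < k := by linarith
  have h48 : (0 : ℝ) ≤ 48 / k := by positivity
  have : Nonempty (Fin k) := ⟨⟨0, by omega⟩⟩
  have hx : ∀ c, ∃ x, ∀ p, h c x ≤ h c p := fun c => Finite.exists_min (h c)
  choose x hx using hx
  have hne : (univ.filter (fun p : Fin k => ∀ c, c ≠ 0 → p ≠ x c)).Nonempty := by
    by_contra hcon
    rw [not_nonempty_iff_eq_empty, filter_eq_empty_iff] at hcon
    have : (univ : Finset (Fin k)) ⊆ univ.image x := by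
      intro p hp
      have := hcon hp
      push Not at this
      obtain ⟨c, _, h⟩ := this
      exact mem_image.2 ⟨c, mem_univ _, h.symm⟩
    have := (card_le_card this).trans card_image_le
    simp at this
    omega
  obtain ⟨i0, hi0, hi0m⟩ := exists_min_image _ (h 0) hne
  set b : Fin 4 → Fin k := Function.update x 0 i0 with hb
  have hb0 : b 0 = i0 := by simp [hb]
  have hbc : ∀ c, c ≠ 0 → b c = x c := fun c hc => by simp [hb, hc]
  set X := univ.filter (fun p : Fin k => ∀ c, c ≠ 0 → p ≠ b c) with hX
  have hXx : X = univ.filter (fun p : Fin k => ∀ c, c ≠ 0 → p ≠ x c) := by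
    ext p
    simp only [hX, mem_filter, mem_univ, true_and]
    exact forall_congr' fun c => forall_congr' fun hc => by rw [hbc c hc]
  set γ : Fin 4 → Fin k → ℝ := fun c p => h c p - h c (b c) with hγ
  have hγ0 : ∀ c, c ≠ 0 → ∀ p, 0 ≤ γ c p := by
    intro c hc p
    simp only [hγ, hbc c hc]
    linarith [hx c p]
  have hγX : ∀ p ∈ X, 0 ≤ γ 0 p := by
    intro p hp
    rw [hXx] at hp
    simp only [hγ, hb0]
    linarith [hi0m p hp]
  set τ := ∑ c, ∑ p, t c p * γ c p with hτ
  have hτe : ∀ e ∈ P, τ < ∑ c, γ c (e c) := by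
    intro e he
    have h1 : τ = ∑ c, ∑ p, t c p * h c p - ∑ c, h c (b c) := by
      rw [hτ, ← sum_sub_distrib]
      refine sum_congr rfl fun c _ => ?_
      simp only [hγ, mul_sub, sum_sub_distrib, ← sum_mul, ht1, one_mul]
    have h2 : ∑ c, γ c (e c) = ∑ c, h c (e c) - ∑ c, h c (b c) := by
      simp only [hγ, sum_sub_distrib]
    rw [h1, h2]
    linarith [hh e he]
  set F3 := univ.filter (fun c : Fin 4 => c ≠ 0) with hF3
  set B := (∑ c ∈ F3, ∑ p, γ c p) / k with hB
  have hspl : ∀ f : Fin 4 → ℝ, ∑ c, f c = f 0 + ∑ c ∈ F3, f c := by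
    intro f
    rw [← sum_filter_add_sum_filter_not univ (fun c : Fin 4 => c = 0)]
    congr 1
    simp [filter_eq']
  have hB0 : 0 ≤ B := div_nonneg (sum_nonneg fun c hc => sum_nonneg fun p _ => hγ0 c (mem_filter.1 hc).2 p) hk0.le
  have hmk : ∀ p, τ - 8 * B < γ 0 p := by
    intro p
    obtain ⟨e, he, h1, h2⟩ := markov_edge ε (by linarith) hk hP γ hγ0 p
    have h3 := hτe e he
    rw [hspl, h1] at h3
    have h4 : ∑ c ∈ F3, γ c (e c) ≤ ∑ c ∈ F3, 8 * ((∑ p, γ c p) / k) := sum_le_sum fun c hc => h2 c (mem_filter.1 hc).2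
    rw [← mul_sum, ← sum_div] at h4
    linarith
  have hτB : τ < 8 * B := by
    have := hmk i0
    simp only [hγ, hb0, sub_self] at this
    linarith
  have htl : ∀ c p, (1 - ε) / k ≤ t c p ∧ t c p ≤ 2 / k := by
    intro c p
    have := abs_le.1 (ht c p)
    constructor
    · rw [div_le_iff₀ hk0]; linarith [this.1]
    · rw [le_div_iff₀ hk0]; linarith [this.2]
  set S0 := ∑ p ∈ X, γ 0 p with hS0
  have hS00 : 0 ≤ S0 := sum_nonneg hγX
  have hXc : (((univ.filter (fun p => p ∉ X)).card : ℝ)) ≤ 3 := by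
    have h1 : univ.filter (fun p => p ∉ X) ⊆ (univ.erase (0 : Fin 4)).image b := by
      intro p hp
      have := (mem_filter.1 hp).2
      simp only [hX, mem_filter, mem_univ, true_and] at this
      push Not at this
      obtain ⟨c, hc, h⟩ := this
      exact mem_image.2 ⟨c, mem_erase.2 ⟨hc, mem_univ _⟩, h.symm⟩
    exact_mod_cast (card_le_card h1).trans (card_image_le.trans (by decide))
  have p1 : (1 - ε) * B ≤ ∑ c ∈ F3, ∑ p, t c p * γ c p := by
    have : (1 - ε) * B = ∑ c ∈ F3, ∑ p, (1 - ε) / k * γ c p := by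
      simp only [← mul_sum]
      rw [hB]; ring
    rw [this]
    exact sum_le_sum fun c hc => sum_le_sum fun p _ =>
      mul_le_mul_of_nonneg_right (htl c p).1 (hγ0 c (mem_filter.1 hc).2 p)
  have p2 : (1 - ε) / k * S0 ≤ ∑ p ∈ X, t 0 p * γ 0 p := by
    rw [hS0, mul_sum]
    exact sum_le_sum fun p hp => mul_le_mul_of_nonneg_right (htl 0 p).1 (hγX p hp)
  have p3 : - (6 / k * (8 * B - τ)) ≤ ∑ p ∈ univ.filter (fun p => p ∉ X), t 0 p * γ 0 p := by
    have h1 : ∑ p ∈ univ.filter (fun p => p ∉ X), - (2 / k * (8 * B - τ)) ≤ ∑ p ∈ univ.filter (fun p => p ∉ X), t 0 p * γ 0 p := by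
      refine sum_le_sum fun p _ => ?_
      have h2 := hmk p
      have h3 := htl 0 p
      have h4 : 0 ≤ t 0 p := le_trans (div_nonneg (by linarith) hk0.le) h3.1
      have h5 : t 0 p * (τ - 8 * B) ≤ t 0 p * γ 0 p := mul_le_mul_of_nonneg_left h2.le h4
      have h6 : t 0 p * (8 * B - τ) ≤ 2 / k * (8 * B - τ) := mul_le_mul_of_nonneg_right h3.2 (by linarith)
      linarith
    refine le_trans ?_ h1
    rw [sum_const, nsmul_eq_mul]
    have h7 : 0 ≤ 2 / k * (8 * B - τ) := mul_nonneg (by positivity) (by linarith)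
    have h8 : 6 / k * (8 * B - τ) = 3 * (2 / k * (8 * B - τ)) := by ring
    nlinarith
  have hτsum : τ = ∑ p ∈ X, t 0 p * γ 0 p + ∑ p ∈ univ.filter (fun p => p ∉ X), t 0 p * γ 0 p + ∑ c ∈ F3, ∑ p, t c p * γ c p := by
    rw [hτ, hspl (fun c => ∑ p, t c p * γ c p)]
    congr 1
    rw [← sum_filter_add_sum_filter_not univ (fun p => p ∈ X)]
    congr 2
    simp
  have hmain : (1 - ε - 48 / k) * (B + S0 / k) ≤ τ * (1 - 6 / k) := by
    have h1 : (1 - ε) / k * S0 = (1 - ε) * (S0 / k) := by ring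
    have h2 : 0 ≤ 48 / k * (S0 / k) := mul_nonneg h48 (div_nonneg hS00 hk0.le)
    have h3 : 6 / k * (8 * B - τ) = 48 / k * B - 6 / k * τ := by ring
    nlinarith
  have hSk : 0 ≤ S0 / k := div_nonneg hS00 hk0.le
  have h6k : 0 ≤ 6 / (k : ℝ) ∧ 6 / (k : ℝ) ≤ 6 / 100 := ⟨by positivity, by
    rw [div_le_div_iff_of_pos_left (by norm_num) hk0 (by norm_num)]; exact hk'⟩
  have hτ0 : 0 < τ := by
    have h1 : 0 ≤ (1 - ε - 48 / k) * (B + S0 / k) := mul_nonneg (by linarith) (by linarith)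
    have h2 : 0 ≤ τ := by
      by_contra hcon; push Not at hcon
      nlinarith [h6k.1, h6k.2]
    have h3 : 0 < B := by linarith
    have h4 : 0 < (1 - ε - 48 / k) * (B + S0 / k) := mul_pos (by linarith) (by linarith)
    rcases h2.eq_or_lt with h | h
    · rw [← h] at hmain; linarith
    · exact h
  have hfin : B + S0 / k ≤ (1 + ε1) * τ := by
    have hε10 : 0 ≤ ε1 := by linarith
    have h1 : (1 - ε1 / 4) * (B + S0 / k) ≤ τ := by
      have a1 : (1 - ε1 / 4) * (B + S0 / k) ≤ (1 - ε - 48 / k) * (B + S0 / k) := mul_le_mul_of_nonneg_right (by linarith) (by linarith)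
      nlinarith [mul_nonneg hτ0.le h6k.1]
    have h2 : (1 + ε1) * ((1 - ε1 / 4) * (B + S0 / k)) ≤ (1 + ε1) * τ := mul_le_mul_of_nonneg_left h1 (by linarith)
    have h3 : 1 ≤ (1 + ε1) * (1 - ε1 / 4) := by nlinarith
    nlinarith [mul_le_mul_of_nonneg_right h3 (show 0 ≤ B + S0 / k by linarith)]
  refine ⟨fun c p => γ c p / τ, b, ?_, ?_, ?_, ?_, ?_, ?_⟩
  · exact fun c hc p => div_nonneg (hγ0 c hc p) hτ0.le
  · intro c; simp [hγ]
  · intro p hp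
    exact div_nonneg (hγX p (mem_filter.2 ⟨mem_univ _, hp⟩)) hτ0.le
  · intro e he
    rw [← sum_div, one_lt_div hτ0]
    exact hτe e he
  · simp only [← sum_div]
    rw [← add_div, div_le_iff₀ hτ0]
    have e1 : ∑ c ∈ F3, ∑ p, γ c p = B * k := by rw [hB]; field_simp
    have e2 : S0 = S0 / k * k := by field_simp
    change S0 + ∑ c ∈ F3, ∑ p, γ c p ≤ _
    rw [e1, e2]
    have := mul_le_mul_of_nonneg_right hfin hk0.le
    linarith
  · intro c hc
    refine hP c hc _ _ ?_
    rw [hb0, hbc c hc]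
    exact (mem_filter.1 hi0).2 c hc

end RPM

open Finset
namespace RPM
open scoped Classical

variable {k : ℕ} {P : Finset (Fin 4 → Fin k)}

def chiR {k : ℕ} (e : Fin 4 → Fin k) : Fin 4 → Fin k → ℝ := fun c p => if e c = p then 1 else 0

lemma chiR_inj : Function.Injective (chiR (k := k)) := by
  intro e e' h
  funext c
  have := congrFun (congrFun h c) (e' c)
  simp only [chiR, if_true] at this
  by_contra hcon
  rw [if_neg hcon] at this
  norm_num at this

lemma sep (t : Fin 4 → Fin k → ℝ)
    (ht : ¬ ∃ w : (Fin 4 → Fin k) → ℝ, (∀ e ∈ P, 0 ≤ w e) ∧ ∀ c p, ∑ e ∈ P.filter (fun e => e c = p), w e = t c p) :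
    ∃ h : Fin 4 → Fin k → ℝ, ∀ e ∈ P, ∑ c, ∑ p, t c p * h c p < ∑ c, h c (e c) := by
  set S : Finset (Fin 4 → Fin k → ℝ) := P.image chiR with hS
  have hnot : t ∉ convexHull ℝ (S : Set (Fin 4 → Fin k → ℝ)) := by
    intro hcon
    rw [Finset.mem_convexHull'] at hcon
    obtain ⟨w, h1, h2, h3⟩ := hcon
    apply ht
    refine ⟨fun e => w (chiR e), fun e he => h1 _ (mem_image_of_mem _ he), fun c p => ?_⟩
    rw [← h3, hS, sum_image (fun a _ b _ h => chiR_inj h)]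
    simp only [Finset.sum_apply, Pi.smul_apply, smul_eq_mul, chiR, mul_ite, mul_one, mul_zero]
    rw [sum_filter]
  obtain ⟨f, u, h1, h2⟩ := geometric_hahn_banach_point_closed (convex_convexHull ℝ _)
    (S.finite_toSet.isCompact_convexHull ℝ).isClosed hnot
  set h : Fin 4 → Fin k → ℝ := fun c p => f (Pi.single c (Pi.single p 1)) with hh
  have hf : ∀ x : Fin 4 → Fin k → ℝ, f x = ∑ c, ∑ p, x c p * h c p := by
    intro x
    have : x = ∑ c, ∑ p, x c p • (Pi.single c (Pi.single p 1) : Fin 4 → Fin k → ℝ) := by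
      funext c p
      simp only [Finset.sum_apply, Pi.smul_apply, smul_eq_mul]
      rw [sum_eq_single c, sum_eq_single p]
      · simp
      · intro q _ hq
        simp [Pi.single_apply, hq.symm]
      · simp
      · intro c' _ hc
        refine sum_eq_zero fun q _ => ?_
        rw [Pi.single_eq_of_ne hc.symm]; simp
      · simp
    conv_lhs => rw [this]
    simp only [map_sum, map_smul, smul_eq_mul, hh]
  refine ⟨h, fun e he => ?_⟩
  have h3 := h2 (chiR e) (subset_convexHull ℝ _ (mem_coe.2 (mem_image_of_mem _ he)))
  rw [hf] at h1 h3
  have h4 : ∑ c, ∑ p, chiR e c p * h c p = ∑ c, h c (e c) := by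
    refine sum_congr rfl fun c _ => ?_
    simp [chiR]
  linarith

theorem FT (η : ℝ) (hη : 0 < η) (hη1 : η ≤ 1) : ∃ ε, 0 < ε ∧ ε ≤ 1 / 100 ∧ ∃ k0 : ℕ, ∀ k, k0 ≤ k →
    ∀ P : Finset (Fin 4 → Fin k), DegP ε P → FText η P ∨
      ∀ t : Fin 4 → Fin k → ℝ, (∀ c p, |k * t c p - 1| ≤ ε) → (∀ c, ∑ p, t c p = 1) →
      ∃ w : (Fin 4 → Fin k) → ℝ, (∀ e ∈ P, 0 ≤ w e) ∧ ∀ c p, ∑ e ∈ P.filter (fun e => e c = p), w e = t c p := by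
  set δ := η / 10000 with hδ
  have hδ0 : 0 < δ := by positivity
  obtain ⟨q, hq⟩ := exists_nat_ge (1 / δ)
  rw [div_le_iff₀ hδ0] at hq
  obtain ⟨k1, hk1⟩ := exists_nat_ge (48 / (δ / 1000))
  obtain ⟨k2, hk2⟩ := exists_nat_ge (3 / δ)
  refine ⟨δ / 1000, by positivity, by linarith, max 100 (max k1 k2), fun k hk P hP => ?_⟩
  have hk' : (0 : ℝ) < k := by exact_mod_cast (by omega : 0 < k)
  have e1 : (48 / k : ℝ) ≤ δ / 1000 := by
    have : (k1 : ℝ) ≤ k := by exact_mod_cast (by omega : k1 ≤ k)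
    have h := hk1.trans this
    rw [div_le_iff₀ (by positivity)] at h
    rw [div_le_iff₀ hk']; linarith
  have e2 : 3 ≤ δ * k := by
    have : (k2 : ℝ) ≤ k := by exact_mod_cast (by omega : k2 ≤ k)
    have h := hk2.trans this
    rw [div_le_iff₀ (by positivity)] at h
    linarith
  by_cases hF : FText η P
  · exact Or.inl hF
  refine Or.inr fun t ht ht1 => ?_
  by_contra hcon
  obtain ⟨h, hh⟩ := sep t hcon
  obtain ⟨g, b, H⟩ := ft_nf (δ / 1000) (δ / 100) (by positivity) (by linarith) (by omega) (by linarith) hP t ht ht1 h hh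
  exact hF (H.ext η δ q hδ hη hη1 e2 hq (by positivity) (by linarith) (by positivity) le_rfl)

/-- strictly positive perfect fractional matching -/
theorem FT2 (η : ℝ) (hη : 0 < η) (hη1 : η ≤ 1) : ∃ ε, 0 < ε ∧ ε ≤ 1 / 100 ∧ ∃ k0 : ℕ, ∀ k, k0 ≤ k →
    ∀ P : Finset (Fin 4 → Fin k), DegP ε P → FText η P ∨
      ∃ w : (Fin 4 → Fin k) → ℝ, (∀ e ∈ P, 0 < w e) ∧ ∀ c p, ∑ e ∈ P.filter (fun e => e c = p), w e = 1 := by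
  obtain ⟨ε, hε, hε1, k0, h⟩ := FT η hη hη1
  refine ⟨ε, hε, hε1, max 1 k0, fun k hk P hP => ?_⟩
  rcases h k (by omega) P hP with h | h
  · exact Or.inl h
  refine Or.inr ?_
  have hk' : (0 : ℝ) < k := by exact_mod_cast (by omega : 0 < k)
  have hk1 : (1 : ℝ) ≤ k := by exact_mod_cast (by omega : 1 ≤ k)
  set m : ℝ := (P.card : ℝ) with hm
  have hm0 : 0 ≤ m := by positivity
  set θ : ℝ := ε / (4 * k * (m + 1)) with hθ
  have hθ0 : 0 < θ := by positivity
  have hθm : k * (θ * m) ≤ ε / 4 := by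
    have : k * (θ * m) = ε / 4 * (m / (m + 1)) := by rw [hθ]; field_simp
    rw [this]
    have : m / (m + 1) ≤ 1 := div_le_one_of_le₀ (by linarith) (by linarith)
    nlinarith
  have hθm' : θ * m ≤ ε / 4 := by
    have : 0 ≤ θ * m := by positivity
    nlinarith
  set D : Fin 4 → Fin k → ℝ := fun c p => ((P.filter (fun e => e c = p)).card : ℝ) with hD
  have hDm : ∀ c p, 0 ≤ D c p ∧ D c p ≤ m := by
    intro c p
    refine ⟨by positivity, ?_⟩
    simp only [hD, hm]
    exact_mod_cast card_le_card (filter_subset _ _)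
  have hDs : ∀ c, ∑ p, D c p = m := by
    intro c
    simp only [hD, hm]
    have := card_eq_sum_card_fiberwise (s := P) (t := univ) (f := fun e => e c) (fun _ _ => mem_coe.2 (mem_univ _))
    rw [this]; push_cast; rfl
  have h1m : 0 < 1 - θ * m := by linarith
  obtain ⟨w, hw0, hw⟩ := h (fun c p => (1 / k - θ * D c p) / (1 - θ * m)) (by
      intro c p
      have e : (k : ℝ) * ((1 / k - θ * D c p) / (1 - θ * m)) - 1 = (θ * m - k * (θ * D c p)) / (1 - θ * m) := by
        field_simp; ring
      rw [e, abs_div, abs_of_pos h1m, div_le_iff₀ h1m]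
      have h1 : k * (θ * D c p) ≤ ε / 4 := by
        refine le_trans ?_ hθm
        exact mul_le_mul_of_nonneg_left (mul_le_mul_of_nonneg_left (hDm c p).2 hθ0.le) hk'.le
      have h2 : 0 ≤ k * (θ * D c p) := mul_nonneg hk'.le (mul_nonneg hθ0.le (hDm c p).1)
      have h3 : 0 ≤ θ * m := by positivity
      rw [abs_le]
      constructor <;> nlinarith) (by
      intro c
      rw [← sum_div, sum_sub_distrib, ← mul_sum, hDs]
      simp only [sum_const, card_univ, Fintype.card_fin, nsmul_eq_mul]
      rw [mul_one_div_cancel hk'.ne', div_self h1m.ne'])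
  refine ⟨fun e => k * ((1 - θ * m) * w e + θ), fun e he => ?_, fun c p => ?_⟩
  · have := mul_nonneg h1m.le (hw0 e he)
    positivity
  · rw [← mul_sum, sum_add_distrib, ← mul_sum, hw, sum_const, nsmul_eq_mul]
    change k * ((1 - θ * m) * ((1 / k - θ * D c p) / (1 - θ * m)) + D c p * θ) = 1
    field_simp
    ring

/-- the lattice condition from the degrees -/
lemma degP_lat (ε : ℝ) (hε : ε ≤ 1 / 100) (hk : 3 ≤ k) (hP : DegP ε P) : LatH P ∧ P.Nonempty := by
  have hk' : (3 : ℝ) ≤ k := by exact_mod_cast hk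
  have h3 : ∀ p q : Fin k, ∃ a, a ≠ p ∧ a ≠ q := by
    intro p q
    by_contra hcon
    push Not at hcon
    have : (univ : Finset (Fin k)) ⊆ {p, q} := by
      intro a _
      simp only [mem_insert, mem_singleton]
      by_cases h : a = p
      · exact Or.inl h
      · exact Or.inr (hcon a h)
    have := (card_le_card this).trans card_le_two
    simp at this
    omega
  -- general: two big sets of pairs intersect
  have key : ∀ (c d : Fin 4), c ≠ d → ∀ (p q a : Fin k),
      (5 / 9 - ε) * k ^ 2 ≤ ((P.filter (fun e => e c = p ∧ e d = a)).card : ℝ) →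
      (5 / 9 - ε) * k ^ 2 ≤ ((P.filter (fun e => e c = q ∧ e d = a)).card : ℝ) →
      ∃ e ∈ P, ∃ e' ∈ P, (∀ c', c' ≠ c → e c' = e' c') ∧ e c = p ∧ e' c = q := by
    intro c d hcd p q a h1 h2
    set S1 := P.filter (fun e => e c = p ∧ e d = a)
    set S2 := (P.filter (fun e => e c = q ∧ e d = a)).image (fun e => Function.update e c p)
    have hS2 : S2.card = (P.filter (fun e => e c = q ∧ e d = a)).card := by
      apply card_image_of_injOn
      intro e he e' he' h
      funext x
      by_cases hx : x = c
      · rw [hx, (mem_filter.1 he).2.1, (mem_filter.1 he').2.1]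
      · have := congrFun h x
        simpa [hx] using this
    set S := (univ : Finset (Fin 4 → Fin k)).filter (fun e => e c = p ∧ e d = a)
    have hSc : S.card = k ^ 2 := card_fix2 c d hcd p a
    have hs1 : S1 ⊆ S := fun e he => mem_filter.2 ⟨mem_univ _, (mem_filter.1 he).2⟩
    have hs2 : S2 ⊆ S := by
      intro e he
      obtain ⟨e', he', rfl⟩ := mem_image.1 he
      refine mem_filter.2 ⟨mem_univ _, by simp, ?_⟩
      rw [Function.update_of_ne hcd.symm]
      exact (mem_filter.1 he').2.2
    have hne : (S1 ∩ S2).Nonempty := by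
      by_contra hcon
      rw [not_nonempty_iff_eq_empty, ← disjoint_iff_inter_eq_empty] at hcon
      have h4 := card_le_card (union_subset hs1 hs2)
      rw [card_union_of_disjoint hcon, hS2, hSc] at h4
      have h5 : (S1.card : ℝ) + (P.filter (fun e => e c = q ∧ e d = a)).card ≤ k ^ 2 := by exact_mod_cast h4
      nlinarith
    obtain ⟨e, he⟩ := hne
    obtain ⟨he1, he2⟩ := mem_inter.1 he
    obtain ⟨e', he', h6⟩ := mem_image.1 he2
    refine ⟨e, (mem_filter.1 he1).1, e', (mem_filter.1 he').1, ?_, (mem_filter.1 he1).2.1, (mem_filter.1 he').2.1⟩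
    intro c' hc'
    rw [← h6, Function.update_of_ne hc']
  constructor
  · intro c p q hpq
    obtain ⟨a, ha1, ha2⟩ := h3 p q
    by_cases hc : c = 0
    · subst hc
      exact key 0 1 (by decide) p q a (hP 1 (by decide) p a ha1.symm) (hP 1 (by decide) q a ha2.symm)
    · have e : ∀ v, P.filter (fun e => e c = v ∧ e 0 = a) = P.filter (fun e => e 0 = a ∧ e c = v) := fun v =>
        filter_congr fun e _ => and_comm
      exact key c 0 hc p q a (by rw [e]; exact hP c hc a p ha1) (by rw [e]; exact hP c hc a q ha2)
  · obtain ⟨a, ha, _⟩ := h3 ⟨0, by omega⟩ ⟨0, by omega⟩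
    have h := hP 1 (by decide) ⟨0, by omega⟩ a ha.symm
    have : 0 < (P.filter (fun e => e 0 = ⟨0, by omega⟩ ∧ e 1 = a)).card := by
      have h1 : (0 : ℝ) < (5 / 9 - ε) * k ^ 2 := mul_pos (by linarith) (by positivity)
      exact_mod_cast h1.trans_le h
    obtain ⟨e, he⟩ := card_pos.1 this
    exact ⟨e, (mem_filter.1 he).1⟩

end RPM

open Finset
namespace RPM
open scoped Classical

lemma hasPM_of_bij {n : ℕ} {E : Finset (Fin 4 → Fin n)} {J : Type*} [Fintype J] (V : J → Fin 4 → Fin n)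
    (hE : ∀ j, V j ∈ E) (hb : ∀ c, Function.Bijective (fun j => V j c)) : HasPM E := by
  have hinj : Function.Injective V := fun i j h => (hb 0).1 (congrFun h 0)
  refine ⟨univ.image V, ?_, ?_, ?_⟩
  · intro e he
    obtain ⟨j, -, rfl⟩ := mem_image.1 he
    exact hE j
  · intro e he e' he' hne c hc
    obtain ⟨j, -, rfl⟩ := mem_image.1 he
    obtain ⟨j', -, rfl⟩ := mem_image.1 he'
    exact hne (congrArg V ((hb c).1 hc))
  · rw [card_image_of_injective _ hinj, card_univ, Fintype.card_of_bijective (hb 0), Fintype.card_fin]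

lemma assign {ι κ β : Type*} [Fintype ι] [Inhabited β] (π : ι → κ) (B : κ → Finset β)
    (hd : ∀ o o' x, x ∈ B o → x ∈ B o' → o = o')
    (hc : ∀ o, (univ.filter (fun i => π i = o)).card = (B o).card) :
    ∃ v : ι → β, Function.Injective v ∧ (∀ i, v i ∈ B (π i)) ∧ ∀ o, ∀ x ∈ B o, ∃ i, v i = x := by
  have h1 : ∀ o, ∃ f : ι → β, (∀ i, π i = o → f i ∈ B o) ∧ (∀ i j, π i = o → π j = o → f i = f j → i = j) ∧
      ∀ x ∈ B o, ∃ i, π i = o ∧ f i = x := by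
    intro o
    have e := Finset.equivOfCardEq (hc o)
    have hm : ∀ i, π i = o → i ∈ univ.filter (fun i => π i = o) := fun i hi => by simp [hi]
    refine ⟨fun i => if h : π i = o then (e ⟨i, hm i h⟩).1 else default, ?_, ?_, ?_⟩
    · intro i hi
      simp only [hi, dif_pos]
      exact (e _).2
    · intro i j hi hj h
      simp only [hi, hj, dif_pos] at h
      have := e.injective (Subtype.ext h)
      exact congrArg Subtype.val this
    · intro x hx
      refine ⟨(e.symm ⟨x, hx⟩).1, (mem_filter.1 (e.symm ⟨x, hx⟩).2).2, ?_⟩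
      show (if h : π (e.symm ⟨x, hx⟩).1 = o then (e ⟨(e.symm ⟨x, hx⟩).1, hm _ h⟩).1 else default) = x
      rw [dif_pos (mem_filter.1 (e.symm ⟨x, hx⟩).2).2]
      simp
  choose f hf1 hf2 hf3 using h1
  refine ⟨fun i => f (π i) i, ?_, fun i => hf1 _ i rfl, ?_⟩
  · intro i j h
    have h1 := hf1 _ i rfl
    have h2 := hf1 _ j rfl
    have h' : f (π i) i = f (π j) j := h
    have h3 : π i = π j := hd _ _ _ h1 (h' ▸ h2)
    rw [← h3] at h'
    exact hf2 _ i j rfl h3.symm h'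
  · intro o x hx
    obtain ⟨i, h1, h2⟩ := hf3 o x hx
    exact ⟨i, by simpa [h1] using h2⟩

lemma fibre_count {k : ℕ} (P : Finset (Fin 4 → Fin k)) (z : (Fin 4 → Fin k) → ℕ) (T : Fin 4 → Fin 4 → Fin k)
    (c : Fin 4) (p : Fin k) :
    (univ.filter (fun i : (Σ e : P, Fin (z e.1)) ⊕ Fin 4 =>
      (Sum.elim (fun q => some (q.1.1 c)) (fun c' => if c' = c then none else some (T c' c)) i : Option (Fin k)) = some p)).card
      = ∑ e ∈ P.filter (fun e => e c = p), z e + (univ.filter (fun c' => c' ≠ c ∧ T c' c = p)).card := by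
  rw [card_filter, Fintype.sum_sum_type, Fintype.sum_sigma, card_filter]
  congr 1
  · simp only [Sum.elim_inl, Option.some.injEq, sum_const, card_univ, Fintype.card_fin, smul_eq_mul]
    rw [sum_filter, ← sum_coe_sort P]
    refine sum_congr rfl fun e _ => ?_
    split_ifs <;> simp
  · refine sum_congr rfl fun c' _ => ?_
    by_cases h : c' = c <;> simp [h]

theorem blowup {n k N : ℕ} {E : Finset (Fin 4 → Fin n)} (t0 : Fin n)
    (hdiag : ∀ j, j ≠ t0 → (fun _ => j) ∈ E)
    (P : Finset (Fin 4 → Fin k)) (T : Fin 4 → Fin 4 → Fin k) (z : (Fin 4 → Fin k) → ℕ)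
    (hz : ∀ c p, ∑ e ∈ P.filter (fun e => e c = p), z e + (univ.filter (fun c' => c' ≠ c ∧ T c' c = p)).card = N)
    (A : Fin k → Finset (Fin n)) (hA : ∀ p, (A p).card = N)
    (hd : ∀ p q x, x ∈ A p → x ∈ A q → p = q) (ht : ∀ p, t0 ∉ A p)
    (hP : ∀ e ∈ P, ∀ x : Fin 4 → Fin n, (∀ c, x c ∈ A (e c)) → x ∈ E)
    (hT : ∀ c, ∀ x : Fin 4 → Fin n, x c = t0 → (∀ c', c' ≠ c → x c' ∈ A (T c c')) → x ∈ E) : HasPM E := by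
  have : Inhabited (Fin n) := ⟨t0⟩
  set ι := (Σ e : P, Fin (z e.1)) ⊕ Fin 4
  set π : Fin 4 → ι → Option (Fin k) := fun c i =>
    Sum.elim (fun q => some (q.1.1 c)) (fun c' => if c' = c then none else some (T c' c)) i with hπ
  set B : Option (Fin k) → Finset (Fin n) := fun o => o.elim {t0} A with hB
  have hBd : ∀ o o' x, x ∈ B o → x ∈ B o' → o = o' := by
    intro o o' x
    cases o <;> cases o' <;> simp only [hB, Option.elim, mem_singleton]
    · simp
    · rintro rfl h; exact absurd h (ht _)
    · rintro h rfl; exact absurd h (ht _)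
    · intro h1 h2; rw [hd _ _ _ h1 h2]
  have hcard : ∀ c o, (univ.filter (fun i => π c i = o)).card = (B o).card := by
    intro c o
    cases o with
    | some p =>
      simp only [hB, Option.elim, hA]
      rw [← hz c p]
      exact fibre_count P z T c p
    | none =>
      simp only [hB, Option.elim, card_singleton]
      rw [card_eq_one]
      refine ⟨Sum.inr c, ?_⟩
      ext i
      rcases i with i | i
      · simp [hπ]
      · by_cases h : i = c
        · simp [hπ, h]
        · have h' : (Sum.inr i : ι) ≠ Sum.inr c := fun h'' => h (Sum.inr.inj h'')
          simp [hπ, h, h']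
  have := fun c => assign (π c) B hBd (fun o => by rw [← hcard c o]; congr)
  choose v hv1 hv2 hv3 using this
  set X : Fin n → Prop := fun x => ∃ o, x ∈ B o with hX
  refine hasPM_of_bij (J := ι ⊕ {j // ¬ X j}) (fun i c => Sum.elim (v c) (fun j => j.1) i) ?_ ?_
  · rintro (i | j)
    · simp only [Sum.elim_inl]
      rcases i with q | c
      · refine hP q.1.1 q.1.2 _ fun c => ?_
        have := hv2 c (Sum.inl q)
        simpa [hπ, hB] using this
      · refine hT c _ ?_ ?_
        · have := hv2 c (Sum.inr c)
          simpa [hπ, hB] using this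
        · intro c' hc'
          have := hv2 c' (Sum.inr c)
          simpa [hπ, hB, hc'.symm] using this
    · simp only [Sum.elim_inr]
      refine hdiag _ ?_
      rintro h
      exact j.2 ⟨none, by simp [hB, h]⟩
  · intro c
    constructor
    · rintro (i | i) (j | j) h
      · simp only [Sum.elim_inl] at h
        rw [hv1 c h]
      · simp only [Sum.elim_inl, Sum.elim_inr] at h
        exact absurd ⟨_, h ▸ hv2 c i⟩ j.2
      · simp only [Sum.elim_inl, Sum.elim_inr] at h
        exact absurd ⟨_, h ▸ hv2 c j⟩ i.2
      · simp only [Sum.elim_inr] at h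
        rw [Subtype.ext h]
    · intro x
      by_cases hx : X x
      · obtain ⟨o, ho⟩ := hx
        obtain ⟨i, hi⟩ := hv3 c o x ho
        exact ⟨Sum.inl i, by simpa using hi⟩
      · exact ⟨Sum.inr ⟨x, hx⟩, by simp⟩

end RPM

open Finset
namespace RPM
open scoped Classical

def Solv {k : ℕ} (P : Finset (Fin 4 → Fin k)) (T : Fin 4 → Fin 4 → Fin k) (N : ℕ) : Prop :=
  (∀ e ∈ P, Function.Injective e) ∧ (∀ c, Function.Injective (T c)) ∧ 1 ≤ N ∧ ∃ z : (Fin 4 → Fin k) → ℕ,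
    ∀ c p, ∑ e ∈ P.filter (fun e => e c = p), z e + (univ.filter (fun c' => c' ≠ c ∧ T c' c = p)).card = N

def Fits {k n : ℕ} (E : Finset (Fin 4 → Fin n)) (t0 : Fin n) (s : Fin k → Fin n)
    (P : Finset (Fin 4 → Fin k)) (T : Fin 4 → Fin 4 → Fin k) : Prop :=
  Function.Injective s ∧ (∀ p, s p ≠ t0) ∧ (∀ e ∈ P, s ∘ e ∈ E) ∧ ∀ c, Function.update (s ∘ T c) c t0 ∈ E

lemma ext_mem {k n : ℕ} {A : Fin k → Finset (Fin n)} {a : Fin k → Fin n} (ha : ∀ p, a p ∈ A p)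
    {e : Fin 4 → Fin k} (he : Function.Injective e) {x : Fin 4 → Fin n} (hx : ∀ c, x c ∈ A (e c)) :
    ∀ p, Function.extend e x a p ∈ A p := by
  intro p
  by_cases h : ∃ c, e c = p
  · obtain ⟨c, rfl⟩ := h
    rw [he.extend_apply]; exact hx c
  · rw [Function.extend_apply' _ _ _ h]; exact ha p

lemma asm_one {k : ℕ} (δ : ℝ) (hδ : 0 < δ) (P : Finset (Fin 4 → Fin k)) (T : Fin 4 → Fin 4 → Fin k) (N : ℕ)
    (hS : Solv P T N) : ∃ n0 : ℕ, ∀ n, n0 ≤ n → ∀ (E : Finset (Fin 4 → Fin n)) (t0 : Fin n),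
      (∀ j, j ≠ t0 → (fun _ => j) ∈ E) →
      δ * (n : ℝ) ^ k ≤ ((univ.filter (fun s : Fin k → Fin n => Fits E t0 s P T)).card : ℝ) → HasPM E := by
  obtain ⟨hPi, hTi, hN, z, hz⟩ := hS
  obtain ⟨n0, h0⟩ := box N hN k δ hδ
  refine ⟨n0, fun n hn E t0 hdiag hG => ?_⟩
  obtain ⟨A, hA, hs⟩ := h0 n hn _ hG
  have hs : ∀ s : Fin k → Fin n, (∀ p, s p ∈ A p) → Fits E t0 s P T := fun s h => (mem_filter.1 (hs s h)).2
  have hne : ∀ p, ∃ a, a ∈ A p := fun p => card_pos.1 (by rw [hA]; omega)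
  choose a ha using hne
  refine blowup t0 hdiag P T z hz A hA ?_ ?_ ?_ ?_
  · intro p q x hp hq
    by_contra hpq
    have h := (hs (Function.update (Function.update a p x) q x) ?_).1
    · refine hpq (h ?_)
      simp [Function.update_of_ne hpq]
    · intro r
      by_cases h1 : r = q
      · subst h1; simpa using hq
      · rw [Function.update_of_ne h1]
        by_cases h2 : r = p
        · subst h2; simpa using hp
        · rw [Function.update_of_ne h2]; exact ha r
  · intro p hp
    have h := (hs (Function.update a p t0) ?_).2.1 p
    · simp at h
    · intro r
      by_cases h2 : r = p
      · subst h2; simpa using hp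
      · rw [Function.update_of_ne h2]; exact ha r
  · intro e he x hx
    have h := (hs _ (ext_mem ha (hPi e he) hx)).2.2.1 e he
    rwa [Function.extend_comp (hPi e he)] at h
  · intro c x hxc hx
    have hx' : ∀ c', Function.update x c (a (T c c)) c' ∈ A (T c c') := by
      intro c'
      by_cases h : c' = c
      · subst h; simpa using ha _
      · rw [Function.update_of_ne h]; exact hx c' h
    have h := (hs _ (ext_mem ha (hTi c) hx')).2.2.2 c
    rw [Function.extend_comp (hTi c), Function.update_idem, ← hxc, Function.update_eq_self] at h
    exact h

theorem asm (k : ℕ) : ∃ n0 : ℕ, ∀ n, n0 ≤ n → ∀ (E : Finset (Fin 4 → Fin n)) (t0 : Fin n),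
      (∀ j, j ≠ t0 → (fun _ => j) ∈ E) →
      1 / 2 * (n : ℝ) ^ k ≤ ((univ.filter (fun s : Fin k → Fin n => ∃ P T N, Solv P T N ∧ Fits E t0 s P T)).card : ℝ) →
      HasPM E := by
  set Y := (Finset (Fin 4 → Fin k)) × (Fin 4 → Fin 4 → Fin k)
  set K : ℕ := Fintype.card Y with hK
  have hδ : (0 : ℝ) < 1 / (2 * (K + 1)) := by positivity
  have h1 : ∀ y : Y, ∃ n0 : ℕ, ∀ n, n0 ≤ n → ∀ (E : Finset (Fin 4 → Fin n)) (t0 : Fin n),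
      (∀ j, j ≠ t0 → (fun _ => j) ∈ E) → (∃ N, Solv y.1 y.2 N) →
      1 / (2 * ((K : ℝ) + 1)) * (n : ℝ) ^ k ≤ ((univ.filter (fun s : Fin k → Fin n => Fits E t0 s y.1 y.2)).card : ℝ) →
      HasPM E := by
    intro y
    by_cases hy : ∃ N, Solv y.1 y.2 N
    · obtain ⟨N, hN⟩ := hy
      obtain ⟨n0, h⟩ := asm_one _ hδ y.1 y.2 N hN
      exact ⟨n0, fun n hn E t0 hd _ => h n hn E t0 hd⟩
    · exact ⟨0, fun n hn E t0 hd h => absurd h hy⟩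
  choose f hf using h1
  refine ⟨(univ.sup f) + 1, fun n hn E t0 hd hG => ?_⟩
  by_contra hno
  have h2 : ∀ y : Y, (∃ N, Solv y.1 y.2 N) → ((univ.filter (fun s : Fin k → Fin n => Fits E t0 s y.1 y.2)).card : ℝ)
      ≤ 1 / (2 * ((K : ℝ) + 1)) * (n : ℝ) ^ k := by
    intro y hy
    by_contra hcon
    push Not at hcon
    exact hno (hf y n (by have := le_sup (f := f) (mem_univ y); omega) E t0 hd hy hcon.le)
  have h3 : (univ.filter (fun s : Fin k → Fin n => ∃ P T N, Solv P T N ∧ Fits E t0 s P T)) ⊆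
      (univ.filter (fun y : Y => ∃ N, Solv y.1 y.2 N)).biUnion (fun y => univ.filter (fun s : Fin k → Fin n => Fits E t0 s y.1 y.2)) := by
    intro s hs
    obtain ⟨P, T, N, h, h'⟩ := (mem_filter.1 hs).2
    exact mem_biUnion.2 ⟨(P, T), by simpa using ⟨N, h⟩, by simpa using h'⟩
  have h4 : ((univ.filter (fun s : Fin k → Fin n => ∃ P T N, Solv P T N ∧ Fits E t0 s P T)).card : ℝ) ≤
      ∑ y ∈ univ.filter (fun y : Y => ∃ N, Solv y.1 y.2 N), ((univ.filter (fun s : Fin k → Fin n => Fits E t0 s y.1 y.2)).card : ℝ) := by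
    exact_mod_cast (card_le_card h3).trans card_biUnion_le
  have h5 : ∑ y ∈ univ.filter (fun y : Y => ∃ N, Solv y.1 y.2 N), ((univ.filter (fun s : Fin k → Fin n => Fits E t0 s y.1 y.2)).card : ℝ)
      ≤ ∑ y : Y, 1 / (2 * ((K : ℝ) + 1)) * (n : ℝ) ^ k :=
    (sum_le_sum fun y hy => h2 y (mem_filter.1 hy).2).trans
      (sum_le_sum_of_subset_of_nonneg (filter_subset _ _) fun _ _ _ => by positivity)
  rw [sum_const, card_univ, nsmul_eq_mul, ← hK] at h5
  have hn : (0 : ℝ) < n := by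
    have : 0 < n := by omega
    exact_mod_cast this
  have hp : (0 : ℝ) < (n : ℝ) ^ k := by positivity
  have h6 : (K : ℝ) * (1 / (2 * ((K : ℝ) + 1)) * (n : ℝ) ^ k) < 1 / 2 * (n : ℝ) ^ k := by
    rw [← mul_assoc]
    refine mul_lt_mul_of_pos_right ?_ hp
    rw [mul_one_div, div_lt_div_iff₀ (by positivity) (by norm_num)]
    linarith
  linarith

/-- a sample from which the assembly works -/
lemma solv_of {k : ℕ} (P : Finset (Fin 4 → Fin k)) (hPi : ∀ e ∈ P, Function.Injective e) (hk : 0 < k)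
    (hL : LatH P) (hne : P.Nonempty) (w : (Fin 4 → Fin k) → ℝ) (hw : ∀ e ∈ P, 0 < w e)
    (hw1 : ∀ c p, ∑ e ∈ P.filter (fun e => e c = p), w e = 1)
    (T : Fin 4 → Fin 4 → Fin k) (hT : ∀ c, Function.Injective (T c)) : ∃ N, Solv P T N := by
  obtain ⟨N, z, hN, h⟩ := intsol hk P hL hne w hw hw1
    (fun c p => (univ.filter (fun c' => c' ≠ c ∧ T c' c = p)).card) 3 (by
      intro c
      have : ∀ p, (univ.filter (fun c' => c' ≠ c ∧ T c' c = p)) = ((univ.erase c).filter (fun c' => T c' c = p)) := by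
        intro p; ext; simp
      simp only [this]
      rw [← card_eq_sum_card_fiberwise (fun _ _ => mem_univ _)]
      simp)
  exact ⟨N, hPi, hT, hN, z, h⟩

end RPM

open Finset
namespace RPM
open scoped Classical

lemma fib1 {n : ℕ} (c : Fin 4) (a : Fin n) (R : (Fin 4 → Fin n) → Prop) [DecidablePred R] :
    ((univ : Finset (Fin 4 → Fin n)).filter (fun y => R (Function.update y c a))).card
      = n * ((univ : Finset (Fin 4 → Fin n)).filter (fun y => y c = a ∧ R y)).card := by
  have h : ((univ : Finset (Fin n)) ×ˢ ((univ : Finset (Fin 4 → Fin n)).filter (fun y => y c = a ∧ R y))).card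
      = n * ((univ : Finset (Fin 4 → Fin n)).filter (fun y => y c = a ∧ R y)).card := by
    rw [card_product]; simp
  rw [← h]
  refine card_nbij' (fun y => (y c, Function.update y c a)) (fun q => Function.update q.2 c q.1) ?_ ?_ ?_ ?_
  · intro y hy
    have := (mem_filter.1 hy).2
    simp only [coe_product, coe_univ, Set.mem_prod, Set.mem_univ, true_and, coe_filter, mem_univ, Set.mem_ofPred_eq]
    exact ⟨by simp, this⟩
  · rintro ⟨v, y⟩ hq
    obtain ⟨-, hq⟩ := mem_product.1 hq
    obtain ⟨h1, h2⟩ := (mem_filter.1 hq).2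
    simp only at h1 h2
    simp only [coe_filter, mem_univ, true_and, Set.mem_ofPred_eq, Function.update_idem]
    rw [← h1, Function.update_eq_self]; exact h2
  · intro y hy
    simp
  · rintro ⟨v, y⟩ hq
    obtain ⟨-, hq⟩ := mem_product.1 hq
    obtain ⟨h1, h2⟩ := (mem_filter.1 hq).2
    simp only at h1 h2
    simp only [Function.update_self, Function.update_idem, Prod.mk.injEq, true_and]
    rw [← h1, Function.update_eq_self]

lemma fib2 {n : ℕ} (c : Fin 4) (hc : c ≠ 0) (i a : Fin n) (R : (Fin 4 → Fin n) → Prop) [DecidablePred R] :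
    ((univ : Finset (Fin 4 → Fin n)).filter (fun y => R (Function.update (Function.update y 0 i) c a))).card
      = n ^ 2 * ((univ : Finset (Fin 4 → Fin n)).filter (fun y => y 0 = i ∧ y c = a ∧ R y)).card := by
  rw [fib1 0 i (fun y => R (Function.update y c a))]
  have := fib1 c a (fun y => y 0 = i ∧ R y)
  simp only [Function.update_of_ne hc.symm] at this
  rw [this, pow_two, mul_assoc]
  congr 3
  ext y
  simp only [mem_filter, mem_univ, true_and]
  tauto

lemma card_in_eq {n : ℕ} (c : Fin 4) (R : Fin n → Prop) [DecidablePred R] :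
    ((univ : Finset (Fin 4 → Fin n)).filter (fun y => R (y c))).card
      = n ^ 3 * ((univ : Finset (Fin n)).filter R).card := by
  rw [card_eq_sum_card_fiberwise (f := fun y => y c) (t := univ.filter R)]
  · rw [sum_congr rfl (g := fun _ => n ^ 3)]
    · rw [sum_const, smul_eq_mul, mul_comm]
    · intro v hv
      rw [← card_fix1 c v, filter_filter]
      congr 1
      ext y
      simp only [mem_filter, mem_univ, true_and] at hv ⊢
      constructor
      · rintro ⟨_, h⟩; exact h
      · rintro h; exact ⟨h ▸ hv, h⟩
  · intro y hy
    have := (mem_filter.1 hy).2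
    simpa using this

lemma kap_le {n r s : ℕ} (hn : n = 3 * r + s) (hs1 : 1 ≤ s) (hs3 : s ≤ 3) :
    (kap (n - r) s : ℝ) ≤ (2 / 3 * n + 1) ^ 2 := by
  have h1 : kap (n - r) s ≤ (n - r) ^ 2 := by
    unfold kap
    split_ifs
    · exact le_rfl
    · obtain ⟨q, hq⟩ : ∃ q, n - r = q + 1 := ⟨n - r - 1, by omega⟩
      rw [hq]; simp only [Nat.add_sub_cancel]; nlinarith
    · rw [pow_two]; exact Nat.mul_le_mul_left _ (Nat.sub_le _ _)
  have h2 : ((n - r : ℕ) : ℝ) ≤ 2 / 3 * n + 1 := by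
    have : 3 * (n - r) ≤ 2 * n + 3 := by omega
    have : (3 * ((n - r : ℕ) : ℝ)) ≤ 2 * n + 3 := by exact_mod_cast this
    linarith
  calc (kap (n - r) s : ℝ) ≤ ((n - r : ℕ) : ℝ) ^ 2 := by exact_mod_cast h1
    _ ≤ _ := by gcongr

lemma deg_full {n r s : ℕ} {E : Finset (Fin 4 → Fin n)} (hn : n = 3 * r + s) (hs1 : 1 ≤ s) (hs3 : s ≤ 3)
    (hE : DegH n r s E) (ε : ℝ) (hε : 0 < ε) (hb : 3 ≤ ε * n) (c : Fin 4) (hc : c ≠ 0) (i v : Fin n) :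
    (5 / 9 - ε) * (n : ℝ) ^ 2 ≤ ((univ.filter (fun e : Fin 4 → Fin n => e 0 = i ∧ e c = v ∧ e ∈ E)).card : ℝ) := by
  have h1 := hE c hc i v
  have h2 : (univ.filter (fun e : Fin 4 → Fin n => e 0 = i ∧ e c = v ∧ e ∈ E)).card +
      (univ.filter (fun e : Fin 4 → Fin n => e 0 = i ∧ e c = v ∧ e ∉ E)).card = n ^ 2 := by
    rw [← card_fix2 0 c hc.symm i v, ← card_filter_add_card_filter_not
      (s := (univ : Finset (Fin 4 → Fin n)).filter (fun e => e 0 = i ∧ e c = v)) (fun e => e ∈ E), filter_filter, filter_filter]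
    simp only [and_assoc]
  have h3 := kap_le hn hs1 hs3
  have h4 : ((univ.filter (fun e : Fin 4 → Fin n => e 0 = i ∧ e c = v ∧ e ∉ E)).card : ℝ) + 1 ≤ kap (n - r) s := by
    exact_mod_cast h1
  have h5 : ((univ.filter (fun e : Fin 4 → Fin n => e 0 = i ∧ e c = v ∧ e ∈ E)).card : ℝ) +
      ((univ.filter (fun e : Fin 4 → Fin n => e 0 = i ∧ e c = v ∧ e ∉ E)).card : ℝ) = (n : ℝ) ^ 2 := by
    exact_mod_cast h2
  have hn0 : (0 : ℝ) ≤ n := by positivity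
  have h6 : 3 * (n : ℝ) ≤ ε * n ^ 2 := by nlinarith
  nlinarith

lemma tdeg {n r s : ℕ} {E : Finset (Fin 4 → Fin n)} (hn : n = 3 * r + s) (hs1 : 1 ≤ s) (hs3 : s ≤ 3)
    (hE : DegH n r s E) (ε : ℝ) (hε : 0 < ε) (hb : 3 ≤ ε * n) (c : Fin 4) (t : Fin n) :
    (5 / 9 - ε) * (n : ℝ) ^ 3 ≤ ((univ.filter (fun e : Fin 4 → Fin n => e c = t ∧ e ∈ E)).card : ℝ) := by
  have key : ∀ d : Fin 4, (∀ v, (5 / 9 - ε) * (n : ℝ) ^ 2 ≤ ((univ.filter (fun e : Fin 4 → Fin n => e c = t ∧ e d = v ∧ e ∈ E)).card : ℝ)) →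
      (5 / 9 - ε) * (n : ℝ) ^ 3 ≤ ((univ.filter (fun e : Fin 4 → Fin n => e c = t ∧ e ∈ E)).card : ℝ) := by
    intro d hd
    rw [card_eq_sum_card_fiberwise (f := fun y => y d) (t := univ) (fun _ _ => mem_univ _)]
    push_cast
    have : ∑ v : Fin n, (5 / 9 - ε) * (n : ℝ) ^ 2 = (5 / 9 - ε) * (n : ℝ) ^ 3 := by
      rw [sum_const, card_univ, Fintype.card_fin, nsmul_eq_mul]; ring
    rw [← this]
    refine sum_le_sum fun v _ => (hd v).trans ?_
    norm_cast
    refine card_le_card ?_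
    intro e he
    obtain ⟨h1, h2, h3⟩ := (mem_filter.1 he).2
    simp [h1, h2, h3]
  by_cases hc : c = 0
  · subst hc
    exact key 1 fun v => deg_full hn hs1 hs3 hE ε hε hb 1 (by decide) t v
  · refine key 0 fun v => (deg_full hn hs1 hs3 hE ε hε hb c hc v t).trans ?_
    norm_cast
    refine card_le_card ?_
    intro e he
    obtain ⟨h1, h2, h3⟩ := (mem_filter.1 he).2
    simp [h1, h2, h3]

lemma noninj4 (k : ℕ) (hk : 0 < k) :
    (((univ : Finset (Fin 4 → Fin k)).filter (fun g => ¬ Function.Injective g)).card : ℝ) ≤ 16 * k ^ 3 := by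
  have h := card_not_inj 4 k
  have h' : (((univ : Finset (Fin 4 → Fin k)).filter (fun g => ¬ Function.Injective g)).card : ℝ) * k ≤ 4 ^ 2 * k ^ 4 := by
    exact_mod_cast h
  have hk' : (0 : ℝ) < k := by exact_mod_cast hk
  refine le_of_mul_le_mul_right (h'.trans ?_) hk'
  apply le_of_eq; ring

lemma hit_t0 {n : ℕ} (k : ℕ) (t0 : Fin n) :
    ((univ : Finset (Fin k → Fin n)).filter (fun s => ∃ p, s p = t0)).card * n ≤ k * n ^ k := by
  have h1 : ((univ : Finset (Fin k → Fin n)).filter (fun s => ∃ p, s p = t0)) ⊆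
      (univ : Finset (Fin k)).biUnion (fun p => univ.filter (fun s : Fin k → Fin n => s p = t0)) := by
    intro s hs
    obtain ⟨p, hp⟩ := (mem_filter.1 hs).2
    exact mem_biUnion.2 ⟨p, mem_univ _, by simpa using hp⟩
  have h2 : ∀ p : Fin k, (univ.filter (fun s : Fin k → Fin n => s p = t0)).card * n ≤ n ^ k := by
    intro p
    have : ((univ.filter (fun s : Fin k → Fin n => s p = t0)) ×ˢ (univ : Finset (Fin n))).card ≤ (univ : Finset (Fin k → Fin n)).card := by
      refine card_le_card_of_injOn (fun q => Function.update q.1 p q.2) (fun _ _ => mem_univ _) ?_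
      rintro ⟨s, v⟩ hs ⟨s', v'⟩ hs' h
      have e1 : s p = t0 := by have := (mem_product.1 hs).1; simpa using this
      have e2 : s' p = t0 := by have := (mem_product.1 hs').1; simpa using this
      simp only at h
      have e3 : v = v' := by have := congrFun h p; simpa using this
      refine Prod.ext ?_ e3
      funext q
      by_cases hq : q = p
      · subst hq; simp [e1, e2]
      · have := congrFun h q; simpa [hq] using this
    rw [card_product] at this
    simpa using this
  calc _ ≤ (∑ p : Fin k, (univ.filter (fun s : Fin k → Fin n => s p = t0)).card) * n :=
        Nat.mul_le_mul_right _ ((card_le_card h1).trans card_biUnion_le)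
    _ = ∑ p : Fin k, (univ.filter (fun s : Fin k → Fin n => s p = t0)).card * n := by rw [sum_mul]
    _ ≤ ∑ p : Fin k, n ^ k := sum_le_sum fun p _ => h2 p
    _ = k * n ^ k := by simp

lemma inj4 {k : ℕ} (c : Fin 4) (hc : c ≠ 0) (e : Fin 4 → Fin k) (h1 : e 0 ≠ e c) (h2 : e 0 ≠ e (nx c))
    (h3 : e 0 ≠ e (nx (nx c))) (h4 : e c ≠ e (nx c)) (h5 : e c ≠ e (nx (nx c))) (h6 : e (nx c) ≠ e (nx (nx c))) :
    Function.Injective e := by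
  intro p q hpq
  rcases nx_cases c hc p with h | h | h | h <;> rcases nx_cases c hc q with h' | h' | h' | h' <;>
    rw [h, h'] at hpq ⊢ <;>
    first
      | exact absurd hpq ‹_›
      | exact absurd hpq.symm ‹_›

lemma noninj_fix {k : ℕ} (c : Fin 4) (hc : c ≠ 0) (i a : Fin k) (hia : i ≠ a) :
    ((univ : Finset (Fin 4 → Fin k)).filter (fun e => e 0 = i ∧ e c = a ∧ ¬ Function.Injective e)).card ≤ 5 * k := by
  obtain ⟨h1, h2, h3, h4, h5⟩ := nx_ne c hc
  have hcs := nx_cases c hc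
  set c1 := nx c
  set c2 := nx (nx c)
  have key : ∀ (R : (Fin 4 → Fin k) → Prop) [DecidablePred R] (d : Fin 4), (∀ e e' : Fin 4 → Fin k, R e → R e' → e d = e' d → ∀ x, e x = e' x) →
      ((univ : Finset (Fin 4 → Fin k)).filter R).card ≤ k := by
    intro R _ d hR
    have : ((univ : Finset (Fin 4 → Fin k)).filter R).card ≤ (univ : Finset (Fin k)).card := by
      refine card_le_card_of_injOn (fun e => e d) (fun _ _ => mem_univ _) ?_
      intro e he e' he' h
      exact funext (hR e e' (mem_filter.1 he).2 (mem_filter.1 he').2 h)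
    simpa using this
  have a1 := key (fun e => e 0 = i ∧ e c = a ∧ e c1 = i) c2 (by
    rintro e e' ⟨x1, x2, x3⟩ ⟨y1, y2, y3⟩ h x
    rcases hcs x with rfl | rfl | rfl | rfl <;> simp_all)
  have a2 := key (fun e => e 0 = i ∧ e c = a ∧ e c1 = a) c2 (by
    rintro e e' ⟨x1, x2, x3⟩ ⟨y1, y2, y3⟩ h x
    rcases hcs x with rfl | rfl | rfl | rfl <;> simp_all)
  have a3 := key (fun e => e 0 = i ∧ e c = a ∧ e c2 = i) c1 (by
    rintro e e' ⟨x1, x2, x3⟩ ⟨y1, y2, y3⟩ h x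
    rcases hcs x with rfl | rfl | rfl | rfl <;> simp_all)
  have a4 := key (fun e => e 0 = i ∧ e c = a ∧ e c2 = a) c1 (by
    rintro e e' ⟨x1, x2, x3⟩ ⟨y1, y2, y3⟩ h x
    rcases hcs x with rfl | rfl | rfl | rfl <;> simp_all)
  have a5 := key (fun e => e 0 = i ∧ e c = a ∧ e c1 = e c2) c1 (by
    rintro e e' ⟨x1, x2, x3⟩ ⟨y1, y2, y3⟩ h x
    rcases hcs x with rfl | rfl | rfl | rfl <;> simp_all)
  have hsub : ((univ : Finset (Fin 4 → Fin k)).filter (fun e => e 0 = i ∧ e c = a ∧ ¬ Function.Injective e)) ⊆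
      (univ.filter (fun e : Fin 4 → Fin k => e 0 = i ∧ e c = a ∧ e c1 = i)) ∪
      ((univ.filter (fun e : Fin 4 → Fin k => e 0 = i ∧ e c = a ∧ e c1 = a)) ∪
      ((univ.filter (fun e : Fin 4 → Fin k => e 0 = i ∧ e c = a ∧ e c2 = i)) ∪
      ((univ.filter (fun e : Fin 4 → Fin k => e 0 = i ∧ e c = a ∧ e c2 = a)) ∪
      (univ.filter (fun e : Fin 4 → Fin k => e 0 = i ∧ e c = a ∧ e c1 = e c2))))) := by
    intro e he
    obtain ⟨x1, x2, x3⟩ := (mem_filter.1 he).2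
    simp only [mem_union, mem_filter, mem_univ, true_and, x1, x2]
    by_contra hcon
    push Not at hcon
    obtain ⟨y1, y2, y3, y4, y5⟩ := hcon
    refine x3 (inj4 c hc e ?_ ?_ ?_ ?_ ?_ y5)
    · rw [x1, x2]; exact hia
    · rw [x1]; exact fun h => y1 h.symm
    · rw [x1]; exact fun h => y3 h.symm
    · rw [x2]; exact fun h => y2 h.symm
    · rw [x2]; exact fun h => y4 h.symm
  refine (card_le_card hsub).trans ?_
  refine ((card_union_le _ _).trans (add_le_add a1 ((card_union_le _ _).trans (add_le_add a2
    ((card_union_le _ _).trans (add_le_add a3 ((card_union_le _ _).trans (add_le_add a4 a5)))))))).trans ?_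
  omega

end RPM

open Finset
namespace RPM
open scoped Classical

noncomputable def Wx {n : ℕ} (E : Finset (Fin 4 → Fin n)) (x : Fin 4 → Fin n) (c : Fin 4) : Finset (Fin n) :=
  univ.filter (fun v => 7 / 10 * (n : ℝ) ≤ ((univ.filter (fun w => lk x c v w ∈ E)).card : ℝ))

def QF {n : ℕ} (E : Finset (Fin 4 → Fin n)) (t0 : Fin n) (j : Fin 5 × Fin 4) (x y : Fin 4 → Fin n) : Prop :=
  if j.1 = 0 then Function.update (Function.update y 0 (x 0)) j.2 (x 1) ∈ E
  else if j.1 = 1 then Function.update y j.2 t0 ∈ E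
  else if j.1 = 2 then Function.update x (nx j.2) (y (nx j.2)) ∈ E
  else if j.1 = 3 then y j.2 ∈ Wx E x j.2
  else (y ∈ E ∧ ∀ c, c ≠ 0 → y c ∉ Wx E x c)

def SG {n k : ℕ} (ε : ℝ) (E : Finset (Fin 4 → Fin n)) (t0 : Fin n) (s : Fin k → Fin n) : Prop :=
  ∀ j, ∀ φ : Fin 4 → Fin k,
      |(((univ : Finset (Fin 4 → Fin k)).filter (fun ψ => QF E t0 j (s ∘ φ) (s ∘ ψ))).card : ℝ) / k ^ 4
        - (((univ : Finset (Fin 4 → Fin n)).filter (fun y => QF E t0 j (s ∘ φ) y)).card : ℝ) / n ^ 4| ≤ ε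

variable {n k : ℕ} {ε : ℝ} {E : Finset (Fin 4 → Fin n)} {t0 : Fin n} {s : Fin k → Fin n}

lemma SG.D (h : SG ε E t0 s) (hk : 0 < k) (hn : 0 < n) (c : Fin 4) (hc : c ≠ 0) (i a : Fin k) :
    |((univ.filter (fun e : Fin 4 → Fin k => e 0 = i ∧ e c = a ∧ s ∘ e ∈ E)).card : ℝ) / k ^ 2
      - ((univ.filter (fun y : Fin 4 → Fin n => y 0 = s i ∧ y c = s a ∧ y ∈ E)).card : ℝ) / n ^ 2| ≤ ε := by
  have h1 := h (0, c) ![i, a, a, a]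
  simp only [QF, if_true, Function.comp_apply] at h1
  have e1 := fib2 c hc i a (fun e => s ∘ e ∈ E)
  have e2 := fib2 c hc (s i) (s a) (fun e => e ∈ E)
  simp only [Function.comp_update] at e1
  have z0 : (![i, a, a, a] : Fin 4 → Fin k) 0 = i := rfl
  have z1 : (![i, a, a, a] : Fin 4 → Fin k) 1 = a := rfl
  simp only [z0, z1] at h1
  rw [e1, e2] at h1
  push_cast at h1
  have hk' : (k : ℝ) ≠ 0 := by positivity
  have hn' : (n : ℝ) ≠ 0 := by positivity
  convert h1 using 3
  · field_simp
  · field_simp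

lemma SG.T (h : SG ε E t0 s) (hk : 0 < k) (hn : 0 < n) (c : Fin 4) :
    |((univ.filter (fun e : Fin 4 → Fin k => Function.update (s ∘ e) c t0 ∈ E)).card : ℝ) / k ^ 4
      - ((univ.filter (fun y : Fin 4 → Fin n => y c = t0 ∧ y ∈ E)).card : ℝ) / n ^ 3| ≤ ε := by
  have h1 := h (1, c) (fun _ => ⟨0, hk⟩)
  simp only [QF, if_true, one_ne_zero, if_false] at h1
  have e2 := fib1 c t0 (fun e => e ∈ E)
  rw [e2] at h1
  push_cast at h1
  have hn' : (n : ℝ) ≠ 0 := by positivity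
  convert h1 using 3
  field_simp

lemma SG.L (h : SG ε E t0 s) (hk : 0 < k) (hn : 0 < n) (c : Fin 4) (φ : Fin 4 → Fin k) :
    |((univ.filter (fun w : Fin k => s ∘ Function.update φ (nx c) w ∈ E)).card : ℝ) / k
      - ((univ.filter (fun w : Fin n => Function.update (s ∘ φ) (nx c) w ∈ E)).card : ℝ) / n| ≤ ε := by
  have h1 := h (2, c) φ
  have q0 : (2 : Fin 5) ≠ 0 := by decide
  have q1 : (2 : Fin 5) ≠ 1 := by decide
  simp only [QF, if_true, q0, q1, if_false] at h1
  have e1 := card_in_eq (nx c) (fun w : Fin k => s ∘ Function.update φ (nx c) w ∈ E)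
  have e2 := card_in_eq (nx c) (fun w : Fin n => Function.update (s ∘ φ) (nx c) w ∈ E)
  simp only [Function.comp_update] at e1
  simp only [Function.comp_apply] at h1
  rw [e1, e2] at h1
  push_cast at h1
  have hk' : (k : ℝ) ≠ 0 := by positivity
  have hn' : (n : ℝ) ≠ 0 := by positivity
  simp only [Function.comp_update]
  convert h1 using 3
  · field_simp
  · field_simp

lemma SG.W (h : SG ε E t0 s) (hk : 0 < k) (hn : 0 < n) (c : Fin 4) (φ : Fin 4 → Fin k) :
    |((univ.filter (fun p : Fin k => s p ∈ Wx E (s ∘ φ) c)).card : ℝ) / k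
      - ((Wx E (s ∘ φ) c).card : ℝ) / n| ≤ ε := by
  have h1 := h (3, c) φ
  have q0 : (3 : Fin 5) ≠ 0 := by decide
  have q1 : (3 : Fin 5) ≠ 1 := by decide
  have q2 : (3 : Fin 5) ≠ 2 := by decide
  simp only [QF, if_true, q0, q1, q2, if_false, Function.comp_apply] at h1
  have e1 := card_in_eq c (fun w : Fin k => s w ∈ Wx E (s ∘ φ) c)
  have e2 := card_in_eq c (fun w : Fin n => w ∈ Wx E (s ∘ φ) c)
  have e3 : univ.filter (fun w : Fin n => w ∈ Wx E (s ∘ φ) c) = Wx E (s ∘ φ) c := by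
    ext; simp
  rw [e3] at e2
  rw [e1, e2] at h1
  push_cast at h1
  have hk' : (k : ℝ) ≠ 0 := by positivity
  have hn' : (n : ℝ) ≠ 0 := by positivity
  convert h1 using 3
  · field_simp
  · field_simp

lemma SG.A (h : SG ε E t0 s) (φ : Fin 4 → Fin k) :
    |((univ.filter (fun ψ : Fin 4 → Fin k => s ∘ ψ ∈ E ∧ ∀ c, c ≠ 0 → s (ψ c) ∉ Wx E (s ∘ φ) c)).card : ℝ) / k ^ 4
      - ((Av E (Wx E (s ∘ φ))).card : ℝ) / n ^ 4| ≤ ε := by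
  have h1 := h (4, 0) φ
  have q0 : (4 : Fin 5) ≠ 0 := by decide
  have q1 : (4 : Fin 5) ≠ 1 := by decide
  have q2 : (4 : Fin 5) ≠ 2 := by decide
  have q3 : (4 : Fin 5) ≠ 3 := by decide
  simp only [QF, q0, q1, q2, q3, if_false, Function.comp_apply] at h1
  have e3 : univ.filter (fun y : Fin 4 → Fin n => y ∈ E ∧ ∀ c, c ≠ 0 → y c ∉ Wx E (s ∘ φ) c) = Av E (Wx E (s ∘ φ)) := by
    ext; simp [Av]
  rw [e3] at h1
  exact h1

noncomputable def pat (E : Finset (Fin 4 → Fin n)) (s : Fin k → Fin n) : Finset (Fin 4 → Fin k) :=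
  univ.filter (fun e => Function.Injective e ∧ s ∘ e ∈ E)

lemma pat_deg {r s' : ℕ} (hn : n = 3 * r + s') (hs1 : 1 ≤ s') (hs3 : s' ≤ 3) (hE : DegH n r s' E)
    (h : SG ε E t0 s) (hε : 0 < ε) (hk : 0 < k) (hb : 3 ≤ ε * n) (hbk : 5 ≤ ε * k) :
    DegP (3 * ε) (pat E s) := by
  intro c hc i a hia
  have hn0 : 0 < n := by omega
  have h1 := h.D hk hn0 c hc i a
  have h2 := deg_full hn hs1 hs3 hE ε hε hb c hc (s i) (s a)
  have hk' : (0 : ℝ) < k := by positivity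
  have hn' : (0 : ℝ) < n := by positivity
  have h3 : 5 / 9 - ε ≤ ((univ.filter (fun y : Fin 4 → Fin n => y 0 = s i ∧ y c = s a ∧ y ∈ E)).card : ℝ) / n ^ 2 := by
    rw [le_div_iff₀ (by positivity)]; exact h2
  have h4 : 5 / 9 - 2 * ε ≤ ((univ.filter (fun e : Fin 4 → Fin k => e 0 = i ∧ e c = a ∧ s ∘ e ∈ E)).card : ℝ) / k ^ 2 := by
    have := (abs_le.1 h1).1; linarith
  rw [le_div_iff₀ (by positivity)] at h4
  have h5 := noninj_fix c hc i a hia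
  have h6 : (univ.filter (fun e : Fin 4 → Fin k => e 0 = i ∧ e c = a ∧ s ∘ e ∈ E)) ⊆
      ((pat E s).filter (fun e => e 0 = i ∧ e c = a)) ∪
      ((univ : Finset (Fin 4 → Fin k)).filter (fun e => e 0 = i ∧ e c = a ∧ ¬ Function.Injective e)) := by
    intro e he
    obtain ⟨x1, x2, x3⟩ := (mem_filter.1 he).2
    by_cases hi : Function.Injective e <;> simp [pat, x1, x2, x3, hi]
  have h7 := (card_le_card h6).trans (card_union_le _ _)
  have h8 : ((univ.filter (fun e : Fin 4 → Fin k => e 0 = i ∧ e c = a ∧ s ∘ e ∈ E)).card : ℝ) ≤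
      (((pat E s).filter (fun e => e 0 = i ∧ e c = a)).card : ℝ) + 5 * k := by
    exact_mod_cast h7.trans (Nat.add_le_add_left h5 _)
  have h9 : 5 * (k : ℝ) ≤ ε * k ^ 2 := by nlinarith
  linarith

lemma pat_T {r s' : ℕ} (hn : n = 3 * r + s') (hs1 : 1 ≤ s') (hs3 : s' ≤ 3) (hE : DegH n r s' E)
    (h : SG ε E t0 s) (hε : 0 < ε) (hε1 : ε ≤ 1 / 100) (hk : 0 < k) (hb : 3 ≤ ε * n) (hbk : 16 ≤ ε * k) :
    ∃ T : Fin 4 → Fin 4 → Fin k, ∀ c, Function.Injective (T c) ∧ Function.update (s ∘ T c) c t0 ∈ E := by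
  have : ∀ c, ∃ e : Fin 4 → Fin k, Function.Injective e ∧ Function.update (s ∘ e) c t0 ∈ E := by
    intro c
    by_contra hcon
    push Not at hcon
    have hn0 : 0 < n := by omega
    have h1 := h.T hk hn0 c
    have h2 := tdeg hn hs1 hs3 hE ε hε hb c t0
    have hk' : (0 : ℝ) < k := by positivity
    have hn' : (0 : ℝ) < n := by positivity
    have h3 : 5 / 9 - ε ≤ ((univ.filter (fun y : Fin 4 → Fin n => y c = t0 ∧ y ∈ E)).card : ℝ) / n ^ 3 := by
      rw [le_div_iff₀ (by positivity)]; exact h2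
    have h4 : 5 / 9 - 2 * ε ≤ ((univ.filter (fun e : Fin 4 → Fin k => Function.update (s ∘ e) c t0 ∈ E)).card : ℝ) / k ^ 4 := by
      have := (abs_le.1 h1).1; linarith
    rw [le_div_iff₀ (by positivity)] at h4
    have h5 := noninj4 k hk
    have h6 : ((univ.filter (fun e : Fin 4 → Fin k => Function.update (s ∘ e) c t0 ∈ E)).card : ℝ) ≤
      (((univ : Finset (Fin 4 → Fin k)).filter (fun g => ¬ Function.Injective g)).card : ℝ) := by
      norm_cast
      refine card_le_card fun e he => ?_
      have := (mem_filter.1 he).2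
      exact mem_filter.2 ⟨mem_univ _, fun hi => hcon e hi this⟩
    have h7 : (0 : ℝ) < (k : ℝ) ^ 3 := by positivity
    have h8 : 16 * (k : ℝ) ^ 3 ≤ ε * k ^ 4 := by nlinarith
    have h9 : (0 : ℝ) < (k : ℝ) ^ 4 := by positivity
    nlinarith
  choose T hT using this
  exact ⟨T, hT⟩

end RPM

open Finset
namespace RPM
open scoped Classical

variable {n k : ℕ} {ε : ℝ} {E : Finset (Fin 4 → Fin n)} {t0 : Fin n} {s : Fin k → Fin n}

lemma ftd (h : SG ε E t0 s) (hε : 0 < ε) (hε1 : ε ≤ 1 / 100) (hk : 1000 ≤ k) (hn : 0 < n) (η : ℝ) (hη : η ≤ 1 / 100)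
    (b : Fin 4 → Fin k) (W : Fin 4 → Finset (Fin k)) (c : Fin 4) (hc : c ≠ 0)
    (hsz : |((W c).card : ℝ) - k / 3| ≤ η * k)
    (hlo : ∀ v, v ∉ W c → ((univ.filter (fun w => lk b c v w ∈ pat E s)).card : ℝ) ≤ 1 / 2 * k)
    (hbad : (((W c).filter (fun v => ((univ.filter (fun w => lk b c v w ∈ pat E s)).card : ℝ) < 9 / 10 * k)).card : ℝ) ≤ η * k) :
    ∃ D : Finset (Fin k), (D.card : ℝ) ≤ η * k + 2 ∧ ∀ p, p ∉ D → (s p ∈ Wx E (s ∘ b) c ↔ p ∈ W c) := by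
  obtain ⟨e1, e2, e3, e4, e5⟩ := nx_ne c hc
  have hkR : (1000 : ℝ) ≤ k := by exact_mod_cast hk
  have hnR : (0 : ℝ) < n := by exact_mod_cast hn
  set bad := (W c).filter (fun v => ((univ.filter (fun w => lk b c v w ∈ pat E s)).card : ℝ) < 9 / 10 * k) with hbd
  have hL : ∀ v, |((univ.filter (fun w : Fin k => s ∘ lk b c v w ∈ E)).card : ℝ) / k
      - ((univ.filter (fun w : Fin n => lk (s ∘ b) c (s v) w ∈ E)).card : ℝ) / n| ≤ ε := by
    intro v
    have := h.L (by omega) hn c (Function.update b c v)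
    simp only [lk, Function.comp_update] at this ⊢
    exact this
  -- b injective on remaining coordinates
  have hb : b 0 ≠ b (nx (nx c)) := by
    have h1 : bad.card < (W c).card := by
      have : (bad.card : ℝ) < (W c).card := by
        have := (abs_le.1 hsz).1
        nlinarith
      exact_mod_cast this
    obtain ⟨v, hv, hv'⟩ := exists_mem_notMem_of_card_lt_card h1
    have h2 : 9 / 10 * (k : ℝ) ≤ ((univ.filter (fun w => lk b c v w ∈ pat E s)).card : ℝ) := by
      by_contra hcon
      push Not at hcon
      exact hv' (mem_filter.2 ⟨hv, hcon⟩)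
    have h3 : 0 < (univ.filter (fun w => lk b c v w ∈ pat E s)).card := by
      have : (0 : ℝ) < ((univ.filter (fun w => lk b c v w ∈ pat E s)).card : ℝ) := by linarith
      exact_mod_cast this
    obtain ⟨w, hw⟩ := card_pos.1 h3
    have hw := (mem_filter.1 (mem_filter.1 hw).2).2.1
    obtain ⟨l1, l2, l3, l4⟩ := lk_vals b c hc v w
    intro hbb
    have : lk b c v w 0 = lk b c v w (nx (nx c)) := by rw [l1, l4, hbb]
    exact e2 (hw this).symm
  refine ⟨bad ∪ {b 0, b (nx (nx c))}, ?_, ?_⟩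
  · have h1 : ((bad ∪ {b 0, b (nx (nx c))}).card : ℝ) ≤ bad.card + 2 := by
      have := (card_union_le bad {b 0, b (nx (nx c))}).trans (Nat.add_le_add_left card_le_two _)
      exact_mod_cast this
    linarith
  · intro p hp
    simp only [mem_union, mem_insert, mem_singleton, not_or] at hp
    obtain ⟨hp1, hp2, hp3⟩ := hp
    have hL := abs_le.1 (hL p)
    have hWx : s p ∈ Wx E (s ∘ b) c ↔ 7 / 10 * (n : ℝ) ≤ ((univ.filter (fun w => lk (s ∘ b) c (s p) w ∈ E)).card : ℝ) := by
      simp [Wx]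
    have hWx' : s p ∈ Wx E (s ∘ b) c ↔ 7 / 10 ≤ ((univ.filter (fun w => lk (s ∘ b) c (s p) w ∈ E)).card : ℝ) / n := by
      rw [hWx, le_div_iff₀ hnR]
    rw [hWx']
    constructor
    · intro hq
      by_contra hpW
      have h1 := hlo p hpW
      have h2 : (univ.filter (fun w : Fin k => s ∘ lk b c p w ∈ E)) ⊆
          (univ.filter (fun w => lk b c p w ∈ pat E s)) ∪ {b 0, p, b (nx (nx c))} := by
        intro w hw
        have hw := (mem_filter.1 hw).2
        simp only [mem_union, mem_filter, mem_univ, true_and, mem_insert, mem_singleton]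
        by_cases hw3 : w = b 0 ∨ w = p ∨ w = b (nx (nx c))
        · right; exact hw3
        · left
          push Not at hw3
          refine mem_filter.2 ⟨mem_univ _, ?_, hw⟩
          obtain ⟨l1, l2, l3, l4⟩ := lk_vals b c hc p w
          apply inj4 c hc
          · rw [l1, l2]; exact fun h => hp2 h.symm
          · rw [l1, l3]; exact fun h => hw3.1 h.symm
          · rw [l1, l4]; exact hb
          · rw [l2, l3]; exact fun h => hw3.2.1 h.symm
          · rw [l2, l4]; exact hp3
          · rw [l3, l4]; exact hw3.2.2
      have h3 : ((univ.filter (fun w : Fin k => s ∘ lk b c p w ∈ E)).card : ℝ) ≤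
          ((univ.filter (fun w => lk b c p w ∈ pat E s)).card : ℝ) + 3 := by
        have := (card_le_card h2).trans ((card_union_le _ _).trans (Nat.add_le_add_left card_le_three _))
        exact_mod_cast this
      have h4 : ((univ.filter (fun w : Fin k => s ∘ lk b c p w ∈ E)).card : ℝ) / k ≤ 6 / 10 := by
        rw [div_le_iff₀ (by linarith)]; linarith
      linarith [hL.1]
    · intro hpW
      have h2 : 9 / 10 * (k : ℝ) ≤ ((univ.filter (fun w => lk b c p w ∈ pat E s)).card : ℝ) := by
        by_contra hcon
        push Not at hcon
        exact hp1 (mem_filter.2 ⟨hpW, hcon⟩)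
      have h3 : ((univ.filter (fun w => lk b c p w ∈ pat E s)).card : ℝ) ≤ ((univ.filter (fun w : Fin k => s ∘ lk b c p w ∈ E)).card : ℝ) := by
        norm_cast
        refine card_le_card fun w hw => ?_
        exact mem_filter.2 ⟨mem_univ _, (mem_filter.1 (mem_filter.1 hw).2).2.2⟩
      have h4 : 9 / 10 ≤ ((univ.filter (fun w : Fin k => s ∘ lk b c p w ∈ E)).card : ℝ) / k := by
        rw [le_div_iff₀ (by linarith)]; linarith
      linarith [hL.2]

lemma ext_of_FText {r s' : ℕ} (hn : n = 3 * r + s') (hs1 : 1 ≤ s') (hs3 : s' ≤ 3) (hE : DegH n r s' E)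
    (h : SG ε E t0 s) (hε : 0 < ε) (hε1 : ε ≤ 1 / 10 ^ 14) (hk : 10 ^ 16 ≤ k) (hbig : 10 ^ 16 ≤ n)
    (hF : FText (1 / 10 ^ 13) (pat E s)) : HasPM E := by
  obtain ⟨b, W, hsz, hav, hlo, hbad⟩ := hF
  have hkR : (10 ^ 16 : ℝ) ≤ k := by exact_mod_cast hk
  have hnR : (10 ^ 16 : ℝ) ≤ n := by exact_mod_cast hbig
  have hk0 : (0 : ℝ) < k := by linarith
  have hn0 : (0 : ℝ) < n := by linarith
  have hD : ∀ c, ∃ D : Finset (Fin k), (D.card : ℝ) ≤ 1 / 10 ^ 13 * k + 2 ∧ (c ≠ 0 → ∀ p, p ∉ D → (s p ∈ Wx E (s ∘ b) c ↔ p ∈ W c)) := by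
    intro c
    by_cases hc : c = 0
    · exact ⟨∅, by simp; positivity, fun h => absurd hc h⟩
    · obtain ⟨D, h1, h2⟩ := ftd h hε (hε1.trans (by norm_num)) (by omega) (by omega) (1 / 10 ^ 13) (by norm_num) b W c hc
        (hsz c hc) (hlo c hc) (hbad c hc)
      exact ⟨D, h1, fun _ => h2⟩
  choose D hD1 hD2 using hD
  refine ExtH.hasPM (r := r) (s := s') (W := Wx E (s ∘ b)) ⟨hn, hs1, hs3, hbig, hE, ?_, ?_⟩
  · intro c hc
    have h1 := abs_le.1 (h.W (by omega) (by omega) c b)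
    have h2 := abs_le.1 (hsz c hc)
    set S := univ.filter (fun p : Fin k => s p ∈ Wx E (s ∘ b) c) with hS
    have h3 : (S.card : ℝ) ≤ (W c).card + (D c).card := by
      have : S ⊆ W c ∪ D c := by
        intro p hp
        have hp := (mem_filter.1 hp).2
        by_cases hpD : p ∈ D c
        · exact mem_union_right _ hpD
        · exact mem_union_left _ ((hD2 c hc p hpD).1 hp)
      exact_mod_cast (card_le_card this).trans (card_union_le _ _)
    have h4 : ((W c).card : ℝ) ≤ S.card + (D c).card := by
      have : W c ⊆ S ∪ D c := by
        intro p hp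
        by_cases hpD : p ∈ D c
        · exact mem_union_right _ hpD
        · exact mem_union_left _ (mem_filter.2 ⟨mem_univ _, (hD2 c hc p hpD).2 hp⟩)
      exact_mod_cast (card_le_card this).trans (card_union_le _ _)
    have h5 := hD1 c
    have h6 : (S.card : ℝ) / k ≤ 1 / 3 + 21 / 10 ^ 14 := by
      rw [div_le_iff₀ hk0]; linarith
    have h7 : 1 / 3 - 21 / 10 ^ 14 ≤ (S.card : ℝ) / k := by
      rw [le_div_iff₀ hk0]; linarith
    have h8 : ((Wx E (s ∘ b) c).card : ℝ) / n ≤ 1 / 3 + 22 / 10 ^ 14 := by linarith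
    have h9 : 1 / 3 - 22 / 10 ^ 14 ≤ ((Wx E (s ∘ b) c).card : ℝ) / n := by linarith
    rw [div_le_iff₀ hn0] at h8
    rw [le_div_iff₀ hn0] at h9
    rw [← le_div_iff₀ (by positivity), abs_le]
    constructor <;> linarith
  · have h1 := abs_le.1 (h.A b)
    set S := univ.filter (fun ψ : Fin 4 → Fin k => s ∘ ψ ∈ E ∧ ∀ c, c ≠ 0 → s (ψ c) ∉ Wx E (s ∘ b) c) with hS
    have hsub : S ⊆ ((pat E s).filter (fun e => ∀ c, c ≠ 0 → e c ∉ W c)) ∪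
        ((univ.filter (fun g : Fin 4 → Fin k => ¬ Function.Injective g)) ∪
        ((univ.filter (fun e : Fin 4 → Fin k => e 1 ∈ D 1)) ∪ ((univ.filter (fun e : Fin 4 → Fin k => e 2 ∈ D 2)) ∪
        (univ.filter (fun e : Fin 4 → Fin k => e 3 ∈ D 3))))) := by
      intro e he
      obtain ⟨x1, x2⟩ := (mem_filter.1 he).2
      simp only [mem_union, mem_filter, mem_univ, true_and]
      by_contra hcon
      push Not at hcon
      obtain ⟨y1, y2, y3, y4, y5⟩ := hcon
      obtain ⟨c, hc, hcW⟩ := y1 (mem_filter.2 ⟨mem_univ _, y2, x1⟩)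
      refine x2 c hc ((hD2 c hc _ ?_).2 hcW)
      fin_cases c
      · exact absurd rfl hc
      · exact y3
      · exact y4
      · exact y5
    have hci : ∀ c, ((univ.filter (fun e : Fin 4 → Fin k => e c ∈ D c)).card : ℝ) ≤ k ^ 3 * (1 / 10 ^ 13 * k + 2) := by
      intro c
      have : ((univ.filter (fun e : Fin 4 → Fin k => e c ∈ D c)).card : ℝ) ≤ k ^ 3 * (D c).card := by
        exact_mod_cast card_in c (D c)
      exact this.trans (mul_le_mul_of_nonneg_left (hD1 c) (by positivity))
    have hcard := (card_le_card hsub).trans ((card_union_le _ _).trans (Nat.add_le_add_left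
      ((card_union_le _ _).trans (Nat.add_le_add_left ((card_union_le _ _).trans (Nat.add_le_add_left
        (card_union_le _ _) _)) _)) _))
    have hcard' : (S.card : ℝ) ≤ (((pat E s).filter (fun e => ∀ c, c ≠ 0 → e c ∉ W c)).card : ℝ) +
        (((univ.filter (fun g : Fin 4 → Fin k => ¬ Function.Injective g)).card : ℝ) +
        (((univ.filter (fun e : Fin 4 → Fin k => e 1 ∈ D 1)).card : ℝ) +
        (((univ.filter (fun e : Fin 4 → Fin k => e 2 ∈ D 2)).card : ℝ) +
        ((univ.filter (fun e : Fin 4 → Fin k => e 3 ∈ D 3)).card : ℝ)))) := by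
      exact_mod_cast hcard
    have g1 := hci 1
    have g2 := hci 2
    have g3 := hci 3
    have g4 := noninj4 k (by omega)
    have hk3 : (0 : ℝ) ≤ (k : ℝ) ^ 3 := by positivity
    have hk4 : (10 : ℝ) ^ 16 * k ^ 3 ≤ (k : ℝ) ^ 4 := by
      have := mul_le_mul_of_nonneg_right hkR hk3
      calc (10 : ℝ) ^ 16 * k ^ 3 ≤ k * k ^ 3 := this
        _ = k ^ 4 := by ring
    have hS4 : (S.card : ℝ) ≤ 5 / 10 ^ 13 * k ^ 4 := by
      have : (k : ℝ) ^ 3 * (1 / 10 ^ 13 * k + 2) = 1 / 10 ^ 13 * k ^ 4 + 2 * k ^ 3 := by ring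
      rw [this] at g1 g2 g3
      linarith
    have g5 : (S.card : ℝ) / k ^ 4 ≤ 5 / 10 ^ 13 := by
      rw [div_le_iff₀ (by positivity)]; exact hS4
    have g6 : ((Av E (Wx E (s ∘ b))).card : ℝ) / n ^ 4 ≤ 1 / 10 ^ 12 := by linarith
    rw [div_le_iff₀ (by positivity)] at g6
    have : (0 : ℝ) ≤ (n : ℝ) ^ 4 := by positivity
    linarith

end RPM

open Finset
namespace RPM
open scoped Classical

theorem core : ∃ n0 : ℕ, ∀ n, n0 ≤ n → ∀ r s : ℕ, n = 3 * r + s → 1 ≤ s → s ≤ 3 →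
    ∀ (E : Finset (Fin 4 → Fin n)) (t0 : Fin n), DegH n r s E → (∀ j, j ≠ t0 → (fun _ => j) ∈ E) → HasPM E := by
  obtain ⟨ε0, h01, h02, k0, hFT⟩ := FT2 (1 / 10 ^ 13) (by norm_num) (by norm_num)
  set ε : ℝ := min (ε0 / 3) (1 / 10 ^ 14) with hε
  have hε0 : 0 < ε := lt_min (by positivity) (by positivity)
  have hε1 : ε ≤ 1 / 10 ^ 14 := min_le_right _ _
  have hε2 : 3 * ε ≤ ε0 := by have : ε ≤ ε0 / 3 := min_le_left _ _; linarith
  obtain ⟨k1, hS⟩ := samp_fam (Fin 5 × Fin 4) ε hε0 (hε1.trans (by norm_num))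
  set k : ℕ := k0 + k1 + 10 ^ 16 + ⌈16 / ε⌉₊ with hk
  obtain ⟨n1, hA⟩ := asm k
  refine ⟨n1 + 10 ^ 16 + ⌈3 / ε⌉₊ + 8 * k ^ 2, fun n hn r s hrs hs1 hs3 E t0 hE hdiag => ?_⟩
  by_contra hno
  apply hno
  have hkbig : 10 ^ 16 ≤ k := by omega
  have hnbig : 10 ^ 16 ≤ n := by omega
  have hkR : (10 ^ 16 : ℝ) ≤ k := by exact_mod_cast hkbig
  have hnR : (10 ^ 16 : ℝ) ≤ n := by exact_mod_cast hnbig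
  have hn8 : 8 * (k : ℝ) ^ 2 ≤ n := by
    have : 8 * k ^ 2 ≤ n := by omega
    exact_mod_cast this
  have hn0 : (0 : ℝ) < n := by linarith
  have hb : 3 ≤ ε * n := by
    have h1 : ⌈3 / ε⌉₊ ≤ n := by omega
    have h2 : 3 / ε ≤ n := (Nat.le_ceil _).trans (by exact_mod_cast h1)
    rw [div_le_iff₀ hε0] at h2; linarith
  have hbk : 16 ≤ ε * k := by
    have h1 : ⌈16 / ε⌉₊ ≤ k := by omega
    have h2 : 16 / ε ≤ k := (Nat.le_ceil _).trans (by exact_mod_cast h1)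
    rw [div_le_iff₀ hε0] at h2; linarith
  refine hA n (by omega) E t0 hdiag ?_
  have hgood : ∀ s : Fin k → Fin n, Function.Injective s → (∀ p, s p ≠ t0) → SG ε E t0 s →
      ∃ P T N, Solv P T N ∧ Fits E t0 s P T := by
    intro s hsi hst hsg
    have hdeg : DegP (3 * ε) (pat E s) := pat_deg hrs hs1 hs3 hE hsg hε0 (by omega) hb (by linarith)
    have hdeg' : DegP ε0 (pat E s) := by
      intro c hc i a hia
      refine le_trans ?_ (hdeg c hc i a hia)
      gcongr
    obtain ⟨T, hT⟩ := pat_T hrs hs1 hs3 hE hsg hε0 (hε1.trans (by norm_num)) (by omega) hb hbk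
    obtain ⟨hL, hne⟩ := degP_lat ε0 h02 (by omega) hdeg'
    rcases hFT k (by omega) (pat E s) hdeg' with hx | ⟨w, hw, hw1⟩
    · exact absurd (ext_of_FText hrs hs1 hs3 hE hsg hε0 hε1 hkbig hnbig hx) hno
    · obtain ⟨N, hN⟩ := solv_of (pat E s) (fun e he => (mem_filter.1 he).2.1) (by omega) hL hne w hw hw1 T (fun c => (hT c).1)
      exact ⟨pat E s, T, N, hN, hsi, hst, fun e he => (mem_filter.1 he).2.2, fun c => (hT c).2⟩
  have hS' := hS k (by omega) n (by omega) (QF E t0)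
  have h1 := card_not_inj k n
  have h2 := hit_t0 k t0
  set B1 := ((univ : Finset (Fin k → Fin n)).filter (fun g => ¬ Function.Injective g)) with hB1
  set B2 := ((univ : Finset (Fin k → Fin n)).filter (fun s => ∃ p, s p = t0)) with hB2
  set B3 := ((univ : Finset (Fin k → Fin n)).filter (fun s => ∃ j, ∃ φ : Fin 4 → Fin k,
      ε < |(((univ : Finset (Fin 4 → Fin k)).filter (fun ψ => QF E t0 j (s ∘ φ) (s ∘ ψ))).card : ℝ) / k ^ 4
        - (((univ : Finset (Fin 4 → Fin n)).filter (fun y => QF E t0 j (s ∘ φ) y)).card : ℝ) / n ^ 4|)) with hB3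
  set G := (univ.filter (fun s : Fin k → Fin n => ∃ P T N, Solv P T N ∧ Fits E t0 s P T)) with hG
  have hcov : (univ : Finset (Fin k → Fin n)) ⊆ G ∪ (B1 ∪ (B2 ∪ B3)) := by
    intro s _
    simp only [mem_union]
    by_contra hcon
    push Not at hcon
    obtain ⟨y1, y2, y3, y4⟩ := hcon
    apply y1
    refine mem_filter.2 ⟨mem_univ _, hgood s ?_ ?_ ?_⟩
    · by_contra hh; exact y2 (mem_filter.2 ⟨mem_univ _, hh⟩)
    · intro p hp; exact y3 (mem_filter.2 ⟨mem_univ _, p, hp⟩)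
    · intro j φ
      by_contra hh
      push Not at hh
      exact y4 (mem_filter.2 ⟨mem_univ _, j, φ, hh⟩)
  have hc := (card_le_card hcov).trans ((card_union_le _ _).trans (Nat.add_le_add_left
      ((card_union_le _ _).trans (Nat.add_le_add_left (card_union_le _ _) _)) _))
  have hc' : (n : ℝ) ^ k ≤ (G.card : ℝ) + (B1.card + (B2.card + B3.card)) := by
    rw [card_univ, Fintype.card_fun, Fintype.card_fin, Fintype.card_fin] at hc
    exact_mod_cast hc
  have hp : (0 : ℝ) < (n : ℝ) ^ k := by positivity
  have hb1 : (B1.card : ℝ) ≤ 1 / 8 * n ^ k := by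
    have : (B1.card : ℝ) * n ≤ k ^ 2 * n ^ k := by exact_mod_cast h1
    refine le_of_mul_le_mul_right (this.trans ?_) hn0
    have := mul_le_mul_of_nonneg_right hn8 hp.le
    linarith
  have hb2 : (B2.card : ℝ) ≤ 1 / 8 * n ^ k := by
    have h3 : (B2.card : ℝ) * n ≤ k * n ^ k := by exact_mod_cast h2
    refine le_of_mul_le_mul_right (h3.trans ?_) hn0
    have h4 : 8 * (k : ℝ) ≤ n := by nlinarith
    have := mul_le_mul_of_nonneg_right h4 hp.le
    linarith
  have hb3 : (B3.card : ℝ) ≤ 1 / 8 * n ^ k := by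
    refine hS'.trans (mul_le_mul_of_nonneg_right (hε1.trans (by norm_num)) hp.le)
  linarith

end RPM

open Finset
namespace RPM
open scoped Classical

lemma pm_index {n : ℕ} {M : Finset (Fin 4 → Fin n)} (hM : IsM M) (hc : M.card = n) :
    ∃ m : Fin n → Fin 4 → Fin n, (∀ i, m i ∈ M) ∧ (∀ i, m i 0 = i) ∧ (∀ c, Function.Bijective (fun i => m i c)) ∧
      ∀ e ∈ M, m (e 0) = e := by
  have hinj : ∀ e ∈ M, ∀ f ∈ M, ∀ c, e c = f c → e = f := by
    intro e he f hf c h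
    by_contra hne
    exact hM e he f hf hne c h
  have h1 : M.image (fun e => e 0) = univ := by
    apply eq_univ_of_card
    rw [card_image_of_injOn (fun e he f hf h => hinj e he f hf 0 h), hc, Fintype.card_fin]
  have h2 : ∀ i, ∃ e ∈ M, e 0 = i := by
    intro i
    have := h1 ▸ mem_univ i
    obtain ⟨e, he, h⟩ := mem_image.1 this
    exact ⟨e, he, h⟩
  choose m hm1 hm2 using h2
  refine ⟨m, hm1, hm2, fun c => ?_, fun e he => hinj _ (hm1 _) _ he 0 (hm2 _)⟩
  apply Function.Injective.bijective_of_finite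
  intro i j h
  have := hinj _ (hm1 i) _ (hm1 j) c h
  rw [← hm2 i, ← hm2 j, this]

theorem main_tuple : ∃ n0 : ℕ, ∀ n, n0 ≤ n → ∀ r s : ℕ, n = 3 * r + s → 1 ≤ s → s ≤ 3 →
    ∀ (E : Finset (Fin 4 → Fin n)), DegH n r s E → HasPM E := by
  obtain ⟨n0, h0⟩ := core
  refine ⟨n0, fun n hn r s hrs hs1 hs3 E hE => ?_⟩
  by_contra hno
  obtain ⟨E', hE', hmax⟩ := (univ.filter (fun F : Finset (Fin 4 → Fin n) => E ⊆ F ∧ ¬ HasPM F)).exists_max_image card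
    ⟨E, mem_filter.2 ⟨mem_univ _, Subset.refl _, hno⟩⟩
  obtain ⟨hsub, hno'⟩ := (mem_filter.1 hE').2
  have hT : ∃ T, T ∉ E' := by
    by_contra hcon
    push Not at hcon
    exact hno' (hasPM_of_bij (fun (j : Fin n) _ => j) (fun j => hcon _) (fun c => Function.bijective_id))
  obtain ⟨T, hT⟩ := hT
  have hins : HasPM (insert T E') := by
    by_contra hcon
    have := hmax (insert T E') (mem_filter.2 ⟨mem_univ _, hsub.trans (subset_insert _ _), hcon⟩)
    rw [card_insert_of_notMem hT] at this
    omega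
  obtain ⟨M, hM1, hM2, hM3⟩ := hins
  obtain ⟨m, m1, m2, m3, m4⟩ := pm_index hM2 hM3
  have hTM : T ∈ M := by
    by_contra hcon
    refine hno' ⟨M, fun e he => ?_, hM2, hM3⟩
    rcases mem_insert.1 (hM1 he) with h | h
    · exact absurd (h ▸ he) hcon
    · exact h
  set Φ : (Fin 4 → Fin n) → (Fin 4 → Fin n) := fun e c => m (e c) c with hΦ
  have hΦi : Function.Injective Φ := by
    intro e f h
    funext c
    exact (m3 c).1 (congrFun h c)
  have hpm := h0 n hn r s hrs hs1 hs3 (univ.filter (fun e => Φ e ∈ E')) (T 0) ?_ ?_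
  · obtain ⟨M', a1, a2, a3⟩ := hpm
    refine hno' ⟨M'.image Φ, ?_, ?_, ?_⟩
    · intro e he
      obtain ⟨f, hf, rfl⟩ := mem_image.1 he
      exact (mem_filter.1 (a1 hf)).2
    · intro e he e' he' hne c hc
      obtain ⟨f, hf, rfl⟩ := mem_image.1 he
      obtain ⟨f', hf', rfl⟩ := mem_image.1 he'
      refine a2 f hf f' hf' (fun h => hne (by rw [h])) c ((m3 c).1 hc)
    · rw [card_image_of_injective _ hΦi, a3]
  · intro c hc i v
    refine le_trans (Nat.add_le_add_right ?_ 1) (hE c hc (m i 0) (m v c))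
    refine card_le_card_of_injOn Φ ?_ (hΦi.injOn)
    intro e he
    obtain ⟨x1, x2, x3⟩ := (mem_filter.1 he).2
    refine mem_filter.2 ⟨mem_univ _, ?_, ?_, fun h => x3 (mem_filter.2 ⟨mem_univ _, hsub h⟩)⟩
    · rw [← x1]
    · rw [← x2]
  · intro j hj
    refine mem_filter.2 ⟨mem_univ _, ?_⟩
    have : Φ (fun _ => j) = m j := rfl
    rw [this]
    rcases mem_insert.1 (hM1 (m1 j)) with h | h
    · exact absurd (by rw [← h, m2]) hj
    · exact h

end RPM

open Finset

namespace RPM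

lemma part_eq {α : Type} [DecidableEq α] {V1 V2 V3 : Finset α} {F : Finset (Finset α)}
    (h : IsPartite3 V1 V2 V3 F) {f : Finset α} (hf : f ∈ F) : ∃ a ∈ V1, ∃ b ∈ V2, ∃ c ∈ V3, f = {a, b, c} ∧
      (∀ x ∈ f, x ∈ V1 → x = a) ∧ (∀ x ∈ f, x ∈ V2 → x = b) ∧ (∀ x ∈ f, x ∈ V3 → x = c) := by
  obtain ⟨h0, h1, h2, h3⟩ := h f hf
  obtain ⟨a, ha⟩ := card_eq_one.1 h1
  obtain ⟨b, hb⟩ := card_eq_one.1 h2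
  obtain ⟨c, hc⟩ := card_eq_one.1 h3
  have ha' : a ∈ f ∩ V1 := by rw [ha]; simp
  have hb' : b ∈ f ∩ V2 := by rw [hb]; simp
  have hc' : c ∈ f ∩ V3 := by rw [hc]; simp
  rw [mem_inter] at ha' hb' hc'
  have k1 : ∀ x ∈ f, x ∈ V1 → x = a := fun x hx hv => by
    have : x ∈ f ∩ V1 := mem_inter.2 ⟨hx, hv⟩
    rw [ha] at this; simpa using this
  have k2 : ∀ x ∈ f, x ∈ V2 → x = b := fun x hx hv => by
    have : x ∈ f ∩ V2 := mem_inter.2 ⟨hx, hv⟩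
    rw [hb] at this; simpa using this
  have k3 : ∀ x ∈ f, x ∈ V3 → x = c := fun x hx hv => by
    have : x ∈ f ∩ V3 := mem_inter.2 ⟨hx, hv⟩
    rw [hc] at this; simpa using this
  refine ⟨a, ha'.2, b, hb'.2, c, hc'.2, ?_, k1, k2, k3⟩
  ext x
  simp only [mem_insert, mem_singleton]
  constructor
  · intro hx
    have := h0 hx
    simp only [mem_union] at this
    rcases this with (h | h) | h
    · exact Or.inl (k1 x hx h)
    · exact Or.inr (Or.inl (k2 x hx h))
    · exact Or.inr (Or.inr (k3 x hx h))
  · rintro (rfl | rfl | rfl)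
    · exact ha'.1
    · exact hb'.1
    · exact hc'.1

lemma exists_param {α : Type} {n : ℕ} (V : Finset α) (h : V.card = n) :
    ∃ g : Fin n → α, Function.Injective g ∧ (∀ i, g i ∈ V) ∧ ∀ x ∈ V, ∃ i, g i = x := by
  have e := (Finset.equivFinOfCardEq h).symm
  refine ⟨fun i => (e i).1, fun i j hij => e.injective (Subtype.ext hij), fun i => (e i).2, fun x hx => ?_⟩
  exact ⟨e.symm ⟨x, hx⟩, by simp⟩

end RPM

theorem rainbow_perfect_matching_threshold :
    ∃ n0 : ℕ, ∀ n : ℕ, n0 ≤ n → ∀ r s : ℕ, n = 3 * r + s → 1 ≤ s → s ≤ 3 →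
      ∀ (α : Type) [DecidableEq α], ∀ V1 V2 V3 : Finset α,
        Disjoint V1 V2 → Disjoint V1 V3 → Disjoint V2 V3 →
        V1.card = n → V2.card = n → V3.card = n →
        ∀ F : Fin n → Finset (Finset α),
          (∀ i, IsPartite3 V1 V2 V3 (F i)) →
          (∀ i, ∀ v ∈ V1 ∪ V2 ∪ V3, deltaLM n r s < hdeg (F i) v) →
          ∃ e : Fin n → Finset α,
            (∀ i, e i ∈ F i) ∧
            (∀ i j, i ≠ j → Disjoint (e i) (e j)) ∧
            (∀ v ∈ V1 ∪ V2 ∪ V3, ∃ i, v ∈ e i) := by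
  obtain ⟨n0, h0⟩ := RPM.main_tuple
  refine ⟨n0, fun n hn r s hrs hs1 hs3 α _ V1 V2 V3 d12 d13 d23 c1 c2 c3 F hF hdg => ?_⟩
  obtain ⟨g1, g1i, g1m, g1s⟩ := RPM.exists_param V1 c1
  obtain ⟨g2, g2i, g2m, g2s⟩ := RPM.exists_param V2 c2
  obtain ⟨g3, g3i, g3m, g3s⟩ := RPM.exists_param V3 c3
  set Ψ : (Fin 4 → Fin n) → Finset α := fun e => {g1 (e 1), g2 (e 2), g3 (e 3)} with hΨ
  set E : Finset (Fin 4 → Fin n) := univ.filter (fun e => Ψ e ∈ F (e 0)) with hEdef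
  have key : ∀ (c : Fin 4) (x : α) (i v : Fin n), (∀ e : Fin 4 → Fin n, e 0 = i → Ψ e ∈ F i → x ∈ Ψ e → e c = v) →
      hdeg (F i) x ≤ (E.filter (fun e => e 0 = i ∧ e c = v)).card := by
    intro c x i v hx
    unfold hdeg
    refine le_trans (card_le_card ?_) (card_image_le (f := Ψ))
    intro f hf
    obtain ⟨hf1, hf2⟩ := mem_filter.1 hf
    obtain ⟨a, ha, b, hb, d, hd, hfe, -⟩ := RPM.part_eq (hF i) hf1
    obtain ⟨a', rfl⟩ := g1s a ha
    obtain ⟨b', rfl⟩ := g2s b hb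
    obtain ⟨d', rfl⟩ := g3s d hd
    have hΨe : Ψ ![i, a', b', d'] = f := by rw [hfe]; rfl
    refine mem_image.2 ⟨![i, a', b', d'], mem_filter.2 ⟨mem_filter.2 ⟨mem_univ _, ?_⟩, rfl, ?_⟩, hΨe⟩
    · rw [hΨe]; exact hf1
    · exact hx _ rfl (hΨe ▸ hf1) (hΨe ▸ hf2)
  have hd12 : ∀ i j, g1 i ≠ g2 j := fun i j h => disjoint_left.1 d12 (g1m i) (h ▸ g2m j)
  have hd13 : ∀ i j, g1 i ≠ g3 j := fun i j h => disjoint_left.1 d13 (g1m i) (h ▸ g3m j)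
  have hd23 : ∀ i j, g2 i ≠ g3 j := fun i j h => disjoint_left.1 d23 (g2m i) (h ▸ g3m j)
  have hm1 : ∀ v e, g1 v ∈ Ψ e ↔ e 1 = v := by
    intro v e
    simp only [hΨ, mem_insert, mem_singleton, hd12, hd13, or_false]
    exact ⟨fun h => (g1i h).symm, fun h => by rw [h]⟩
  have hm2 : ∀ v e, g2 v ∈ Ψ e ↔ e 2 = v := by
    intro v e
    simp only [hΨ, mem_insert, mem_singleton, (hd12 _ _).symm, hd23, or_false, false_or]
    exact ⟨fun h => (g2i h).symm, fun h => by rw [h]⟩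
  have hm3 : ∀ v e, g3 v ∈ Ψ e ↔ e 3 = v := by
    intro v e
    simp only [hΨ, mem_insert, mem_singleton, (hd13 _ _).symm, (hd23 _ _).symm, false_or]
    exact ⟨fun h => (g3i h).symm, fun h => by rw [h]⟩
  have hDeg : RPM.DegH n r s E := by
    refine RPM.degH_of_deg hrs hs1 hs3 fun c hc i v => ?_
    have hcs : c = 1 ∨ c = 2 ∨ c = 3 := by
      revert hc; revert c; decide
    rcases hcs with rfl | rfl | rfl
    · refine lt_of_lt_of_le (hdg i (g1 v) (by simp [g1m])) (key 1 _ i v fun e _ _ h => (hm1 v e).1 h)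
    · refine lt_of_lt_of_le (hdg i (g2 v) (by simp [g2m])) (key 2 _ i v fun e _ _ h => (hm2 v e).1 h)
    · refine lt_of_lt_of_le (hdg i (g3 v) (by simp [g3m])) (key 3 _ i v fun e _ _ h => (hm3 v e).1 h)
  obtain ⟨M, hM1, hM2, hM3⟩ := h0 n hn r s hrs hs1 hs3 E hDeg
  obtain ⟨m, m1, m2, m3, -⟩ := RPM.pm_index hM2 hM3
  refine ⟨fun i => Ψ (m i), fun i => ?_, fun i j hij => ?_, fun v hv => ?_⟩
  · have := (mem_filter.1 (hM1 (m1 i))).2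
    rwa [m2] at this
  · have hne : ∀ c, m i c ≠ m j c := fun c h => hij ((m3 c).1 h)
    rw [disjoint_left]
    intro x hx hx'
    have hx0 := hx
    simp only [hΨ, mem_insert, mem_singleton] at hx0
    rcases hx0 with rfl | rfl | rfl
    · exact hne 1 ((hm1 _ _).1 hx').symm
    · exact hne 2 ((hm2 _ _).1 hx').symm
    · exact hne 3 ((hm3 _ _).1 hx').symm
  · simp only [mem_union] at hv
    rcases hv with (h | h) | h
    · obtain ⟨w, rfl⟩ := g1s v h
      obtain ⟨i, hi⟩ := (m3 1).2 w
      exact ⟨i, (hm1 _ _).2 hi⟩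
    · obtain ⟨w, rfl⟩ := g2s v h
      obtain ⟨i, hi⟩ := (m3 2).2 w
      exact ⟨i, (hm2 _ _).2 hi⟩
    · obtain ⟨w, rfl⟩ := g3s v h
      obtain ⟨i, hi⟩ := (m3 3).2 w
      exact ⟨i, (hm3 _ _).2 hi⟩
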